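/- Let p ∈ (1,∞) and let T be a Calderón–Zygmund operator with normalised standard kernel of Hölder exponent γ. Then the operator Φ̃_s satisfies, for every s ∈ ℕ and every f ∈ L^p(ℝⁿ) with finite Haar expansion, ‖Φ̃_s f‖_{L^p} ≤ C (1+s) 2^{−s·min(γ,1/2,1/p′)} ‖f‖_{L^p}, with C depending only on n, p, γ, and p′ the conjugate exponent of p. -/

import Mathlib

open MeasureTheory

noncomputable section

open Classical in
/-- Classical indicator of a proposition. -/
def indR (P : Prop) : ℝ := if P then 1 else 0

/-- The real sign associated to a boolean. -/
def sgnB (b : Bool) : ℝ := if b then 1 else -1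

/-- The `ℓ∞` norm of an integer vector, as a real number. -/
def inorm {n : ℕ} (m : Fin n → ℤ) : ℝ := ‖(fun i => (m i : ℝ) : Fin n → ℝ)‖

/-- The dyadic cube `2^{-k}([0,1)^n + m)` of generation `k` in `ℝ^n` (with the `ℓ∞` metric). -/
def dyadicCube (n : ℕ) (k : ℤ) (m : Fin n → ℤ) : Set (Fin n → ℝ) :=
  {x | ∀ i, (2:ℝ) ^ (-k) * m i ≤ x i ∧ x i < (2:ℝ) ^ (-k) * (m i + 1)}

/-- The side length `2^{-k}` of a dyadic cube of generation `k`. -/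
def sideLen (k : ℤ) : ℝ := (2:ℝ) ^ (-k)

/-- One-dimensional Haar function on the dyadic interval `2^{-k}[m, m+1)`:
the non-cancellative `h⁰` for `η = false`, the cancellative `h¹` for `η = true`. -/
def haar1D (k : ℤ) (m : ℤ) (η : Bool) (t : ℝ) : ℝ :=
  (Real.sqrt ((2:ℝ) ^ (-k)))⁻¹ *
    (if η then
        (Set.Ico ((2:ℝ) ^ (-k) * m) ((2:ℝ) ^ (-k) * (m + 1/2))).indicator 1 t
          - (Set.Ico ((2:ℝ) ^ (-k) * (m + 1/2)) ((2:ℝ) ^ (-k) * (m + 1))).indicator 1 t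
      else (Set.Ico ((2:ℝ) ^ (-k) * m) ((2:ℝ) ^ (-k) * (m + 1))).indicator 1 t)

/-- The Haar function `h^η_I` for the dyadic cube `I` indexed by `(k, m)`. -/
def haarFn (n : ℕ) (k : ℤ) (m : Fin n → ℤ) (η : Fin n → Bool) (x : Fin n → ℝ) : ℝ :=
  ∏ i, haar1D k (m i) (η i) (x i)

/-- The non-cancellative Haar function `h⁰_I = |I|^{-1/2} 1_I`. -/
def haarZero (n : ℕ) (k : ℤ) (m : Fin n → ℤ) : (Fin n → ℝ) → ℝ :=
  haarFn n k m (fun _ => false)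

/-- The pairing `⟨g, f⟩ = ∫ g f dx`. -/
def pairing {n : ℕ} (g f : (Fin n → ℝ) → ℝ) : ℝ := ∫ x, g x * f x

/-- A normalised standard kernel with Hölder exponent `γ` (with respect to the `ℓ∞` metric). -/
structure IsNormalisedKernel (n : ℕ) (γ : ℝ) (K : (Fin n → ℝ) → (Fin n → ℝ) → ℝ) : Prop where
  size : ∀ x y, x ≠ y → |K x y| ≤ dist x y ^ (-(n:ℝ))
  smooth : ∀ x y h, 2 * ‖h‖ < dist x y →
    |K (x + h) y - K x y| + |K x (y + h) - K x y| ≤ ‖h‖ ^ γ * dist x y ^ (-(n:ℝ) - γ)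

/-- The singular integral `Tf(x) = ∫ K(x,y) f(y) dy`. -/
def czIntegral {n : ℕ} (K : (Fin n → ℝ) → (Fin n → ℝ) → ℝ) (f : (Fin n → ℝ) → ℝ)
    (x : Fin n → ℝ) : ℝ := ∫ y, K x y * f y

/-- The truncated singular integral `T_ε f(x) = ∫_{|y-x|>ε} K(x,y) f(y) dy`. -/
def czTrunc {n : ℕ} (K : (Fin n → ℝ) → (Fin n → ℝ) → ℝ) (ε : ℝ) (f : (Fin n → ℝ) → ℝ)
    (x : Fin n → ℝ) : ℝ := ∫ y in {y | ε < dist x y}, K x y * f y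

/-- The dyadic conditional expectation `E_k f`. -/
def dyadicE (n : ℕ) (k : ℤ) (f : (Fin n → ℝ) → ℝ) (x : Fin n → ℝ) : ℝ :=
  (2:ℝ) ^ (k * (n:ℤ)) * ∫ y in dyadicCube n k (fun i => ⌊(2:ℝ) ^ k * x i⌋), f y

/-- The dyadic martingale difference `D_k f = E_{k+1} f - E_k f`. -/
def dyadicD (n : ℕ) (k : ℤ) (f : (Fin n → ℝ) → ℝ) (x : Fin n → ℝ) : ℝ :=
  dyadicE n (k+1) f x - dyadicE n k f x

/-- The centre of the dyadic cube indexed by `(k, m)`. -/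
def cubeCenter (n : ℕ) (k : ℤ) (m : Fin n → ℤ) : Fin n → ℝ :=
  fun i => (2:ℝ) ^ (-k) * (m i + 1/2)

/-- The concentric `c`-fold expansion of the dyadic cube indexed by `(k, m)`. -/
def expandCube (n : ℕ) (k : ℤ) (m : Fin n → ℤ) (c : ℝ) : Set (Fin n → ℝ) :=
  {x | ∀ i, |x i - cubeCenter n k m i| ≤ c * (2:ℝ) ^ (-k) / 2}

/-- The set `Σ_{f,s} = ⋃_k 9Ω_k`, where `Ω_k` is the union of the cubes `I ∈ 𝒟_k` on which
`D_{k+s} f` is not a.e. zero. -/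
def SigmaSet (n : ℕ) (f : (Fin n → ℝ) → ℝ) (s : ℕ) : Set (Fin n → ℝ) :=
  ⋃ (k : ℤ) (m : Fin n → ℤ)
    (_ : ¬ (∀ᵐ x ∂(volume.restrict (dyadicCube n k m)), dyadicD n (k + (s:ℤ)) f x = 0)),
      expandCube n k m 9

/-- The (measure-theoretic) support of a measurable function: the complement of the union of
all balls on which the function vanishes a.e. -/
def suppAE {n : ℕ} (f : (Fin n → ℝ) → ℝ) : Set (Fin n → ℝ) :=
  {x | ∀ r > 0, ¬ (∀ᵐ y ∂(volume.restrict (Metric.ball x r)), f y = 0)}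

/-- The axis-parallel closed cube with centre `c` and side length `ρ`. -/
def cube (n : ℕ) (c : Fin n → ℝ) (ρ : ℝ) : Set (Fin n → ℝ) :=
  {x | ∀ i, |x i - c i| ≤ ρ / 2}

/-- The index of the `s`-th dyadic ancestor `I^{(s)}` of the cube indexed by `(k, m)`
(the ancestor is the cube indexed by `(k - s, ancestorIdx s m)`). -/
def ancestorIdx {n : ℕ} (s : ℕ) (m : Fin n → ℤ) : Fin n → ℤ :=
  fun i => Int.fdiv (m i) (2 ^ s)

/-- The distance between two sets (in the ambient metric). -/
def setDist {α : Type*} [PseudoMetricSpace α] (A B : Set α) : ℝ :=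
  sInf (Set.image2 dist A B)

/-- The operator `Φ̃_s` of (2.9), applied to `f`; the sums over the translation parameter
`m ≠ 0` and over the dyadic cubes are pointwise (absolutely convergent) sums. -/
def PhiTildeNZ (n : ℕ) (K : (Fin n → ℝ) → (Fin n → ℝ) → ℝ) (s : ℕ)
    (f : (Fin n → ℝ) → ℝ) (x : Fin n → ℝ) : ℝ :=
  ∑' m : Fin n → ℤ, ∑ η : Fin n → Bool,
    if m = 0 ∨ η = (fun _ => false) then 0 else
      ∑' (k : ℤ) (mI : Fin n → ℤ),
        (haarZero n (k - s) (ancestorIdx s mI + m) x - haarZero n (k - s) (ancestorIdx s mI) x) *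
          pairing (haarZero n (k - s) (ancestorIdx s mI + m)) (czIntegral K (haarFn n k mI η)) *
          pairing (haarFn n k mI η) f

section

open scoped ENNReal

/-- The `ℓ^r` norm of a nonnegative function on an arbitrary index type. -/
def seqNorm {X : Type*} (r : ℝ) (u : X → ℝ≥0∞) : ℝ≥0∞ := (∑' x, u x ^ r) ^ (1 / r)

section SeqNorm
variable {X : Type*}

lemma seqNorm_rpow {r : ℝ} (hr : 0 < r) (u : X → ℝ≥0∞) :
    seqNorm r u ^ r = ∑' x, u x ^ r := by
  rw [seqNorm, ← ENNReal.rpow_mul, one_div_mul_cancel hr.ne', ENNReal.rpow_one]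

lemma seqNorm_mono {r : ℝ} (hr : 0 < r) {u v : X → ℝ≥0∞} (h : ∀ x, u x ≤ v x) :
    seqNorm r u ≤ seqNorm r v := by
  unfold seqNorm
  gcongr with x
  exact h x

lemma seqNorm_const_mul {r : ℝ} (hr : 0 < r) (c : ℝ≥0∞) (u : X → ℝ≥0∞) :
    seqNorm r (fun x => c * u x) = c * seqNorm r u := by
  unfold seqNorm
  simp_rw [ENNReal.mul_rpow_of_nonneg _ _ hr.le, ENNReal.tsum_mul_left]
  rw [ENNReal.mul_rpow_of_nonneg _ _ (by positivity), ← ENNReal.rpow_mul,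
    mul_one_div_cancel hr.ne', ENNReal.rpow_one]

lemma seqNorm_comp_rpow {r a : ℝ} (hr : 0 < r) (ha : 0 < a) (u : X → ℝ≥0∞) :
    seqNorm r (fun x => u x ^ a) = seqNorm (a * r) u ^ a := by
  unfold seqNorm
  rw [← ENNReal.rpow_mul]
  simp_rw [← ENNReal.rpow_mul]
  congr 1
  field_simp

lemma tsum_mul_le_seqNorm {p q : ℝ} (h : p.HolderConjugate q) (u v : X → ℝ≥0∞) :
    ∑' x, u x * v x ≤ seqNorm p u * seqNorm q v := by
  let : MeasurableSpace X := ⊤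
  have := ENNReal.lintegral_mul_le_Lp_mul_Lq Measure.count h (f := u) (g := v)
    (measurable_from_top).aemeasurable (measurable_from_top).aemeasurable
  simpa [lintegral_count, seqNorm] using this

lemma tsum_mul_rpow_le {r : ℝ} (hr : 1 ≤ r) (u v : X → ℝ≥0∞) :
    ∑' x, u x * v x ^ (r - 1) ≤ seqNorm r u * seqNorm r v ^ (r - 1) := by
  rcases hr.eq_or_lt with rfl | hr
  · simp [seqNorm]
  · have hc : r.HolderConjugate r.conjExponent := Real.HolderConjugate.conjExponent hr
    refine (tsum_mul_le_seqNorm hc _ _).trans ?_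
    rw [seqNorm_comp_rpow hc.symm.pos (by linarith),
      show (r - 1) * r.conjExponent = r from hc.sub_one_mul_conj]

lemma seqNorm_add_le {r : ℝ} (hr : 1 ≤ r) (u v : X → ℝ≥0∞) :
    seqNorm r (fun x => u x + v x) ≤ seqNorm r u + seqNorm r v := by
  let : MeasurableSpace X := ⊤
  have := ENNReal.lintegral_Lp_add_le (μ := Measure.count) (f := u) (g := v)
    (measurable_from_top).aemeasurable (measurable_from_top).aemeasurable hr
  simpa [lintegral_count, seqNorm] using this

lemma seqNorm_zero {r : ℝ} (hr : 0 < r) : seqNorm r (fun _ : X => 0) = 0 := by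
  simp [seqNorm, hr]

lemma seqNorm_sum_le {ι : Type*} {r : ℝ} (hr : 1 ≤ r) (s : Finset ι) (u : ι → X → ℝ≥0∞) :
    seqNorm r (fun x => ∑ i ∈ s, u i x) ≤ ∑ i ∈ s, seqNorm r (u i) := by
  classical
  induction s using Finset.induction_on with
  | empty => simp [seqNorm_zero (X := X) (zero_lt_one.trans_le hr)]
  | insert i s hi ih =>
    simp_rw [Finset.sum_insert hi]
    exact (seqNorm_add_le hr _ _).trans (by gcongr)

/-- Monotone convergence for the `ℓ^r` norm of a series. -/
lemma tsum_tsum_rpow_le {r : ℝ} (u : ℕ → X → ℝ≥0∞) {B : ℝ≥0∞}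
    (h : ∀ L, ∑' x, (∑ i ∈ Finset.range L, u i x) ^ r ≤ B) :
    ∑' x, (∑' i, u i x) ^ r ≤ B := by
  rw [ENNReal.tsum_eq_iSup_sum]
  refine iSup_le fun s => ?_
  have : Filter.Tendsto (fun L => ∑ x ∈ s, (∑ i ∈ Finset.range L, u i x) ^ r) Filter.atTop
      (nhds (∑ x ∈ s, (∑' i, u i x) ^ r)) := by
    refine tendsto_finsetSum _ fun x _ => ?_
    exact ((ENNReal.continuous_rpow_const).tendsto _).comp
      (ENNReal.tendsto_nat_tsum fun i => u i x)
  exact le_of_tendsto' this fun L => (ENNReal.sum_le_tsum s).trans (h L)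

lemma seqNorm_le_iff {r : ℝ} (hr : 0 < r) (u : X → ℝ≥0∞) (B : ℝ≥0∞) :
    seqNorm r u ≤ B ↔ ∑' x, u x ^ r ≤ B ^ r := by
  rw [← seqNorm_rpow hr, ENNReal.rpow_le_rpow_iff hr]

lemma seqNorm_tsum_le_of {r : ℝ} (hr : 0 < r) (u : ℕ → X → ℝ≥0∞) {B : ℝ≥0∞}
    (h : ∀ L, seqNorm r (fun x => ∑ i ∈ Finset.range L, u i x) ≤ B) :
    seqNorm r (fun x => ∑' i, u i x) ≤ B := by
  rw [seqNorm_le_iff hr]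
  exact tsum_tsum_rpow_le u fun L => (seqNorm_le_iff hr _ _).1 (h L)

lemma seqNorm_tsum_le {r : ℝ} (hr : 1 ≤ r) (u : ℕ → X → ℝ≥0∞) :
    seqNorm r (fun x => ∑' i, u i x) ≤ ∑' i, seqNorm r (u i) :=
  seqNorm_tsum_le_of (by linarith) u fun _ =>
    (seqNorm_sum_le hr _ u).trans (ENNReal.sum_le_tsum _)

lemma rpow_add_le_tangent {r : ℝ} (hr : 1 ≤ r) (a b : ℝ≥0∞) :
    (a + b) ^ r ≤ b ^ r + ENNReal.ofReal r * (a * (a + b) ^ (r - 1)) := by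
  have hr0 : 0 < r := by linarith
  rcases eq_or_ne a ⊤ with rfl | ha
  · rcases hr.eq_or_lt with rfl | h
    · simp
    · simp [hr0, sub_pos.2 h]
  rcases eq_or_ne b ⊤ with rfl | hb
  · simp [hr0]
  lift a to NNReal using ha
  lift b to NNReal using hb
  rcases eq_or_ne (a + b) 0 with h0 | h0
  · obtain ⟨rfl, rfl⟩ := add_eq_zero.1 h0
    simp [hr0]
  have hpos : 0 < (a:ℝ) + b := by
    have := pos_iff_ne_zero.2 h0
    exact_mod_cast this
  have key : ((a:ℝ) + b) ^ r ≤ (b:ℝ) ^ r + r * (a * ((a:ℝ) + b) ^ (r - 1)) := by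
    have hb : -1 ≤ -((a:ℝ) / (a + b)) := by
      rw [neg_le_neg_iff, div_le_one hpos]
      linarith [b.coe_nonneg]
    have := one_add_mul_self_le_rpow_one_add hb hr
    have e : 1 + -((a:ℝ) / (a + b)) = b / (a + b) := by field_simp; ring
    rw [e, Real.div_rpow b.coe_nonneg hpos.le, le_div_iff₀ (Real.rpow_pos_of_pos hpos _)] at this
    have e2 : ((a:ℝ) + b) ^ r = (a + b) * (a + b) ^ (r - 1) := by
      rw [← Real.rpow_one_add' hpos.le (by linarith)]; congr 1; ring
    have e3 : (1 + r * -((a:ℝ) / (a + b))) * (a + b) ^ r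
        = (a + b) ^ r - r * (a * (a + b) ^ (r - 1)) := by
      rw [e2]; field_simp; ring
    linarith
  have h1 : ((a : ℝ≥0∞) + b) = ENNReal.ofReal ((a:ℝ) + b) := by
    rw [ENNReal.ofReal_add a.coe_nonneg b.coe_nonneg]; simp
  rw [h1, ENNReal.ofReal_rpow_of_pos hpos, ENNReal.ofReal_rpow_of_pos hpos,
    show (a : ℝ≥0∞) = ENNReal.ofReal a by simp, show (b : ℝ≥0∞) = ENNReal.ofReal b by simp,
    ENNReal.ofReal_rpow_of_nonneg b.coe_nonneg hr0.le, ← ENNReal.ofReal_mul a.coe_nonneg,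
    ← ENNReal.ofReal_mul hr0.le,
    ← ENNReal.ofReal_add (by positivity) (by positivity)]
  exact ENNReal.ofReal_le_ofReal key

lemma sum_range_rpow_le {r : ℝ} (hr : 1 ≤ r) (a : ℕ → ℝ≥0∞) (L : ℕ) :
    (∑ i ∈ Finset.range L, a i) ^ r ≤ ENNReal.ofReal r *
      ∑ i ∈ Finset.range L, a i * (∑ j ∈ Finset.Ico i L, a j) ^ (r - 1) := by
  have hr0 : 0 < r := by linarith
  suffices h : ∀ k ≤ L, (∑ i ∈ Finset.Ico k L, a i) ^ r ≤ ENNReal.ofReal r *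
      ∑ i ∈ Finset.Ico k L, a i * (∑ j ∈ Finset.Ico i L, a j) ^ (r - 1) by
    have := h 0 (Nat.zero_le _)
    rwa [← Finset.range_eq_Ico] at this
  intro k hk
  induction hk using Nat.decreasingInduction with
  | self => simp [hr0]
  | of_succ k hk ih =>
    rw [Finset.sum_eq_sum_Ico_succ_bot hk]
    refine (rpow_add_le_tangent hr _ _).trans ?_
    rw [← Finset.sum_eq_sum_Ico_succ_bot hk,
      Finset.sum_eq_sum_Ico_succ_bot hk (fun i => a i * _), mul_add, add_comm]
    gcongr

lemma le_of_rpow_le_mul {r : ℝ} {a c : ℝ≥0∞} (ha : a ≠ ⊤)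
    (h : a ^ r ≤ c * a ^ (r - 1)) : a ≤ c := by
  rcases eq_or_ne a 0 with rfl | h0
  · simp
  have h1 : a ^ r = a * a ^ (r - 1) := by
    conv_rhs => rw [← ENNReal.rpow_one a, ← ENNReal.rpow_mul, one_mul, ← ENNReal.rpow_add _ _ h0 ha]
    congr 1
    ring
  rw [h1, mul_comm, mul_comm c] at h
  exact (ENNReal.mul_le_mul_iff_right (by simp [ENNReal.rpow_eq_zero_iff, h0, ha])
    (ENNReal.rpow_ne_top_of_ne_zero h0 ha)).1 h

end SeqNorm

/-- A decreasing sequence of partitions of `X` into finite blocks; all blocks of level `ν` have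
the same cardinality `size ν`. -/
structure Filt (X : Type*) where
  blk : ℕ → X → Finset X
  size : ℕ → ℕ
  self_mem : ∀ ν x, x ∈ blk ν x
  blk_eq : ∀ {ν x y}, y ∈ blk ν x → blk ν y = blk ν x
  blk_succ : ∀ ν x, blk ν x ⊆ blk (ν + 1) x
  card_blk : ∀ ν x, (blk ν x).card = size ν
  size_pos : ∀ ν, 0 < size ν

namespace Filt
variable {X : Type*} (F : Filt X)

/-- The average of a nonnegative function over the blocks of level `ν`. -/
def avg (ν : ℕ) (u : X → ℝ≥0∞) (x : X) : ℝ≥0∞ :=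
  (F.size ν : ℝ≥0∞)⁻¹ * ∑ y ∈ F.blk ν x, u y

/-- The average of a real function over the blocks of level `ν`. -/
def ravg (ν : ℕ) (f : X → ℝ) (x : X) : ℝ :=
  (F.size ν : ℝ)⁻¹ * ∑ y ∈ F.blk ν x, f y

/-- The function `h` is constant on the blocks of level `ν`. -/
def IsConst {α : Type*} (ν : ℕ) (h : X → α) : Prop := ∀ x, ∀ y ∈ F.blk ν x, h y = h x

lemma mem_comm {ν : ℕ} {x y : X} : y ∈ F.blk ν x ↔ x ∈ F.blk ν y :=
  ⟨fun h => by rw [F.blk_eq h]; exact F.self_mem ν x,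
    fun h => by rw [F.blk_eq h]; exact F.self_mem ν y⟩

lemma blk_mono {ν μ : ℕ} (h : ν ≤ μ) (x : X) : F.blk ν x ⊆ F.blk μ x := by
  induction h with
  | refl => exact subset_rfl
  | step _ ih => exact ih.trans (F.blk_succ _ x)

lemma IsConst.mono {F : Filt X} {α : Type*} {ν μ : ℕ} {h : X → α} (hc : F.IsConst μ h)
    (hνμ : ν ≤ μ) : F.IsConst ν h :=
  fun x y hy => hc x y (F.blk_mono hνμ x hy)

lemma IsConst.comp {F : Filt X} {α β : Type*} {ν : ℕ} {h : X → α} (hc : F.IsConst ν h)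
    (g : α → β) : F.IsConst ν (fun x => g (h x)) :=
  fun x y hy => congrArg g (hc x y hy)

lemma IsConst.comp₂ {F : Filt X} {α β δ : Type*} {ν : ℕ} {h : X → α} {k : X → β}
    (hc : F.IsConst ν h) (kc : F.IsConst ν k) (g : α → β → δ) :
    F.IsConst ν (fun x => g (h x) (k x)) := fun x y hy => by
  simp only [hc x y hy, kc x y hy]

lemma IsConst.sum {F : Filt X} {ι M : Type*} [AddCommMonoid M] {ν : ℕ} {s : Finset ι}
    {h : ι → X → M} (hc : ∀ i ∈ s, F.IsConst ν (h i)) :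
    F.IsConst ν (fun x => ∑ i ∈ s, h i x) := fun x y hy =>
  Finset.sum_congr rfl fun i hi => hc i hi x y hy

lemma isConst_avg (ν : ℕ) (u : X → ℝ≥0∞) : F.IsConst ν (F.avg ν u) := fun x y hy => by
  rw [avg, avg, F.blk_eq hy]

lemma isConst_ravg (ν : ℕ) (f : X → ℝ) : F.IsConst ν (F.ravg ν f) := fun x y hy => by
  rw [ravg, ravg, F.blk_eq hy]

lemma size_ne_zero (ν : ℕ) : (F.size ν : ℝ≥0∞) ≠ 0 := by
  exact_mod_cast (F.size_pos ν).ne'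

lemma avg_mul_const {ν : ℕ} {h : X → ℝ≥0∞} (hc : F.IsConst ν h) (u : X → ℝ≥0∞) (x : X) :
    F.avg ν (fun y => u y * h y) x = F.avg ν u x * h x := by
  rw [avg, avg, mul_assoc, Finset.sum_mul]
  congr 1
  exact Finset.sum_congr rfl fun y hy => by rw [hc x y hy]

lemma avg_const {ν : ℕ} {h : X → ℝ≥0∞} (hc : F.IsConst ν h) (x : X) : F.avg ν h x = h x := by
  rw [avg, Finset.sum_congr rfl fun y hy => hc x y hy, Finset.sum_const, F.card_blk, nsmul_eq_mul,
    ← mul_assoc, ENNReal.inv_mul_cancel (F.size_ne_zero ν) (by simp), one_mul]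

lemma ravg_const {ν : ℕ} {h : X → ℝ} (hc : F.IsConst ν h) (x : X) : F.ravg ν h x = h x := by
  have : (F.size ν : ℝ) ≠ 0 := by exact_mod_cast (F.size_pos ν).ne'
  rw [ravg, Finset.sum_congr rfl fun y hy => hc x y hy, Finset.sum_const, F.card_blk, nsmul_eq_mul,
    ← mul_assoc, inv_mul_cancel₀ this, one_mul]

lemma avg_mono {ν : ℕ} {u v : X → ℝ≥0∞} (h : ∀ x, u x ≤ v x) (x : X) :
    F.avg ν u x ≤ F.avg ν v x := by
  unfold avg
  gcongr with y
  exact h y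

lemma avg_add (ν : ℕ) (u v : X → ℝ≥0∞) (x : X) :
    F.avg ν (fun y => u y + v y) x = F.avg ν u x + F.avg ν v x := by
  simp [avg, Finset.sum_add_distrib, mul_add]

lemma avg_const_mul (ν : ℕ) (c : ℝ≥0∞) (u : X → ℝ≥0∞) (x : X) :
    F.avg ν (fun y => c * u y) x = c * F.avg ν u x := by
  simp [avg, ← Finset.mul_sum, mul_left_comm]

lemma avg_sum {ι : Type*} (ν : ℕ) (s : Finset ι) (u : ι → X → ℝ≥0∞) (x : X) :
    F.avg ν (fun y => ∑ i ∈ s, u i y) x = ∑ i ∈ s, F.avg ν (u i) x := by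
  simp only [avg, ← Finset.mul_sum]
  rw [Finset.sum_comm]

lemma tsum_avg (ν : ℕ) (u : X → ℝ≥0∞) : ∑' x, F.avg ν u x = ∑' x, u x := by
  classical
  have hs : ∀ (s : Finset X) (v : X → ℝ≥0∞), ∑ y ∈ s, v y = ∑' y, if y ∈ s then v y else 0 := by
    intro s v
    rw [tsum_eq_sum (s := s) (by intro b hb; simp [hb])]
    exact Finset.sum_congr rfl fun y hy => by simp [hy]
  simp only [avg, ENNReal.tsum_mul_left, hs]
  rw [ENNReal.tsum_comm]
  have : ∀ y, ∑' x, (if y ∈ F.blk ν x then u y else 0) = F.size ν * u y := by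
    intro y
    simp_rw [F.mem_comm (y := y), ← hs]
    rw [Finset.sum_const, F.card_blk, nsmul_eq_mul]
  simp_rw [this, ENNReal.tsum_mul_left]
  rw [← mul_assoc, ENNReal.inv_mul_cancel (F.size_ne_zero ν) (by simp), one_mul]

lemma tsum_avg_mul {ν : ℕ} {h : X → ℝ≥0∞} (hc : F.IsConst ν h) (u : X → ℝ≥0∞) :
    ∑' x, F.avg ν u x * h x = ∑' x, u x * h x := by
  rw [← F.tsum_avg ν (fun y => u y * h y)]
  simp_rw [F.avg_mul_const hc]

lemma tsum_avg_mul' (ν : ℕ) (u v : X → ℝ≥0∞) :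
    ∑' x, F.avg ν u x * v x = ∑' x, u x * F.avg ν v x := by
  rw [← F.tsum_avg_mul (F.isConst_avg ν v)]
  have h := F.tsum_avg_mul (F.isConst_avg ν u) v
  simp_rw [mul_comm] at h ⊢
  rw [← h]

lemma tsum_le_of_blk {ν : ℕ} {u v : X → ℝ≥0∞}
    (h : ∀ x, ∑ y ∈ F.blk ν x, u y ≤ ∑ y ∈ F.blk ν x, v y) : ∑' x, u x ≤ ∑' x, v x := by
  rw [← F.tsum_avg ν u, ← F.tsum_avg ν v]
  exact ENNReal.tsum_le_tsum fun x => by unfold avg; exact mul_le_mul_right (h x) _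

lemma avg_rpow_le {r : ℝ} (hr : 1 ≤ r) (ν : ℕ) (u : X → ℝ≥0∞) (x : X) :
    F.avg ν u x ^ r ≤ F.avg ν (fun y => u y ^ r) x := by
  have := ENNReal.rpow_arith_mean_le_arith_mean_rpow (F.blk ν x)
    (fun _ => (F.size ν : ℝ≥0∞)⁻¹) u (by
      rw [Finset.sum_const, F.card_blk, nsmul_eq_mul,
        ENNReal.mul_inv_cancel (F.size_ne_zero ν) (by simp)]) hr
  simpa only [avg, Finset.mul_sum] using this

lemma seqNorm_avg_le {r : ℝ} (hr : 1 ≤ r) (ν : ℕ) (u : X → ℝ≥0∞) :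
    seqNorm r (F.avg ν u) ≤ seqNorm r u := by
  have hr0 : 0 < r := by linarith
  rw [seqNorm_le_iff hr0, seqNorm_rpow hr0, ← F.tsum_avg ν (fun y => u y ^ r)]
  exact ENNReal.tsum_le_tsum fun x => F.avg_rpow_le hr ν u x

lemma rpow_eq_mul_rpow_sub_one {r : ℝ} (hr : 1 ≤ r) (a : ℝ≥0∞) : a ^ r = a * a ^ (r - 1) := by
  conv_rhs => rw [← ENNReal.rpow_one a, ← ENNReal.rpow_mul, one_mul,
    ← ENNReal.rpow_add_of_nonneg _ _ zero_le_one (by linarith)]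
  congr 1
  ring

/-- The dual Doob inequality. -/
lemma seqNorm_tsum_avg_le {r : ℝ} (hr : 1 ≤ r) (u : ℕ → X → ℝ≥0∞) :
    seqNorm r (fun x => ∑' ν, F.avg ν (u ν) x) ≤
      ENNReal.ofReal r * seqNorm r (fun x => ∑' ν, u ν x) := by
  have hr0 : 0 < r := by linarith
  rcases eq_or_ne (seqNorm r (fun x => ∑' ν, u ν x)) ⊤ with ht | ht
  · rw [ht, ENNReal.mul_top (by simp [hr0])]; exact le_top
  refine seqNorm_tsum_le_of hr0 _ fun L => ?_
  set S : X → ℝ≥0∞ := fun x => ∑ i ∈ Finset.range L, F.avg i (u i) x with hS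
  have hfin : seqNorm r S ≠ ⊤ := by
    refine ne_top_of_le_ne_top ?_ (seqNorm_sum_le hr _ _)
    refine ENNReal.sum_ne_top.2 fun i _ => ne_top_of_le_ne_top ht ?_
    refine (F.seqNorm_avg_le hr i _).trans (seqNorm_mono hr0 fun x => ?_)
    exact ENNReal.le_tsum i
  refine le_of_rpow_le_mul (r := r) hfin ?_
  rw [seqNorm_rpow hr0, mul_assoc]
  calc ∑' x, S x ^ r
      ≤ ∑' x, ENNReal.ofReal r * ∑ i ∈ Finset.range L, F.avg i (u i) x *
          (∑ j ∈ Finset.Ico i L, F.avg j (u j) x) ^ (r - 1) :=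
        ENNReal.tsum_le_tsum fun x => sum_range_rpow_le hr _ L
    _ = ENNReal.ofReal r * ∑ i ∈ Finset.range L, ∑' x, F.avg i (u i) x *
          (∑ j ∈ Finset.Ico i L, F.avg j (u j) x) ^ (r - 1) := by
        rw [ENNReal.tsum_mul_left, Summable.tsum_finsetSum fun _ _ => ENNReal.summable]
    _ = ENNReal.ofReal r * ∑ i ∈ Finset.range L, ∑' x, u i x *
          (∑ j ∈ Finset.Ico i L, F.avg j (u j) x) ^ (r - 1) := by
        congr 1
        refine Finset.sum_congr rfl fun i _ => ?_
        refine F.tsum_avg_mul (IsConst.comp (IsConst.sum fun j hj => ?_) (· ^ (r - 1))) _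
        exact (F.isConst_avg j _).mono (Finset.mem_Ico.1 hj).1
    _ ≤ ENNReal.ofReal r * ∑ i ∈ Finset.range L, ∑' x, u i x * S x ^ (r - 1) := by
        gcongr with i hi x
        rw [hS, Finset.range_eq_Ico]
        exact Finset.sum_le_sum_of_subset (Finset.Ico_subset_Ico_left (Nat.zero_le _))
    _ = ENNReal.ofReal r * ∑' x, (∑ i ∈ Finset.range L, u i x) * S x ^ (r - 1) := by
        simp_rw [Finset.sum_mul]
        rw [Summable.tsum_finsetSum fun _ _ => ENNReal.summable]
    _ ≤ ENNReal.ofReal r * ∑' x, (∑' i, u i x) * S x ^ (r - 1) := by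
        gcongr with x
        exact ENNReal.sum_le_tsum _
    _ ≤ _ := by
        gcongr
        exact tsum_mul_rpow_le hr _ _

/-- Multiplying a sum of `ν`-constant terms by functions of small conditional expectation. -/
lemma tsum_layer_rpow_le {r : ℝ} (hr : 1 ≤ r) {κ : ℝ≥0∞} (θ v : ℕ → X → ℝ≥0∞)
    (hθ : ∀ ν x, θ ν x ≤ 1) (hκ : ∀ ν x, F.avg ν (θ ν) x ≤ κ) (hv : ∀ ν, F.IsConst ν (v ν)) :
    ∑' x, (∑' ν, θ ν x * v ν x) ^ r ≤
      ENNReal.ofReal r * κ * ∑' x, (∑' ν, v ν x) ^ r := by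
  have hr0 : 0 < r := by linarith
  refine tsum_tsum_rpow_le _ fun L => ?_
  have hVc : ∀ i, F.IsConst i fun x => v i x * (∑ j ∈ Finset.Ico i L, v j x) ^ (r - 1) :=
    fun i => (hv i).comp₂ (IsConst.sum fun j hj => (hv j).mono (Finset.mem_Ico.1 hj).1)
      (fun a b => a * b ^ (r - 1))
  calc ∑' x, (∑ i ∈ Finset.range L, θ i x * v i x) ^ r
      ≤ ∑' x, ENNReal.ofReal r * ∑ i ∈ Finset.range L, θ i x * v i x *
          (∑ j ∈ Finset.Ico i L, θ j x * v j x) ^ (r - 1) :=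
        ENNReal.tsum_le_tsum fun x => sum_range_rpow_le hr _ L
    _ ≤ ∑' x, ENNReal.ofReal r * ∑ i ∈ Finset.range L, θ i x * (v i x *
          (∑ j ∈ Finset.Ico i L, v j x) ^ (r - 1)) := by
        refine ENNReal.tsum_le_tsum fun x => ?_
        refine mul_le_mul_right (Finset.sum_le_sum fun i _ => ?_) _
        rw [mul_assoc]
        gcongr with j hj
        exact mul_le_of_le_one_left' (hθ j x)
    _ = ENNReal.ofReal r * ∑ i ∈ Finset.range L, ∑' x, F.avg i (θ i) x * (v i x *
          (∑ j ∈ Finset.Ico i L, v j x) ^ (r - 1)) := by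
        rw [ENNReal.tsum_mul_left, Summable.tsum_finsetSum fun _ _ => ENNReal.summable]
        simp_rw [F.tsum_avg_mul (hVc _)]
    _ ≤ ENNReal.ofReal r * ∑ i ∈ Finset.range L, ∑' x, κ * (v i x *
          (∑' j, v j x) ^ (r - 1)) := by
        gcongr with i hi x
        · exact hκ i x
        exact ENNReal.sum_le_tsum _
    _ = ENNReal.ofReal r * κ * ∑' x, (∑ i ∈ Finset.range L, v i x) * (∑' j, v j x) ^ (r - 1) := by
        simp_rw [ENNReal.tsum_mul_left, ← Finset.mul_sum, Finset.sum_mul]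
        rw [Summable.tsum_finsetSum fun _ _ => ENNReal.summable, mul_assoc]
    _ ≤ _ := by
        gcongr with x
        rw [rpow_eq_mul_rpow_sub_one hr]
        gcongr
        exact ENNReal.sum_le_tsum _

/-- Doob's maximal inequality. -/
lemma seqNorm_sup_avg_le {q : ℝ} (hq : 1 < q) (u : X → ℝ≥0∞) (L : ℕ) :
    seqNorm q (fun x => (Finset.range (L + 1)).sup fun i => F.avg i u x) ≤
      ENNReal.ofReal q.conjExponent * seqNorm q u := by
  classical
  have hq0 : 0 < q := by linarith
  have hc : q.HolderConjugate q.conjExponent := Real.HolderConjugate.conjExponent hq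
  rcases eq_or_ne (seqNorm q u) ⊤ with ht | ht
  · rw [ht, ENNReal.mul_top (by simp [hc.symm.pos])]; exact le_top
  set M : X → ℝ≥0∞ := fun x => (Finset.range (L + 1)).sup fun i => F.avg i u x with hM
  have hfin : seqNorm q M ≠ ⊤ := by
    refine ne_top_of_le_ne_top ?_ ((seqNorm_mono hq0 (v := fun x =>
      ∑ i ∈ Finset.range (L + 1), F.avg i u x) fun x => ?_).trans (seqNorm_sum_le hq.le _ _))
    · exact ENNReal.sum_ne_top.2 fun i _ => ne_top_of_le_ne_top ht (F.seqNorm_avg_le hq.le i _)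
    · exact Finset.sup_le fun i hi => Finset.single_le_sum (f := fun i => F.avg i u x)
        (fun _ _ => zero_le) hi
  have hex : ∀ x, ∃ i ∈ Finset.range (L + 1), M x = F.avg i u x := fun x =>
    Finset.exists_mem_eq_sup _ ⟨0, by simp⟩ _
  choose a ha haM using hex
  refine le_of_rpow_le_mul (r := q) hfin ?_
  rw [seqNorm_rpow hq0]
  set w : ℕ → X → ℝ≥0∞ := fun i x => if a x = i then M x ^ (q - 1) else 0 with hw
  have hwsum : ∀ x, ∑' i, w i x = M x ^ (q - 1) := fun x => by simp [hw]
  calc ∑' x, M x ^ q = ∑' x, ∑' i, F.avg i u x * w i x := by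
        congr 1 with x
        rw [tsum_eq_single (a x) fun i hi => by simp [hw, hi.symm], ← haM,
          rpow_eq_mul_rpow_sub_one hq.le]
        simp [hw]
    _ = ∑' x, u x * ∑' i, F.avg i (w i) x := by
        rw [ENNReal.tsum_comm]
        simp_rw [F.tsum_avg_mul']
        rw [ENNReal.tsum_comm]
        simp_rw [ENNReal.tsum_mul_left]
    _ ≤ seqNorm q u * (ENNReal.ofReal q.conjExponent *
          seqNorm q.conjExponent (fun x => M x ^ (q - 1))) := by
        refine (tsum_mul_le_seqNorm hc _ _).trans ?_
        gcongr
        simpa only [hwsum] using F.seqNorm_tsum_avg_le hc.symm.lt.le w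
    _ = _ := by
        rw [seqNorm_comp_rpow hc.symm.pos (by linarith),
          show (q - 1) * q.conjExponent = q from hc.sub_one_mul_conj]
        ring

end Filt

lemma mul_one_sub_rpow_le {a t : ℝ} (ha : 0 ≤ a) (ht0 : 0 ≤ t) (ht1 : t ≤ 1) :
    1 - t ^ a ≤ (a + 1) * (1 - t) := by
  have h1 := one_add_mul_self_le_rpow_one_add (s := t - 1) (p := a + 1) (by linarith) (by linarith)
  rw [add_sub_cancel] at h1
  have h2 : t ^ (a + 1) ≤ t ^ a := by
    rw [Real.rpow_add_one' ht0 (by linarith)]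
    exact mul_le_of_le_one_right (by positivity) ht1
  linarith

lemma rpow_sub_rpow_mul_le {a x y : ℝ} (ha : 0 ≤ a) (hy : 0 ≤ y) (hyx : y ≤ x) :
    (x ^ a - y ^ a) * x ≤ (a + 1) * x ^ a * (x - y) := by
  rcases (hy.trans hyx).eq_or_lt with rfl | hx
  · obtain rfl := le_antisymm hyx hy
    simp
  have h := mul_one_sub_rpow_le ha (div_nonneg hy hx.le) ((div_le_one hx).2 hyx)
  rw [Real.div_rpow hy hx.le] at h
  have h2 := mul_le_mul_of_nonneg_left h (show 0 ≤ x ^ a * x by positivity)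
  have hxa : 0 < x ^ a := by positivity
  have e1 : x ^ a * x * (1 - y ^ a / x ^ a) = (x ^ a - y ^ a) * x := by field_simp
  have e2 : x ^ a * x * ((a + 1) * (1 - y / x)) = (a + 1) * x ^ a * (x - y) := by field_simp
  linarith

lemma rpow_tangent_le {r x y : ℝ} (hr : 1 ≤ r) (hx : 0 ≤ x) (hy : 0 ≤ y) :
    x ^ r + r * x ^ (r - 1) * (y - x) ≤ y ^ r := by
  rcases hx.eq_or_lt with rfl | hx
  · rcases hr.eq_or_lt with rfl | hr
    · simp
    · rw [Real.zero_rpow (by linarith), Real.zero_rpow (by linarith)]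
      have : 0 ≤ y ^ r := by positivity
      simpa
  have h := one_add_mul_self_le_rpow_one_add (s := y / x - 1) (p := r)
    (by have : 0 ≤ y / x := by positivity
        linarith) hr
  rw [add_sub_cancel, Real.div_rpow hy hx.le, le_div_iff₀ (by positivity)] at h
  have e : x ^ r = x * x ^ (r - 1) := by
    rw [← Real.rpow_one_add' hx.le (by linarith)]; congr 1; ring
  have e2 : (1 + r * (y / x - 1)) * x ^ r = x ^ r + r * x ^ (r - 1) * (y - x) := by
    rw [e]; field_simp
  linarith

/-- A second order Taylor bound for `t ↦ |t|^{2r}`. -/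
lemma sq_rpow_le {r : ℝ} (hr : 1 ≤ r) (a b : ℝ) :
    (a ^ 2) ^ r ≤ (b ^ 2) ^ r + 2 * r * (b ^ 2) ^ (r - 1) * b * (a - b) +
      5 * r ^ 2 * (max (a ^ 2) (b ^ 2)) ^ (r - 1) * (a - b) ^ 2 := by
  have ha : 0 ≤ a ^ 2 := sq_nonneg a
  have hb : 0 ≤ b ^ 2 := sq_nonneg b
  set M := max (a ^ 2) (b ^ 2) with hM
  have hM0 : 0 ≤ M := ha.trans (le_max_left _ _)
  have h1 := rpow_tangent_le hr ha hb
  have hbM : (b ^ 2) ^ (r - 1) ≤ M ^ (r - 1) :=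
    Real.rpow_le_rpow hb (le_max_right _ _) (by linarith)
  have hsq : (a ^ 2 - b ^ 2) ^ 2 ≤ 4 * M * (a - b) ^ 2 := by
    have : (a + b) ^ 2 ≤ 4 * M := by
      nlinarith [le_max_left (a ^ 2) (b ^ 2), le_max_right (a ^ 2) (b ^ 2), sq_nonneg (a - b)]
    calc (a ^ 2 - b ^ 2) ^ 2 = (a + b) ^ 2 * (a - b) ^ 2 := by ring
      _ ≤ _ := by gcongr
  have hx : ((a ^ 2) ^ (r - 1) - (b ^ 2) ^ (r - 1)) * (a ^ 2 - b ^ 2) * M ≤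
      r * M ^ (r - 1) * (a ^ 2 - b ^ 2) ^ 2 := by
    rcases le_total (b ^ 2) (a ^ 2) with h | h
    · have := rpow_sub_rpow_mul_le (a := r - 1) (by linarith) hb h
      rw [hM, max_eq_left h]
      have := mul_le_mul_of_nonneg_right this (sub_nonneg.2 h)
      rw [sub_add_cancel] at this
      nlinarith
    · have := rpow_sub_rpow_mul_le (a := r - 1) (by linarith) ha h
      rw [hM, max_eq_right h]
      have := mul_le_mul_of_nonneg_right this (sub_nonneg.2 h)
      rw [sub_add_cancel] at this
      nlinarith
  have hMr : 0 ≤ M ^ (r - 1) := by positivity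
  have hy : ((a ^ 2) ^ (r - 1) - (b ^ 2) ^ (r - 1)) * (a ^ 2 - b ^ 2) ≤
      4 * r * M ^ (r - 1) * (a - b) ^ 2 := by
    rcases hM0.eq_or_lt with h0 | h0
    · have ha0 : a ^ 2 = 0 := le_antisymm ((le_max_left _ _).trans_eq h0.symm) ha
      have hb0 : b ^ 2 = 0 := le_antisymm ((le_max_right _ _).trans_eq h0.symm) hb
      rw [ha0, hb0]
      have : 0 ≤ 4 * r * M ^ (r - 1) * (a - b) ^ 2 := by positivity
      simpa
    · refine le_of_mul_le_mul_right (hx.trans ?_) h0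
      calc r * M ^ (r - 1) * (a ^ 2 - b ^ 2) ^ 2
          ≤ r * M ^ (r - 1) * (4 * M * (a - b) ^ 2) := by gcongr
        _ = _ := by ring
  have h2 : r * (b ^ 2) ^ (r - 1) * (a - b) ^ 2 ≤ r ^ 2 * M ^ (r - 1) * (a - b) ^ 2 := by
    gcongr
    nlinarith
  have h3 : r * (((a ^ 2) ^ (r - 1) - (b ^ 2) ^ (r - 1)) * (a ^ 2 - b ^ 2)) ≤
      r * (4 * r * M ^ (r - 1) * (a - b) ^ 2) := by gcongr
  have e : a ^ 2 - b ^ 2 = 2 * b * (a - b) + (a - b) ^ 2 := by ring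
  have e2 : r * (((a ^ 2) ^ (r - 1) - (b ^ 2) ^ (r - 1)) * (a ^ 2 - b ^ 2)) =
      r * (a ^ 2) ^ (r - 1) * (a ^ 2 - b ^ 2) - 2 * r * (b ^ 2) ^ (r - 1) * b * (a - b)
        - r * (b ^ 2) ^ (r - 1) * (a - b) ^ 2 := by
    rw [sub_mul, mul_sub]
    conv_lhs => arg 2; rw [e]
    ring
  nlinarith

lemma enorm_sq_eq (t : ℝ) : ‖t‖ₑ ^ 2 = ENNReal.ofReal (t ^ 2) := by
  rw [← enorm_pow, Real.enorm_of_nonneg (sq_nonneg t)]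

lemma enorm_sub_sq_le (a b : ℝ) : ‖a - b‖ₑ ^ 2 ≤ 2 * ‖a‖ₑ ^ 2 + 2 * ‖b‖ₑ ^ 2 := by
  rw [enorm_sq_eq, enorm_sq_eq, enorm_sq_eq,
    show (2 : ℝ≥0∞) = ENNReal.ofReal 2 by simp,
    ← ENNReal.ofReal_mul (by norm_num), ← ENNReal.ofReal_mul (by norm_num),
    ← ENNReal.ofReal_add (by positivity) (by positivity)]
  exact ENNReal.ofReal_le_ofReal (by nlinarith [sq_nonneg (a + b)])

lemma seqNorm_sq {X : Type*} {r : ℝ} (hr : 0 < r) (u : X → ℝ≥0∞) :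
    seqNorm r (fun x => u x ^ 2) = seqNorm (2 * r) u ^ 2 := by
  have := seqNorm_comp_rpow hr (show (0:ℝ) < 2 by norm_num) u
  simpa only [ENNReal.rpow_two] using this

namespace Filt
variable {X : Type*} (F : Filt X)

/-- The filtration with the first `k` levels dropped. -/
def shift (k : ℕ) : Filt X where
  blk ν := F.blk (ν + k)
  size ν := F.size (ν + k)
  self_mem _ := F.self_mem _
  blk_eq h := F.blk_eq h
  blk_succ _ := F.blk_mono (by omega)
  card_blk _ := F.card_blk _
  size_pos _ := F.size_pos _

lemma shift_avg (k ν : ℕ) (u : X → ℝ≥0∞) : (F.shift k).avg ν u = F.avg (ν + k) u := rfl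

/-- The martingale differences. -/
def dif (i : ℕ) (f : X → ℝ) (x : X) : ℝ := F.ravg i f x - F.ravg (i + 1) f x

lemma isConst_dif (i : ℕ) (f : X → ℝ) : F.IsConst i (F.dif i f) :=
  (F.isConst_ravg i f).comp₂ ((F.isConst_ravg (i + 1) f).mono i.le_succ) (· - ·)

lemma sum_blk_ravg {i k : ℕ} (hik : i ≤ k) (f : X → ℝ) (x : X) :
    ∑ y ∈ F.blk k x, F.ravg i f y = ∑ y ∈ F.blk k x, f y := by
  simp only [ravg, ← Finset.mul_sum]
  rw [Finset.sum_comm' (s' := F.blk i) (t' := F.blk k x)]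
  · simp_rw [Finset.sum_const, F.card_blk, nsmul_eq_mul, ← Finset.mul_sum]
    rw [← mul_assoc, inv_mul_cancel₀ (by exact_mod_cast (F.size_pos i).ne'), one_mul]
  · intro y z
    have key : ∀ y z, y ∈ F.blk k x → z ∈ F.blk i y → z ∈ F.blk k x := fun y z hy hz => by
      rw [← F.blk_eq hy]; exact F.blk_mono hik y hz
    constructor
    · rintro ⟨hy, hz⟩; exact ⟨F.mem_comm.1 hz, key y z hy hz⟩
    · rintro ⟨hy, hz⟩; exact ⟨key z y hz hy, F.mem_comm.1 hy⟩

lemma ravg_ravg {i k : ℕ} (hik : i ≤ k) (f : X → ℝ) : F.ravg k (F.ravg i f) = F.ravg k f := by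
  ext x
  rw [ravg, F.sum_blk_ravg hik, ravg]

lemma sum_blk_dif {i k : ℕ} (h : i + 1 ≤ k) (f : X → ℝ) (x : X) :
    ∑ y ∈ F.blk k x, F.dif i f y = 0 := by
  simp only [dif, Finset.sum_sub_distrib]
  rw [F.sum_blk_ravg (by omega), F.sum_blk_ravg h, sub_self]

lemma enorm_ravg_le (ν : ℕ) (f : X → ℝ) (x : X) :
    ‖F.ravg ν f x‖ₑ ≤ F.avg ν (fun y => ‖f y‖ₑ) x := by
  rw [ravg, avg, enorm_mul, enorm_inv (by exact_mod_cast (F.size_pos ν).ne')]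
  gcongr
  · simp
  · exact enorm_sum_le _ _

lemma enorm_ravg_sq_le (ν : ℕ) (f : X → ℝ) (x : X) :
    ‖F.ravg ν f x‖ₑ ^ 2 ≤ F.avg ν (fun y => ‖f y‖ₑ ^ 2) x := by
  have h := F.avg_rpow_le (r := 2) (by norm_num) ν (fun y => ‖f y‖ₑ) x
  simp only [ENNReal.rpow_two] at h
  exact (pow_le_pow_left' (F.enorm_ravg_le ν f x) 2).trans h

lemma ravg_zero (h0 : F.size 0 = 1) (f : X → ℝ) : F.ravg 0 f = f := by
  ext x
  have : F.blk 0 x = {x} := by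
    obtain ⟨a, ha⟩ := Finset.card_eq_one.1 ((F.card_blk 0 x).trans h0)
    have := F.self_mem 0 x
    rw [ha, Finset.mem_singleton] at this
    rw [ha, this]
  simp [ravg, this, h0]

lemma tsum_ravg_rpow_step {r : ℝ} (hr : 1 ≤ r) (f : X → ℝ) (i : ℕ) (W : X → ℝ≥0∞)
    (hW : ∀ x, ‖F.ravg i f x‖ₑ ≤ W x) (hW' : ∀ x, ‖F.ravg (i + 1) f x‖ₑ ≤ W x) :
    ∑' x, (‖F.ravg i f x‖ₑ ^ 2) ^ r ≤ ∑' x, (‖F.ravg (i + 1) f x‖ₑ ^ 2) ^ r +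
      ENNReal.ofReal (5 * r ^ 2) * ∑' x, ‖F.dif i f x‖ₑ ^ 2 * (W x ^ 2) ^ (r - 1) := by
  have hr0 : 0 ≤ r - 1 := by linarith
  rw [← ENNReal.tsum_mul_left, ← ENNReal.tsum_add]
  refine (F.tsum_le_of_blk (ν := i + 1) (v := fun x => ENNReal.ofReal
    (((F.ravg (i + 1) f x) ^ 2) ^ r + 5 * r ^ 2 *
      (max ((F.ravg i f x) ^ 2) ((F.ravg (i + 1) f x) ^ 2)) ^ (r - 1) * (F.dif i f x) ^ 2))
    fun x => ?_).trans (ENNReal.tsum_le_tsum fun x => ?_)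
  · simp_rw [enorm_sq_eq, ENNReal.ofReal_rpow_of_nonneg (sq_nonneg _) (show 0 ≤ r by linarith)]
    rw [← ENNReal.ofReal_sum_of_nonneg fun _ _ => by positivity,
      ← ENNReal.ofReal_sum_of_nonneg fun _ _ => by positivity]
    refine ENNReal.ofReal_le_ofReal ?_
    have hz : ∑ y ∈ F.blk (i + 1) x, 2 * r * ((F.ravg (i + 1) f y) ^ 2) ^ (r - 1) *
        F.ravg (i + 1) f y * F.dif i f y = 0 := by
      rw [Finset.sum_congr rfl fun y hy => by rw [F.isConst_ravg (i + 1) f x y hy],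
        ← Finset.mul_sum, F.sum_blk_dif le_rfl, mul_zero]
    refine (Finset.sum_le_sum (g := fun y => (((F.ravg (i + 1) f y) ^ 2) ^ r + 5 * r ^ 2 *
      (max ((F.ravg i f y) ^ 2) ((F.ravg (i + 1) f y) ^ 2)) ^ (r - 1) * (F.dif i f y) ^ 2) +
      2 * r * ((F.ravg (i + 1) f y) ^ 2) ^ (r - 1) * F.ravg (i + 1) f y * F.dif i f y)
      fun y _ => ?_).trans_eq (by rw [Finset.sum_add_distrib, hz, add_zero])
    refine (sq_rpow_le hr _ (F.ravg (i + 1) f y)).trans_eq ?_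
    simp only [dif]
    ring
  · rw [ENNReal.ofReal_add (by positivity) (by positivity), ENNReal.ofReal_mul (by positivity),
      ENNReal.ofReal_mul (by positivity), enorm_sq_eq, enorm_sq_eq, mul_assoc,
      ENNReal.ofReal_rpow_of_nonneg (sq_nonneg _) (by linarith),
      ← ENNReal.ofReal_rpow_of_nonneg (le_max_of_le_left (sq_nonneg _)) hr0,
      mul_comm (ENNReal.ofReal (F.dif i f x ^ 2))]
    gcongr
    rw [ENNReal.ofReal_max, ← enorm_sq_eq, ← enorm_sq_eq]
    exact max_le (pow_le_pow_left' (hW x) 2) (pow_le_pow_left' (hW' x) 2)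

lemma tsum_ravg_rpow_le {r : ℝ} (hr : 1 ≤ r) (f : X → ℝ) (L : ℕ) :
    ∑' x, (‖F.ravg 0 f x‖ₑ ^ 2) ^ r ≤ ∑' x, (‖F.ravg L f x‖ₑ ^ 2) ^ r +
      ENNReal.ofReal (5 * r ^ 2) * (seqNorm r (fun x => ∑' i, ‖F.dif i f x‖ₑ ^ 2) *
        (ENNReal.ofReal (2 * r).conjExponent ^ 2 * seqNorm r (fun x => ‖f x‖ₑ ^ 2)) ^ (r - 1)) := by
  have hr0 : 0 ≤ r - 1 := by linarith
  set W : X → ℝ≥0∞ := fun x => (Finset.range (L + 1)).sup fun i => F.avg i (fun y => ‖f y‖ₑ) x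
    with hWdef
  have hW : ∀ i ≤ L, ∀ x, ‖F.ravg i f x‖ₑ ≤ W x := fun i hi x =>
    (F.enorm_ravg_le i f x).trans
      (Finset.le_sup (f := fun i => F.avg i (fun y => ‖f y‖ₑ) x) (Finset.mem_range.2 (by omega)))
  have main : ∀ k ≤ L, ∑' x, (‖F.ravg 0 f x‖ₑ ^ 2) ^ r ≤ ∑' x, (‖F.ravg k f x‖ₑ ^ 2) ^ r +
      ENNReal.ofReal (5 * r ^ 2) * ∑ i ∈ Finset.range k,
        ∑' x, ‖F.dif i f x‖ₑ ^ 2 * (W x ^ 2) ^ (r - 1) := by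
    intro k
    induction k with
    | zero => simp
    | succ k ih =>
      intro hk
      refine (ih (by omega)).trans ?_
      rw [Finset.sum_range_succ, mul_add, add_comm (ENNReal.ofReal _ * _), ← add_assoc]
      gcongr
      exact F.tsum_ravg_rpow_step hr f k W (hW k (by omega)) (hW (k + 1) hk)
  refine (main L le_rfl).trans ?_
  gcongr
  rw [← Summable.tsum_finsetSum fun _ _ => ENNReal.summable]
  simp_rw [← Finset.sum_mul]
  refine (ENNReal.tsum_le_tsum fun x => mul_le_mul_left (ENNReal.sum_le_tsum _) _).trans ?_
  refine (tsum_mul_rpow_le hr _ _).trans ?_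
  gcongr
  rw [seqNorm_sq (by linarith), seqNorm_sq (by linarith), ← mul_pow]
  exact pow_le_pow_left' (F.seqNorm_sup_avg_le (by linarith) _ L) 2

lemma tsum_enorm_ravg_rpow_le {q : ℝ} (hq : 1 ≤ q) (f : X → ℝ) (L : ℕ) :
    ∑' x, ‖F.ravg L f x‖ₑ ^ q ≤
      ((F.size L : ℝ≥0∞)⁻¹ * ∑' x, ‖f x‖ₑ) ^ (q - 1) * ∑' x, ‖f x‖ₑ := by
  rw [← F.tsum_avg L (fun x => ‖f x‖ₑ), ← ENNReal.tsum_mul_left]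
  refine ENNReal.tsum_le_tsum fun x => ?_
  rw [rpow_eq_mul_rpow_sub_one hq, mul_comm]
  have h := F.enorm_ravg_le L f x
  gcongr
  rw [F.tsum_avg]
  refine h.trans ?_
  rw [avg]
  gcongr
  exact ENNReal.sum_le_tsum _

lemma tsum_enorm_ne_top {f : X → ℝ} (hf : f.support.Finite) : ∑' x, ‖f x‖ₑ ≠ ⊤ := by
  rw [tsum_eq_sum (s := hf.toFinset) (by intro b hb; simpa using hb)]
  exact ENNReal.sum_ne_top.2 fun _ _ => enorm_ne_top

lemma seqNorm_enorm_sq_ne_top {f : X → ℝ} (hf : f.support.Finite) {r : ℝ} (hr : 0 < r) :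
    seqNorm r (fun x => ‖f x‖ₑ ^ 2) ≠ ⊤ := by
  rw [seqNorm, tsum_eq_sum (s := hf.toFinset) (by
    intro b hb
    rw [Set.Finite.mem_toFinset, Function.mem_support, not_not] at hb
    simp [hb, hr])]
  refine ENNReal.rpow_ne_top_of_nonneg (by positivity) (ENNReal.sum_ne_top.2 fun _ _ => ?_)
  exact ENNReal.rpow_ne_top_of_nonneg hr.le (ENNReal.pow_ne_top enorm_ne_top)

lemma tendsto_size_inv (hs : Filter.Tendsto F.size Filter.atTop Filter.atTop) :
    Filter.Tendsto (fun L => (F.size L : ℝ≥0∞)⁻¹) Filter.atTop (nhds 0) :=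
  ENNReal.tendsto_inv_nat_nhds_zero.comp hs

/-- The norm of a function is controlled by its martingale square function. -/
lemma seqNorm_sq_le_square {r : ℝ} (hr : 1 ≤ r) (h0 : F.size 0 = 1)
    (hs : Filter.Tendsto F.size Filter.atTop Filter.atTop) {f : X → ℝ} (hf : f.support.Finite) :
    seqNorm r (fun x => ‖f x‖ₑ ^ 2) ≤
      (ENNReal.ofReal (5 * r ^ 2) * (ENNReal.ofReal (2 * r).conjExponent ^ 2) ^ (r - 1)) *
        seqNorm r (fun x => ∑' i, ‖F.dif i f x‖ₑ ^ 2) := by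
  have hr0 : 0 < r := by linarith
  refine le_of_rpow_le_mul (r := r) (seqNorm_enorm_sq_ne_top hf hr0) ?_
  rw [seqNorm_rpow hr0]
  have hA := tsum_enorm_ne_top hf
  set A := ∑' x, ‖f x‖ₑ
  have hlim : Filter.Tendsto (fun L => ((F.size L : ℝ≥0∞)⁻¹ * A) ^ (2 * r - 1) * A +
      ENNReal.ofReal (5 * r ^ 2) * (seqNorm r (fun x => ∑' i, ‖F.dif i f x‖ₑ ^ 2) *
        (ENNReal.ofReal (2 * r).conjExponent ^ 2 * seqNorm r (fun x => ‖f x‖ₑ ^ 2)) ^ (r - 1)))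
      Filter.atTop (nhds (0 + ENNReal.ofReal (5 * r ^ 2) *
        (seqNorm r (fun x => ∑' i, ‖F.dif i f x‖ₑ ^ 2) *
        (ENNReal.ofReal (2 * r).conjExponent ^ 2 * seqNorm r (fun x => ‖f x‖ₑ ^ 2)) ^ (r - 1)))) := by
    refine Filter.Tendsto.add ?_ tendsto_const_nhds
    have h1 : Filter.Tendsto (fun L => (F.size L : ℝ≥0∞)⁻¹ * A) Filter.atTop (nhds (0 * A)) :=
      ENNReal.Tendsto.mul_const (F.tendsto_size_inv hs) (Or.inr hA)
    have h2 := ((ENNReal.continuous_rpow_const (y := 2 * r - 1)).tendsto _).comp h1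
    have h3 := ENNReal.Tendsto.mul_const h2 (Or.inr hA)
    rw [zero_mul, ENNReal.zero_rpow_of_pos (by linarith), zero_mul] at h3
    exact h3
  refine (ge_of_tendsto' hlim fun L => ?_).trans_eq ?_
  · have h := F.tsum_ravg_rpow_le hr f L
    rw [F.ravg_zero h0] at h
    refine h.trans ?_
    gcongr
    refine le_trans (le_of_eq ?_) (F.tsum_enorm_ravg_rpow_le (q := 2 * r) (by linarith) f L)
    congr 1 with x
    rw [ENNReal.rpow_mul, ENNReal.rpow_two]
  · rw [zero_add, ENNReal.mul_rpow_of_nonneg _ _ (by linarith)]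
    ring

lemma tsum_ravg_sq_step {k i : ℕ} (hik : i + 1 ≤ k) {h : X → ℝ≥0∞} (hc : F.IsConst k h)
    (f : X → ℝ) :
    ∑' x, h x * ‖F.ravg i f x‖ₑ ^ 2 =
      ∑' x, h x * ‖F.ravg (i + 1) f x‖ₑ ^ 2 + ∑' x, h x * ‖F.dif i f x‖ₑ ^ 2 := by
  rw [← ENNReal.tsum_add]
  have hc' := hc.mono hik
  have key : ∀ x, ∑ y ∈ F.blk (i + 1) x, h y * ‖F.ravg i f y‖ₑ ^ 2 =
      ∑ y ∈ F.blk (i + 1) x,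
        (h y * ‖F.ravg (i + 1) f y‖ₑ ^ 2 + h y * ‖F.dif i f y‖ₑ ^ 2) := by
    intro x
    have e : ∀ g : X → ℝ≥0∞, ∑ y ∈ F.blk (i + 1) x, h y * g y = h x * ∑ y ∈ F.blk (i + 1) x, g y :=
      fun g => by
        rw [Finset.mul_sum]
        exact Finset.sum_congr rfl fun y hy => by rw [hc' x y hy]
    simp_rw [← mul_add]
    rw [e, e]
    congr 1
    simp_rw [enorm_sq_eq, ← ENNReal.ofReal_add (sq_nonneg _) (sq_nonneg _)]
    rw [← ENNReal.ofReal_sum_of_nonneg fun _ _ => by positivity,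
      ← ENNReal.ofReal_sum_of_nonneg fun _ _ => by positivity]
    congr 1
    have hz : ∑ y ∈ F.blk (i + 1) x, 2 * F.ravg (i + 1) f y * F.dif i f y = 0 := by
      rw [Finset.sum_congr rfl fun y hy => by rw [F.isConst_ravg (i + 1) f x y hy],
        ← Finset.mul_sum, F.sum_blk_dif le_rfl, mul_zero]
    rw [← add_zero (∑ y ∈ F.blk (i + 1) x, (_ + _) : ℝ), ← hz, ← Finset.sum_add_distrib]
    refine Finset.sum_congr rfl fun y _ => ?_
    simp only [dif]
    ring
  exact le_antisymm (F.tsum_le_of_blk fun x => (key x).le) (F.tsum_le_of_blk fun x => (key x).ge)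

lemma tsum_mul_dif_sq_le (h0 : F.size 0 = 1) {k : ℕ} {h : X → ℝ≥0∞} (hc : F.IsConst k h)
    (f : X → ℝ) :
    ∑' x, h x * ∑ i ∈ Finset.range k, ‖F.dif i f x‖ₑ ^ 2 ≤ ∑' x, h x * ‖f x‖ₑ ^ 2 := by
  have main : ∀ j ≤ k, ∑' x, h x * ‖f x‖ₑ ^ 2 = ∑' x, h x * ‖F.ravg j f x‖ₑ ^ 2 +
      ∑' x, h x * ∑ i ∈ Finset.range j, ‖F.dif i f x‖ₑ ^ 2 := by
    intro j
    induction j with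
    | zero => simp [F.ravg_zero h0]
    | succ j ih =>
      intro hj
      rw [ih (by omega), F.tsum_ravg_sq_step hj hc]
      simp_rw [Finset.sum_range_succ, mul_add]
      rw [ENNReal.tsum_add]
      ring
  rw [main k le_rfl]
  exact le_add_self

lemma enorm_dif_sq_le (i : ℕ) (f : X → ℝ) (x : X) :
    ‖F.dif i f x‖ₑ ^ 2 ≤ 2 * F.avg i (fun y => ‖f y‖ₑ ^ 2) x +
      2 * F.avg (i + 1) (fun y => ‖f y‖ₑ ^ 2) x := by
  refine (enorm_sub_sq_le _ _).trans ?_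
  gcongr <;> exact F.enorm_ravg_sq_le _ _ _

/-- The martingale square function is controlled by the norm of the function. -/
lemma seqNorm_square_le {r : ℝ} (hr : 1 < r) (h0 : F.size 0 = 1) (f : X → ℝ) :
    seqNorm r (fun x => ∑' i, ‖F.dif i f x‖ₑ ^ 2) ≤
      ENNReal.ofReal r * (3 + 2 * ENNReal.ofReal r.conjExponent) *
        seqNorm r (fun x => ‖f x‖ₑ ^ 2) := by
  have hr0 : 0 < r := by linarith
  have hc : r.HolderConjugate r.conjExponent := Real.HolderConjugate.conjExponent hr
  set N := seqNorm r (fun x => ‖f x‖ₑ ^ 2) with hN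
  rcases eq_or_ne N ⊤ with ht | ht
  · rw [ht, ENNReal.mul_top (by simp [hr0])]; exact le_top
  refine seqNorm_tsum_le_of hr0 _ fun L => ?_
  set a : ℕ → X → ℝ≥0∞ := fun i x => ‖F.dif i f x‖ₑ ^ 2 with ha
  have hac : ∀ i, F.IsConst i (a i) := fun i => (F.isConst_dif i f).comp fun t => ‖t‖ₑ ^ 2
  set S : X → ℝ≥0∞ := fun x => ∑ i ∈ Finset.range L, a i x with hS
  have hfin : seqNorm r S ≠ ⊤ := by
    refine ne_top_of_le_ne_top ?_ (seqNorm_sum_le hr.le _ _)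
    refine ENNReal.sum_ne_top.2 fun i _ => ne_top_of_le_ne_top (b := 2 * N + 2 * N) ?_ ?_
    · exact ENNReal.add_ne_top.2 ⟨ENNReal.mul_ne_top (by simp) ht, ENNReal.mul_ne_top (by simp) ht⟩
    · refine (seqNorm_mono hr0 (F.enorm_dif_sq_le i f)).trans ((seqNorm_add_le hr.le _ _).trans ?_)
      rw [seqNorm_const_mul hr0, seqNorm_const_mul hr0]
      gcongr <;> exact F.seqNorm_avg_le hr.le _ _
  refine le_of_rpow_le_mul (r := r) hfin ?_
  rw [seqNorm_rpow hr0]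
  set A : ℕ → X → ℝ≥0∞ := fun i x => (∑ j ∈ Finset.Ico i L, a j x) ^ (r - 1) with hA
  have hAL : ∀ i ≥ L, ∀ x, A i x = 0 := fun i hi x => by
    simp only [hA, Finset.Ico_eq_empty_of_le hi, Finset.sum_empty]
    exact ENNReal.zero_rpow_of_pos (by linarith)
  have hA0 : ∀ x, A 0 x = S x ^ (r - 1) := fun x => by
    simp only [hA, hS, Finset.range_eq_Ico]
  have hAanti : ∀ i x, A (i + 1) x ≤ A i x := fun i x =>
    ENNReal.rpow_le_rpow (Finset.sum_le_sum_of_subset (Finset.Ico_subset_Ico_left i.le_succ))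
      (by linarith)
  have hAc : ∀ i, F.IsConst i (A i) := fun i =>
    IsConst.comp (IsConst.sum (s := Finset.Ico i L) fun j hj =>
      (hac j).mono (Finset.mem_Ico.1 hj).1) (· ^ (r - 1))
  set δ : ℕ → X → ℝ≥0∞ := fun i x => A i x - A (i + 1) x with hδ
  have hδc : ∀ i, F.IsConst i (δ i) := fun i =>
    (hAc i).comp₂ ((hAc (i + 1)).mono i.le_succ) (· - ·)
  have hAδ : ∀ i ≤ L, ∀ x, A i x = ∑ μ ∈ Finset.Ico i L, δ μ x := by
    intro i hi x
    induction hi using Nat.decreasingInduction with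
    | self => simp [hAL L le_rfl]
    | of_succ k hk ih =>
      rw [Finset.sum_eq_sum_Ico_succ_bot hk, ← ih]
      exact (tsub_add_cancel_of_le (hAanti k x)).symm
  have hδsum : ∀ x, ∑' μ, δ μ x = A 0 x := fun x => by
    rw [hAδ 0 (Nat.zero_le _), ← Finset.range_eq_Ico,
      tsum_eq_sum (s := Finset.range L) fun i hi => ?_]
    have : L ≤ i := by simpa using hi
    simp [hδ, hAL i this]
  have hμ : ∀ μ, ∑' x, δ μ x * ∑ i ∈ Finset.range (μ + 1), a i x ≤
      ∑' x, ‖f x‖ₑ ^ 2 * (3 * δ μ x + 2 * (F.shift 1).avg μ (δ μ) x) := by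
    intro μ
    have h1 := F.tsum_mul_dif_sq_le h0 (hδc μ) f
    have h2 : ∑' x, δ μ x * a μ x ≤ ∑' x, (2 * (δ μ x * ‖f x‖ₑ ^ 2) +
        2 * (‖f x‖ₑ ^ 2 * F.avg (μ + 1) (δ μ) x)) := by
      refine (ENNReal.tsum_le_tsum fun x =>
        mul_le_mul_right (F.enorm_dif_sq_le μ f x) _).trans_eq ?_
      simp_rw [mul_add]
      rw [ENNReal.tsum_add, ENNReal.tsum_add]
      simp_rw [mul_left_comm _ (2:ℝ≥0∞), ENNReal.tsum_mul_left]
      congr 2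
      · have := F.tsum_avg_mul (hδc μ) (fun x => ‖f x‖ₑ ^ 2)
        simp_rw [mul_comm (δ μ _)]
        exact this
      · have := F.tsum_avg_mul' (μ + 1) (fun x => ‖f x‖ₑ ^ 2) (δ μ)
        simp_rw [mul_comm (δ μ _)]
        exact this
    simp_rw [Finset.sum_range_succ, mul_add]
    rw [ENNReal.tsum_add]
    refine (add_le_add h1 h2).trans_eq ?_
    rw [← ENNReal.tsum_add]
    congr 1 with x
    rw [shift_avg]
    ring
  calc ∑' x, S x ^ r ≤ ∑' x, ENNReal.ofReal r * ∑ i ∈ Finset.range L, a i x * A i x :=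
        ENNReal.tsum_le_tsum fun x => sum_range_rpow_le hr.le _ L
    _ = ENNReal.ofReal r *
        ∑' x, ∑ μ ∈ Finset.range L, δ μ x * ∑ i ∈ Finset.range (μ + 1), a i x := by
        rw [ENNReal.tsum_mul_left]
        congr 2 with x
        rw [Finset.sum_congr rfl fun i hi => by rw [hAδ i (Finset.mem_range.1 hi).le x]]
        simp_rw [Finset.mul_sum]
        rw [Finset.sum_comm' (s' := fun μ => Finset.range (μ + 1)) (t' := Finset.range L)]
        · simp_rw [mul_comm]
        · intro i μ
          simp only [Finset.mem_range, Finset.mem_Ico]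
          omega
    _ = ENNReal.ofReal r * ∑ μ ∈ Finset.range L,
          ∑' x, δ μ x * ∑ i ∈ Finset.range (μ + 1), a i x := by
        rw [Summable.tsum_finsetSum fun _ _ => ENNReal.summable]
    _ ≤ ENNReal.ofReal r *
        ∑' μ, ∑' x, ‖f x‖ₑ ^ 2 * (3 * δ μ x + 2 * (F.shift 1).avg μ (δ μ) x) := by
        gcongr
        exact (Finset.sum_le_sum fun μ _ => hμ μ).trans (ENNReal.sum_le_tsum _)
    _ = ENNReal.ofReal r * ∑' x, ‖f x‖ₑ ^ 2 *
          (3 * A 0 x + 2 * ∑' μ, (F.shift 1).avg μ (δ μ) x) := by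
        rw [ENNReal.tsum_comm]
        simp_rw [ENNReal.tsum_mul_left, ENNReal.tsum_add, ENNReal.tsum_mul_left, hδsum]
    _ ≤ ENNReal.ofReal r * (N * ((3 + 2 * ENNReal.ofReal r.conjExponent) *
          seqNorm r.conjExponent (A 0))) := by
        gcongr
        refine (tsum_mul_le_seqNorm hc _ _).trans ?_
        gcongr
        refine (seqNorm_add_le hc.symm.lt.le _ _).trans ?_
        rw [seqNorm_const_mul hc.symm.pos, seqNorm_const_mul hc.symm.pos, add_mul, mul_assoc 2]
        gcongr
        have := (F.shift 1).seqNorm_tsum_avg_le hc.symm.lt.le δ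
        simpa only [hδsum] using this
    _ = _ := by
        have : seqNorm r.conjExponent (A 0) = seqNorm r S ^ (r - 1) := by
          rw [show A 0 = fun x => S x ^ (r - 1) from funext hA0,
            seqNorm_comp_rpow hc.symm.pos (by linarith),
            show (r - 1) * r.conjExponent = r from hc.sub_one_mul_conj]
        rw [this]
        ring

lemma seqNorm_one_square_le (h0 : F.size 0 = 1) (f : X → ℝ) :
    seqNorm 1 (fun x => ∑' i, ‖F.dif i f x‖ₑ ^ 2) ≤ seqNorm 1 (fun x => ‖f x‖ₑ ^ 2) := by
  refine seqNorm_tsum_le_of zero_lt_one _ fun L => ?_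
  have := F.tsum_mul_dif_sq_le (k := L) h0 (h := fun _ => 1) (fun _ _ _ => rfl) f
  simpa [seqNorm] using this

end Filt

section TwoPow

lemma two_rpow_ne_top (a : ℝ) : (2 : ℝ≥0∞) ^ a ≠ ⊤ := by
  simp [ENNReal.rpow_eq_top_iff]

lemma two_rpow_add (a b : ℝ) : (2 : ℝ≥0∞) ^ (a + b) = 2 ^ a * 2 ^ b :=
  ENNReal.rpow_add _ _ (by simp) (by simp)

lemma ofReal_two_rpow (a : ℝ) : ENNReal.ofReal (2 ^ a) = (2 : ℝ≥0∞) ^ a := by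
  rw [← ENNReal.ofReal_rpow_of_pos (by norm_num)]
  simp

lemma tsum_two_rpow_ne_top {γ : ℝ} (hγ : 0 < γ) : ∑' l : ℕ, (2 : ℝ≥0∞) ^ (-(γ * l)) ≠ ⊤ := by
  have : ∀ l : ℕ, (2 : ℝ≥0∞) ^ (-(γ * l)) = ((2 : ℝ≥0∞) ^ (-γ)) ^ l := fun l => by
    rw [← ENNReal.rpow_natCast, ← ENNReal.rpow_mul, neg_mul]
  simp_rw [this]
  rw [ENNReal.tsum_geometric]
  refine ENNReal.inv_ne_top.2 (tsub_pos_of_lt ?_).ne'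
  exact ENNReal.rpow_lt_one_of_one_lt_of_neg (by norm_num) (by linarith)

end TwoPow

section Grid

/-- The shift used at level `ν` of the shifted dyadic grids. -/
def gridShift : ℕ → ℤ
  | 0 => 0
  | ν + 1 => gridShift ν + if Even ν then 2 ^ ν else 0

lemma gridShift_bounds (ν : ℕ) : 3 * gridShift ν ≤ 2 ^ (ν + 1) ∧ 2 ^ ν - 1 ≤ 3 * gridShift ν := by
  have h : 3 * gridShift ν = if Even ν then 2 ^ ν - 1 else 2 ^ (ν + 1) - 1 := by
    induction ν with
    | zero => simp [gridShift]
    | succ ν ih =>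
      rw [gridShift, mul_add, ih]
      by_cases hν : Even ν
      · simp [hν, Nat.even_add_one, pow_succ]; ring
      · simp [hν, Nat.even_add_one, pow_succ]
  have : (0:ℤ) < 2 ^ ν := by positivity
  rw [h]
  split_ifs
  · rw [pow_succ]; omega
  · rw [pow_succ]; omega

/-- The index of the dyadic cell of side `2 ^ ν` containing `x`. -/
def cell {n : ℕ} (ν : ℕ) (x : Fin n → ℤ) : Fin n → ℤ := fun i => x i / 2 ^ ν

variable {n : ℕ}

lemma add_gridShift_succ_ediv (t : ℤ) (ν : ℕ) (x : ℤ) :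
    (x + t * gridShift (ν + 1)) / 2 ^ (ν + 1) =
      ((x + t * gridShift ν) / 2 ^ ν + t * if Even ν then 1 else 0) / 2 := by
  have h2 : (2:ℤ) ^ ν ≠ 0 := by positivity
  have : x + t * gridShift (ν + 1) =
      (x + t * gridShift ν) + (t * if Even ν then 1 else 0) * 2 ^ ν := by
    rw [gridShift]; split_ifs <;> ring
  rw [this, pow_succ, ← Int.ediv_ediv_of_nonneg (by positivity), Int.add_mul_ediv_right _ _ h2]

/-- The dyadic filtration of `ℤⁿ`, shifted by `t i * gridShift ν` in direction `i`. -/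
def grid (t : Fin n → ℤ) : Filt (Fin n → ℤ) where
  blk ν x := Fintype.piFinset fun i =>
    Finset.Ico (2 ^ ν * ((x i + t i * gridShift ν) / 2 ^ ν) - t i * gridShift ν)
      (2 ^ ν * ((x i + t i * gridShift ν) / 2 ^ ν) - t i * gridShift ν + 2 ^ ν)
  size ν := (2 ^ ν) ^ n
  self_mem ν x := by
    simp only [Fintype.mem_piFinset, Finset.mem_Ico]
    intro i
    have h2 : (0:ℤ) < 2 ^ ν := by positivity
    have := Int.mul_ediv_add_emod (x i + t i * gridShift ν) (2 ^ ν)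
    have := Int.emod_nonneg (x i + t i * gridShift ν) h2.ne'
    have := Int.emod_lt_of_pos (x i + t i * gridShift ν) h2
    constructor <;> linarith
  blk_eq {ν x y} h := by
    simp only [Fintype.mem_piFinset, Finset.mem_Ico] at h
    have h2 : (0:ℤ) < 2 ^ ν := by positivity
    have : ∀ i, (y i + t i * gridShift ν) / 2 ^ ν = (x i + t i * gridShift ν) / 2 ^ ν := fun i => by
      rw [Int.ediv_eq_iff_of_pos h2]
      have := h i
      constructor <;> linarith
    simp_rw [this]
  blk_succ ν x := by
    intro y
    simp only [Fintype.mem_piFinset, Finset.mem_Ico]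
    intro h i
    have h2 : (0:ℤ) < 2 ^ ν := by positivity
    have h3 : (0:ℤ) < 2 ^ (ν + 1) := by positivity
    have e : (y i + t i * gridShift ν) / 2 ^ ν = (x i + t i * gridShift ν) / 2 ^ ν := by
      rw [Int.ediv_eq_iff_of_pos h2]
      have := h i
      constructor <;> linarith
    have e2 : (y i + t i * gridShift (ν + 1)) / 2 ^ (ν + 1) =
        (x i + t i * gridShift (ν + 1)) / 2 ^ (ν + 1) := by
      rw [add_gridShift_succ_ediv, add_gridShift_succ_ediv, e]
    rw [Int.ediv_eq_iff_of_pos h3] at e2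
    constructor <;> linarith [e2.1, e2.2]
  card_blk ν x := by
    rw [Fintype.card_piFinset]
    simp only [Int.card_Ico, add_sub_cancel_left, Finset.prod_const, Finset.card_univ,
      Fintype.card_fin]
    congr 1
  size_pos ν := by positivity

lemma mem_grid_blk {t : Fin n → ℤ} {ν : ℕ} {x y : Fin n → ℤ} :
    y ∈ (grid t).blk ν x ↔
      ∀ i, (y i + t i * gridShift ν) / 2 ^ ν = (x i + t i * gridShift ν) / 2 ^ ν := by
  simp only [grid, Fintype.mem_piFinset, Finset.mem_Ico]
  refine forall_congr' fun i => ?_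
  rw [Int.ediv_eq_iff_of_pos (by positivity)]
  constructor <;> rintro ⟨h1, h2⟩ <;> constructor <;> linarith

/-- The standard dyadic filtration of `ℤⁿ`. -/
abbrev stdGrid (n : ℕ) : Filt (Fin n → ℤ) := grid 0

lemma mem_stdGrid_blk {ν : ℕ} {x y : Fin n → ℤ} :
    y ∈ (stdGrid n).blk ν x ↔ cell ν y = cell ν x := by
  rw [mem_grid_blk, funext_iff]
  simp [cell]

lemma grid_size (t : Fin n → ℤ) (ν : ℕ) : ((grid t).size ν : ℝ≥0∞) = 2 ^ ((ν * n : ℝ)) := by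
  simp only [grid]
  rw [ENNReal.rpow_mul, ENNReal.rpow_natCast, ENNReal.rpow_natCast]
  push_cast
  rfl

lemma exists_shift_same_cell {ν : ℕ} (hν : 2 ≤ ν) {x y : ℤ} (h : 8 * |x - y| < 2 ^ ν) :
    ∃ b : Bool, (y + (if b then 1 else 0) * gridShift ν) / 2 ^ ν =
      (x + (if b then 1 else 0) * gridShift ν) / 2 ^ ν := by
  wlog hxy : x ≤ y generalizing x y
  · obtain ⟨b, hb⟩ := this (by rwa [abs_sub_comm] at h) (le_of_not_ge hxy)
    exact ⟨b, hb.symm⟩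
  rw [abs_of_nonpos (by linarith)] at h
  obtain ⟨h1, h2⟩ := gridShift_bounds ν
  have h4 : (4:ℤ) ≤ 2 ^ ν := by
    calc (4:ℤ) = 2 ^ 2 := by norm_num
      _ ≤ 2 ^ ν := pow_le_pow_right₀ (by norm_num) hν
  rw [pow_succ] at h1
  set M : ℤ := 2 ^ ν
  have hM : 0 < M := by linarith
  by_cases he : y / M = x / M
  · exact ⟨false, by simpa using he⟩
  refine ⟨true, ?_⟩
  simp only [if_true, one_mul]
  have hx1 := Int.mul_ediv_add_emod x M
  have hx2 := Int.emod_nonneg x hM.ne'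
  have hx3 := Int.emod_lt_of_pos x hM
  have hy1 := Int.mul_ediv_add_emod y M
  have hy2 := Int.emod_nonneg y hM.ne'
  have hy3 := Int.emod_lt_of_pos y hM
  have hle : x / M ≤ y / M := Int.ediv_le_ediv hM hxy
  have hlt : x / M + 1 ≤ y / M := by omega
  have heq : y / M = x / M + 1 := by
    refine le_antisymm ?_ hlt
    by_contra hc
    have : x / M + 2 ≤ y / M := by omega
    nlinarith
  rw [heq] at hy1
  have e1 : (x + gridShift ν) / M = x / M + 1 := by
    rw [Int.ediv_eq_iff_of_pos hM]
    constructor <;> nlinarith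
  have e2 : (y + gridShift ν) / M = x / M + 1 := by
    rw [Int.ediv_eq_iff_of_pos hM]
    constructor <;> nlinarith
  rw [e1, e2]

lemma abs_sub_lt_of_cell {i l : ℕ} {x y : ℤ} (h : |x / 2 ^ i - y / 2 ^ i| < 2 ^ l) :
    |x - y| < 2 ^ (i + l) := by
  have hM : (0:ℤ) < 2 ^ i := by positivity
  rw [pow_add]
  set M : ℤ := 2 ^ i
  set A : ℤ := 2 ^ l
  have hx1 := Int.mul_ediv_add_emod x M
  have hx2 := Int.emod_nonneg x hM.ne'
  have hx3 := Int.emod_lt_of_pos x hM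
  have hy1 := Int.mul_ediv_add_emod y M
  have hy2 := Int.emod_nonneg y hM.ne'
  have hy3 := Int.emod_lt_of_pos y hM
  have h' : |x / M - y / M| ≤ A - 1 := by omega
  rw [abs_le] at h'
  rw [abs_lt]
  have a1 := mul_le_mul_of_nonneg_left h'.1 hM.le
  have a2 := mul_le_mul_of_nonneg_left h'.2 hM.le
  constructor <;> nlinarith

/-- The decaying weight `(1 + |e|)^{-n-γ}`. -/
def wt (n : ℕ) (γ : ℝ) (e : Fin n → ℤ) : ℝ≥0∞ := ENNReal.ofReal ((1 + ‖e‖) ^ (-(n + γ)))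

lemma wt_le_tsum {γ : ℝ} (hγ : 0 < γ) (e : Fin n → ℤ) :
    wt n γ e ≤ 2 ^ (n + γ) *
      ∑' l : ℕ, (2 : ℝ≥0∞) ^ (-((n + γ) * l)) * if ‖e‖ < 2 ^ l then 1 else 0 := by
  set k := ⌊‖e‖⌋₊ + 1 with hk
  set l := Nat.log 2 k + 1 with hl
  have h1 : ‖e‖ < 2 ^ l := by
    have a : ‖e‖ < k := by rw [hk]; push_cast; exact Nat.lt_floor_add_one _
    have b : k < 2 ^ l := Nat.lt_pow_succ_log_self (by norm_num) k
    exact a.trans (by exact_mod_cast b)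
  have h2 : (2:ℝ) ^ (l : ℝ) ≤ 2 * (1 + ‖e‖) := by
    have a : 2 ^ Nat.log 2 k ≤ k := Nat.pow_log_le_self 2 (by omega)
    have b : (k : ℝ) ≤ 1 + ‖e‖ := by
      rw [hk]; push_cast
      linarith [Nat.floor_le (norm_nonneg e)]
    rw [Real.rpow_natCast, hl, pow_succ]
    have : ((2 ^ Nat.log 2 k : ℕ) : ℝ) ≤ k := by exact_mod_cast a
    push_cast at this
    linarith
  refine le_trans ?_ (mul_le_mul_right (ENNReal.le_tsum l) _)
  rw [if_pos h1, mul_one, wt, ← two_rpow_add, ← ofReal_two_rpow]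
  refine ENNReal.ofReal_le_ofReal ?_
  have h3 : (2:ℝ) ^ ((l:ℝ) - 1) ≤ 1 + ‖e‖ := by
    rw [Real.rpow_sub (by norm_num), Real.rpow_one]
    linarith
  calc (1 + ‖e‖) ^ (-(n + γ)) ≤ ((2:ℝ) ^ ((l:ℝ) - 1)) ^ (-(n + γ)) := by
        refine Real.rpow_le_rpow_of_nonpos (by positivity) h3 ?_
        have : (0:ℝ) ≤ n := by positivity
        linarith
    _ = _ := by
        rw [← Real.rpow_mul (by norm_num)]
        congr 1; ring

/-- The discrete Poisson-like averaging operator at scale `2 ^ i`. -/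
def poisson (γ : ℝ) (i : ℕ) (u : (Fin n → ℤ) → ℝ≥0∞) (x : Fin n → ℤ) : ℝ≥0∞ :=
  2 ^ (-(i * n : ℝ)) * ∑' y, wt n γ (cell i x - cell i y) * u y

/-- The translation parameter of the grid attached to a choice of directions. -/
def gridDir (b : Fin n → Bool) : Fin n → ℤ := fun i => if b i then 1 else 0

lemma indicator_le_sum_grid {i l : ℕ} (x y : Fin n → ℤ) :
    (if ‖cell i x - cell i y‖ < (2:ℝ) ^ l then (1 : ℝ≥0∞) else 0) ≤
      ∑ b : Fin n → Bool, if y ∈ (grid (gridDir b)).blk (i + (l + 3)) x then 1 else 0 := by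
  split_ifs with h
  · have hex : ∀ k, ∃ b : Bool, (y k + (if b then 1 else 0) * gridShift (i + (l + 3))) /
        2 ^ (i + (l + 3)) = (x k + (if b then 1 else 0) * gridShift (i + (l + 3))) /
        2 ^ (i + (l + 3)) := by
      intro k
      refine exists_shift_same_cell (by omega) ?_
      have h1 : ‖(cell i x - cell i y) k‖ < (2:ℝ) ^ l := (norm_le_pi_norm _ k).trans_lt h
      have h2 : |x k / 2 ^ i - y k / 2 ^ i| < 2 ^ l := by
        rw [Pi.sub_apply, cell, cell, Int.norm_eq_abs] at h1
        exact_mod_cast h1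
      have := abs_sub_lt_of_cell h2
      rw [show i + (l + 3) = (i + l) + 3 by ring, pow_add]
      omega
    choose b hb using hex
    refine le_trans ?_ (Finset.single_le_sum (f := fun b : Fin n → Bool =>
      if y ∈ (grid (gridDir b)).blk (i + (l + 3)) x then (1 : ℝ≥0∞) else 0)
      (fun _ _ => zero_le) (Finset.mem_univ b))
    rw [if_pos (show y ∈ (grid (gridDir b)).blk (i + (l + 3)) x from mem_grid_blk.2 hb)]
  · exact zero_le

lemma poisson_le {γ : ℝ} (hγ : 0 < γ) (i : ℕ) (u : (Fin n → ℤ) → ℝ≥0∞) (x : Fin n → ℤ) :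
    poisson γ i u x ≤ 2 ^ (n + γ) * 2 ^ (3 * n : ℝ) * ∑' l : ℕ, (2 : ℝ≥0∞) ^ (-(γ * l)) *
      ∑ b : Fin n → Bool, (grid (gridDir b)).avg (i + (l + 3)) u x := by
  have key : ∀ (l : ℕ) (b : Fin n → Bool), (2:ℝ≥0∞) ^ (-(i * n : ℝ)) * (2 ^ (-((n + γ) * l)) *
      ∑' y, (if y ∈ (grid (gridDir b)).blk (i + (l + 3)) x then 1 else 0) * u y) =
      2 ^ (3 * n : ℝ) * (2 ^ (-(γ * l)) * (grid (gridDir b)).avg (i + (l + 3)) u x) := by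
    intro l b
    rw [Filt.avg, grid_size, ← ENNReal.rpow_neg]
    have : ∑' y, (if y ∈ (grid (gridDir b)).blk (i + (l + 3)) x then (1 : ℝ≥0∞) else 0) * u y =
        ∑ y ∈ (grid (gridDir b)).blk (i + (l + 3)) x, u y := by
      rw [tsum_eq_sum (s := (grid (gridDir b)).blk (i + (l + 3)) x) (by intro y hy; simp [hy])]
      exact Finset.sum_congr rfl fun y hy => by simp [hy]
    rw [this]
    simp_rw [← mul_assoc, ← two_rpow_add]
    congr 2
    push_cast
    ring
  calc poisson γ i u x
      ≤ 2 ^ (-(i * n : ℝ)) * ∑' y, (2 ^ (n + γ) * ∑' l : ℕ, (2 : ℝ≥0∞) ^ (-((n + γ) * l)) *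
          ∑ b : Fin n → Bool, if y ∈ (grid (gridDir b)).blk (i + (l + 3)) x then 1 else 0) *
            u y := by
        rw [poisson]
        gcongr with y
        refine (wt_le_tsum hγ _).trans ?_
        gcongr
        exact indicator_le_sum_grid x y
    _ = 2 ^ (n + γ) * ∑' l : ℕ, ∑ b : Fin n → Bool, (2:ℝ≥0∞) ^ (-(i * n : ℝ)) *
          (2 ^ (-((n + γ) * l)) *
            ∑' y, (if y ∈ (grid (gridDir b)).blk (i + (l + 3)) x then 1 else 0) * u y) := by
        have e : ∀ y, (2 ^ (n + γ) * ∑' l : ℕ, (2 : ℝ≥0∞) ^ (-((n + γ) * l)) *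
            ∑ b : Fin n → Bool, if y ∈ (grid (gridDir b)).blk (i + (l + 3)) x then 1 else 0) *
              u y = 2 ^ (n + γ) * ∑' l : ℕ, ∑ b : Fin n → Bool, (2 : ℝ≥0∞) ^ (-((n + γ) * l)) *
            ((if y ∈ (grid (gridDir b)).blk (i + (l + 3)) x then 1 else 0) * u y) := fun y => by
          rw [mul_assoc, ← ENNReal.tsum_mul_right]
          simp_rw [mul_assoc, Finset.sum_mul, Finset.mul_sum]
        simp_rw [e]
        rw [ENNReal.tsum_mul_left, ENNReal.tsum_comm, mul_left_comm, ← ENNReal.tsum_mul_left]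
        congr 1
        refine tsum_congr fun l => ?_
        rw [Summable.tsum_finsetSum fun _ _ => ENNReal.summable, Finset.mul_sum]
        exact Finset.sum_congr rfl fun b _ => by rw [ENNReal.tsum_mul_left]
    _ = _ := by
        simp_rw [key, ← Finset.mul_sum, ENNReal.tsum_mul_left]
        ring

/-- `ℓ^r` boundedness of a sum of Poisson-like averages. -/
lemma seqNorm_tsum_poisson_le {γ r : ℝ} (hγ : 0 < γ) (hr : 1 ≤ r) :
    ∃ C : NNReal, ∀ u : ℕ → (Fin n → ℤ) → ℝ≥0∞,
      seqNorm r (fun x => ∑' i, poisson γ i (u i) x) ≤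
        C * seqNorm r (fun x => ∑' i, u i x) := by
  have hr0 : 0 < r := by linarith
  set D : ℝ≥0∞ := 2 ^ (n + γ) * 2 ^ (3 * n : ℝ) * ((∑' l : ℕ, (2 : ℝ≥0∞) ^ (-(γ * l))) *
    ((Fintype.card (Fin n → Bool)) * ENNReal.ofReal r)) with hD
  have hDt : D ≠ ⊤ := by
    refine ENNReal.mul_ne_top (ENNReal.mul_ne_top (two_rpow_ne_top _) (two_rpow_ne_top _)) ?_
    refine ENNReal.mul_ne_top (tsum_two_rpow_ne_top hγ) (ENNReal.mul_ne_top (by simp) (by simp))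
  refine ⟨D.toNNReal, fun u => ?_⟩
  rw [ENNReal.coe_toNNReal hDt]
  calc seqNorm r (fun x => ∑' i, poisson γ i (u i) x)
      ≤ seqNorm r (fun x => 2 ^ (n + γ) * 2 ^ (3 * n : ℝ) * ∑' l : ℕ, (2 : ℝ≥0∞) ^ (-(γ * l)) *
          ∑ b : Fin n → Bool, ∑' i, ((grid (gridDir b)).shift (l + 3)).avg i (u i) x) := by
        refine seqNorm_mono hr0 fun x =>
          (ENNReal.tsum_le_tsum fun i => poisson_le hγ i _ x).trans ?_
        rw [ENNReal.tsum_mul_left, ENNReal.tsum_comm]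
        simp_rw [ENNReal.tsum_mul_left, Summable.tsum_finsetSum fun _ _ => ENNReal.summable]
        rfl
    _ ≤ 2 ^ (n + γ) * 2 ^ (3 * n : ℝ) * ∑' l : ℕ, (2 : ℝ≥0∞) ^ (-(γ * l)) *
          ∑ b : Fin n → Bool, ENNReal.ofReal r * seqNorm r (fun x => ∑' i, u i x) := by
        rw [seqNorm_const_mul hr0]
        gcongr
        refine (seqNorm_tsum_le hr _).trans ?_
        gcongr with l
        rw [seqNorm_const_mul hr0]
        gcongr
        refine (seqNorm_sum_le hr _ _).trans ?_
        gcongr with b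
        exact Filt.seqNorm_tsum_avg_le _ hr u
    _ = _ := by
        rw [ENNReal.tsum_mul_right, Finset.sum_const, nsmul_eq_mul, Finset.card_univ, hD]
        ring

end Grid

section Kernel

variable {n : ℕ}

lemma stdGrid_size_zero : (stdGrid n).size 0 = 1 := by simp [grid]

lemma tendsto_stdGrid_size (hn : 0 < n) :
    Filter.Tendsto (stdGrid n).size Filter.atTop Filter.atTop := by
  refine Filter.tendsto_atTop_mono (f := id) (fun ν => ?_) Filter.tendsto_id
  exact (Nat.lt_two_pow_self).le.trans (Nat.le_self_pow hn.ne' _)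

lemma cell_cell (j κ : ℕ) (x : Fin n → ℤ) : cell j (cell κ x) = cell (κ + j) x := by
  funext i
  simp only [cell]
  rw [Int.ediv_ediv_of_nonneg (by positivity), pow_add]

lemma cell_add_smul (κ : ℕ) (x m : Fin n → ℤ) :
    cell κ (x + (2:ℤ) ^ κ • m) = cell κ x + m := by
  funext i
  simp only [cell, Pi.add_apply, Pi.smul_apply, smul_eq_mul]
  rw [Int.add_mul_ediv_left _ _ (by positivity)]

lemma isConst_of_cell {α : Type*} {κ : ℕ} (B : (Fin n → ℤ) → α) :
    (stdGrid n).IsConst κ fun x => B (cell κ x) := fun x y hy => by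
  simp only [mem_stdGrid_blk.1 hy]

lemma wt_neg (γ : ℝ) (e : Fin n → ℤ) : wt n γ (-e) = wt n γ e := by simp [wt]

lemma wt_zero (γ : ℝ) : wt n γ 0 = 1 := by simp [wt]

lemma tsum_wt_ne_top {γ : ℝ} (hγ : 0 < γ) : ∑' m : Fin n → ℤ, wt n γ m ≠ ⊤ := by
  have h := poisson_le (n := n) hγ 0 (fun _ => 1) 0
  have e : poisson γ 0 (fun _ => 1) (0 : Fin n → ℤ) = ∑' m : Fin n → ℤ, wt n γ m := by
    rw [poisson]
    simp only [Nat.cast_zero, zero_mul, neg_zero, ENNReal.rpow_zero, one_mul, mul_one]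
    refine tsum_congr fun m => ?_
    rw [← wt_neg]
    congr 1
    funext i
    simp [cell]
  rw [← e]
  refine ne_top_of_le_ne_top ?_ h
  have h1 : ∀ (b : Fin n → Bool) (l : ℕ), (grid (gridDir b)).avg l (fun _ => 1) 0 = 1 :=
    fun b l => Filt.avg_const _ (fun _ _ _ => rfl) _
  simp only [h1]
  rw [ENNReal.tsum_mul_right]
  exact ENNReal.mul_ne_top (ENNReal.mul_ne_top (two_rpow_ne_top _) (two_rpow_ne_top _))
    (ENNReal.mul_ne_top (tsum_two_rpow_ne_top hγ) (by simp))

lemma sum_wt_cell_of_far {γ : ℝ} (hγ : 0 < γ) (j : ℕ) {y w v : Fin n → ℤ}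
    (hd : 2 ≤ ‖w - cell j y‖) (hv : cell j v = w) :
    wt n γ (v - y) ≤ 2 ^ (-(j * n : ℝ)) * ENNReal.ofReal (3 ^ (n + γ)) * wt n γ (w - cell j y) := by
  have h2 : (0:ℝ) < 2 ^ j := by positivity
  have hkey : (1 + ‖w - cell j y‖) * 2 ^ j ≤ 3 * (1 + ‖v - y‖) := by
    have h1 : ‖w - cell j y‖ ≤ ‖v - y‖ / 2 ^ j + 1 := by
      refine (pi_norm_le_iff_of_nonneg (by positivity)).2 fun i => ?_
      have e1 : |((v i / 2 ^ j - y i / 2 ^ j : ℤ) : ℝ)| ≤ |((v i - y i : ℤ):ℝ)| / 2 ^ j + 1 := by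
        have a1 := Int.mul_ediv_add_emod (v i) (2 ^ j)
        have a2 := Int.emod_nonneg (v i) (show (2:ℤ) ^ j ≠ 0 by positivity)
        have a3 := Int.emod_lt_of_pos (v i) (show (0:ℤ) < 2 ^ j by positivity)
        have b1 := Int.mul_ediv_add_emod (y i) (2 ^ j)
        have b2 := Int.emod_nonneg (y i) (show (2:ℤ) ^ j ≠ 0 by positivity)
        have b3 := Int.emod_lt_of_pos (y i) (show (0:ℤ) < 2 ^ j by positivity)
        have c : 2 ^ j * |v i / 2 ^ j - y i / 2 ^ j| ≤ |v i - y i| + 2 ^ j := by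
          rw [← abs_of_pos (show (0:ℤ) < 2 ^ j by positivity), ← abs_mul,
            abs_of_pos (show (0:ℤ) < 2 ^ j by positivity)]
          rw [abs_le]
          have := neg_abs_le (v i - y i)
          have := le_abs_self (v i - y i)
          constructor <;> nlinarith
        have c' : (2:ℝ) ^ j * |((v i / 2 ^ j - y i / 2 ^ j : ℤ) : ℝ)| ≤
            |((v i - y i : ℤ):ℝ)| + 2 ^ j := by exact_mod_cast c
        rw [div_add_one h2.ne', le_div_iff₀ h2]
        linarith
      rw [← hv]
      refine (Int.norm_eq_abs _).trans_le (e1.trans ?_)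
      gcongr
      rw [← Int.norm_eq_abs]
      exact norm_le_pi_norm (v - y) i
    rw [div_add_one h2.ne', le_div_iff₀ h2] at h1
    nlinarith
  have hpos : 0 ≤ (n + γ) := by positivity
  rw [wt, wt, ← ofReal_two_rpow, ← ENNReal.ofReal_mul (by positivity),
    ← ENNReal.ofReal_mul (by positivity)]
  refine ENNReal.ofReal_le_ofReal ?_
  have hb : (1 + ‖w - cell j y‖) * 2 ^ j / 3 ≤ 1 + ‖v - y‖ := by linarith
  have ht : 0 ≤ ‖w - cell j y‖ := norm_nonneg _
  calc (1 + ‖v - y‖) ^ (-(n + γ)) ≤ ((1 + ‖w - cell j y‖) * 2 ^ j / 3) ^ (-(n + γ)) :=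
        Real.rpow_le_rpow_of_nonpos (by positivity) hb (by linarith)
    _ = (2:ℝ) ^ (-(j * (n + γ))) * 3 ^ (n + γ) * (1 + ‖w - cell j y‖) ^ (-(n + γ)) := by
        rw [Real.div_rpow (by positivity) (by positivity), Real.mul_rpow (by positivity)
          (by positivity), Real.rpow_neg (x := 3) (by positivity), ← Real.rpow_natCast,
          ← Real.rpow_mul (by norm_num), div_inv_eq_mul, mul_neg]
        ring
    _ ≤ _ := by
        gcongr
        · norm_num
        · nlinarith [mul_nonneg (Nat.cast_nonneg (α := ℝ) j) hγ.le]

/-- Coarsening the weight to a scale `2 ^ j`. -/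
lemma tsum_wt_cell_le {γ : ℝ} (hγ : 0 < γ) : ∃ C : NNReal, ∀ (j : ℕ) (y w : Fin n → ℤ),
    ∑' v, (if cell j v = w then wt n γ (v - y) else 0) ≤ C * wt n γ (w - cell j y) := by
  set W : ℝ≥0∞ := ∑' m : Fin n → ℤ, wt n γ m with hW
  have hWt : W ≠ ⊤ := tsum_wt_ne_top hγ
  set D : ℝ≥0∞ := ENNReal.ofReal (3 ^ (n + γ)) * (1 + W) with hD
  have hDt : D ≠ ⊤ := ENNReal.mul_ne_top ENNReal.ofReal_ne_top (by simp [hWt])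
  refine ⟨D.toNNReal, fun j y w => ?_⟩
  rw [ENNReal.coe_toNNReal hDt]
  rcases le_or_gt 2 ‖w - cell j y‖ with hd | hd
  · have hc : ∃ x, cell j x = w := ⟨fun i => w i * 2 ^ j, by funext i; simp [cell]⟩
    obtain ⟨x, hx⟩ := hc
    calc ∑' v, (if cell j v = w then wt n γ (v - y) else 0)
        ≤ ∑' v, if v ∈ (stdGrid n).blk j x then
            2 ^ (-(j * n : ℝ)) * ENNReal.ofReal (3 ^ (n + γ)) * wt n γ (w - cell j y) else 0 := by
          gcongr with v
          by_cases h : cell j v = w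
          · rw [if_pos h, if_pos (mem_stdGrid_blk.2 (h.trans hx.symm))]
            exact sum_wt_cell_of_far hγ j hd h
          · rw [if_neg h]
            exact zero_le
      _ = ENNReal.ofReal (3 ^ (n + γ)) * wt n γ (w - cell j y) := by
          rw [tsum_eq_sum (s := (stdGrid n).blk j x) (by intro b hb; simp [hb]),
            Finset.sum_congr rfl fun v hv => if_pos hv, Finset.sum_const, (stdGrid n).card_blk,
            nsmul_eq_mul, grid_size, ← mul_assoc, ← mul_assoc, ← two_rpow_add]
          simp
      _ ≤ _ := by
          rw [hD]
          gcongr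
          exact le_mul_of_one_le_right' (by simp)
  · have h1 : 1 ≤ ENNReal.ofReal (3 ^ (n + γ)) * wt n γ (w - cell j y) := by
      rw [wt, ← ENNReal.ofReal_mul (by positivity), ← ENNReal.ofReal_one]
      refine ENNReal.ofReal_le_ofReal ?_
      rw [Real.rpow_neg (by positivity), ← div_eq_mul_inv, one_le_div (by positivity)]
      gcongr
      linarith
    calc ∑' v, (if cell j v = w then wt n γ (v - y) else 0) ≤ ∑' v, wt n γ (v - y) := by
          gcongr with v
          split_ifs <;> simp
      _ = W := (Equiv.subRight y).tsum_eq (wt n γ)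
      _ ≤ 1 * (1 + W) := by rw [one_mul]; exact le_add_self
      _ ≤ (ENNReal.ofReal (3 ^ (n + γ)) * wt n γ (w - cell j y)) * (1 + W) := by gcongr
      _ = _ := by rw [hD]; ring

lemma tsum_wt_cell_shift_le {γ : ℝ} (hγ : 0 < γ) : ∃ C : NNReal, ∀ (κ j : ℕ) (x w : Fin n → ℤ),
    ∑' m, (if cell (κ + j) (x + (2:ℤ) ^ κ • m) = w then wt n γ m else 0) ≤
      C * wt n γ (w - cell (κ + j) x) := by
  obtain ⟨C, hC⟩ := tsum_wt_cell_le (n := n) hγ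
  refine ⟨C, fun κ j x w => ?_⟩
  refine le_trans (le_of_eq ?_) ((hC j (cell κ x) w).trans_eq (by rw [cell_cell]))
  rw [← (Equiv.addLeft (cell κ x)).tsum_eq
    (fun v => if cell j v = w then wt n γ (v - cell κ x) else 0)]
  refine tsum_congr fun m => ?_
  simp only [Equiv.coe_addLeft, ← cell_cell, cell_add_smul, add_sub_cancel_left]

lemma tsum_blk_eq {ν : ℕ} (u : (Fin n → ℤ) → ℝ≥0∞) (x : Fin n → ℤ) :
    ∑ y ∈ (stdGrid n).blk ν x, u y = ∑' y, if cell ν y = cell ν x then u y else 0 := by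
  rw [tsum_eq_sum (s := (stdGrid n).blk ν x) (by
    intro b hb; rw [mem_stdGrid_blk] at hb; simp [hb])]
  exact Finset.sum_congr rfl fun y hy => by rw [if_pos (mem_stdGrid_blk.1 hy)]

lemma stdGrid_avg (ν : ℕ) (u : (Fin n → ℤ) → ℝ≥0∞) (x : Fin n → ℤ) :
    (stdGrid n).avg ν u x = 2 ^ (-(ν * n : ℝ)) *
      ∑' y, if cell ν y = cell ν x then u y else 0 := by
  rw [Filt.avg, grid_size, ← ENNReal.rpow_neg, tsum_blk_eq]

lemma tsum_wt_avg_le_poisson {γ : ℝ} (hγ : 0 < γ) : ∃ C : NNReal,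
    ∀ (κ j : ℕ) (u : (Fin n → ℤ) → ℝ≥0∞) (x : Fin n → ℤ),
      ∑' m, wt n γ m * (stdGrid n).avg (κ + j) u (x + (2:ℤ) ^ κ • m) ≤
        C * poisson γ (κ + j) u x := by
  obtain ⟨C, hC⟩ := tsum_wt_cell_shift_le (n := n) hγ
  refine ⟨C, fun κ j u x => ?_⟩
  calc ∑' m, wt n γ m * (stdGrid n).avg (κ + j) u (x + (2:ℤ) ^ κ • m)
      = 2 ^ (-((κ + j : ℕ) * n : ℝ)) * ∑' y, (∑' m,
          if cell (κ + j) (x + (2:ℤ) ^ κ • m) = cell (κ + j) y then wt n γ m else 0) * u y := by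
        simp_rw [stdGrid_avg, ← ENNReal.tsum_mul_left, ← ENNReal.tsum_mul_right]
        rw [ENNReal.tsum_comm]
        refine tsum_congr fun y => ?_
        rw [← ENNReal.tsum_mul_left]
        refine tsum_congr fun m => ?_
        split_ifs with h1 h2 h2
        · ring
        · exact absurd h1.symm h2
        · exact absurd h2.symm h1
        · simp
    _ ≤ 2 ^ (-((κ + j : ℕ) * n : ℝ)) * ∑' y, (C * wt n γ (cell (κ + j) x - cell (κ + j) y)) *
          u y := by
        gcongr with y
        refine (hC κ j x _).trans_eq ?_
        rw [← wt_neg, neg_sub]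
    _ = _ := by
        rw [poisson]
        simp_rw [mul_assoc, ENNReal.tsum_mul_left]
        ring

lemma avg_le_poisson (γ : ℝ) (ν : ℕ) (u : (Fin n → ℤ) → ℝ≥0∞) (x : Fin n → ℤ) :
    (stdGrid n).avg ν u x ≤ poisson γ ν u x := by
  rw [stdGrid_avg, poisson]
  gcongr with y
  split_ifs with h
  · rw [h, sub_self, wt_zero, one_mul]
  · exact zero_le

lemma isConst_poisson (γ : ℝ) (ν : ℕ) (u : (Fin n → ℤ) → ℝ≥0∞) :
    (stdGrid n).IsConst ν (poisson γ ν u) := fun x y hy => by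
  rw [poisson, poisson, mem_stdGrid_blk.1 hy]

end Kernel

lemma Filt.avg_tsum {X ι : Type*} (F : Filt X) (ν : ℕ) (u : ι → X → ℝ≥0∞) (x : X) :
    F.avg ν (fun y => ∑' m, u m y) x = ∑' m, F.avg ν (u m) x := by
  simp only [Filt.avg, ENNReal.tsum_mul_left]
  rw [Summable.tsum_finsetSum fun _ _ => ENNReal.summable]

section Jump

variable {n : ℕ}

/-- The indicator of the points which are moved to a different block by the translation `t`. -/
def jump (ν : ℕ) (t x : Fin n → ℤ) : ℝ≥0∞ := if cell ν (x + t) = cell ν x then 0 else 1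

lemma jump_le_one (ν : ℕ) (t x : Fin n → ℤ) : jump ν t x ≤ 1 := by
  rw [jump]; split_ifs <;> simp

lemma card_filter_ediv_ne_le (N : ℤ) (hN : 0 < N) (q t : ℤ) :
    ((Finset.Ico (N * q) (N * q + N)).filter fun a => (a + t) / N ≠ a / N).card ≤ t.natAbs := by
  have : ((Finset.Ico (N * q) (N * q + N)).filter fun a => (a + t) / N ≠ a / N) ⊆
      if 0 ≤ t then Finset.Ico (N * q + N - t) (N * q + N) else Finset.Ico (N * q) (N * q - t) := by
    intro a ha
    rw [Finset.mem_filter, Finset.mem_Ico] at ha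
    obtain ⟨⟨h1, h2⟩, h3⟩ := ha
    have e : a / N = q := by
      rw [Int.ediv_eq_iff_of_pos hN]; constructor <;> linarith
    rw [e, ne_eq, Int.ediv_eq_iff_of_pos hN, not_and_or] at h3
    split_ifs with ht <;> rw [Finset.mem_Ico]
    · refine ⟨?_, h2⟩
      by_contra h4
      rcases h3 with h3 | h3 <;> exact h3 (by linarith)
    · refine ⟨h1, ?_⟩
      by_contra h4
      rcases h3 with h3 | h3 <;> exact h3 (by linarith)
  refine (Finset.card_le_card this).trans ?_
  split_ifs <;> rw [Int.card_Ico] <;> omega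

lemma avg_jump_le (ν : ℕ) (t z : Fin n → ℤ) :
    (stdGrid n).avg ν (jump ν t) z ≤ ENNReal.ofReal (n * ‖t‖ / 2 ^ ν) := by
  set I : Fin n → Finset ℤ := fun i => Finset.Ico (2 ^ ν * (z i / 2 ^ ν))
    (2 ^ ν * (z i / 2 ^ ν) + 2 ^ ν) with hI
  have hblk : (stdGrid n).blk ν z = Fintype.piFinset I := by
    simp [grid, hI]
  set S : Fin n → Finset ℤ := fun i => (I i).filter fun a => (a + t i) / 2 ^ ν ≠ a / 2 ^ ν with hS
  have hcard : ∀ i, ((Fintype.piFinset (Function.update I i (S i))).card : ℝ≥0∞) ≤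
      ENNReal.ofReal ‖t‖ * ((stdGrid n).size ν * (2 ^ ν)⁻¹) := by
    intro i
    rw [Fintype.card_piFinset]
    have e : ∀ k, (Function.update I i (S i) k).card =
        Function.update (fun k => (I k).card) i (S i).card k := by
      intro k
      rcases eq_or_ne k i with rfl | h <;> simp [*]
    simp_rw [e]
    rw [Finset.prod_update_of_mem (Finset.mem_univ i)]
    have e2 : ∀ k, (I k).card = 2 ^ ν := fun k => by
      simp only [hI, Int.card_Ico, add_sub_cancel_left]
      exact_mod_cast Int.toNat_natCast (2 ^ ν)
    simp_rw [e2]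
    rw [Finset.prod_const, Finset.card_sdiff_of_subset (by simp)]
    simp only [Finset.card_univ, Fintype.card_fin, Finset.card_singleton]
    have h3 : (stdGrid n).size ν = (2 ^ ν) ^ (n - 1) * 2 ^ ν := by
      simp only [grid]
      rw [← pow_succ, Nat.sub_add_cancel (i.pos)]
    rw [h3]
    push_cast
    rw [mul_assoc _ ((2:ℝ≥0∞) ^ ν), ENNReal.mul_inv_cancel (by simp) (by simp), mul_one]
    gcongr
    have h4 := card_filter_ediv_ne_le (2 ^ ν) (by positivity) (z i / 2 ^ ν) (t i)
    have h5 : ((t i).natAbs : ℝ) ≤ ‖t‖ := by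
      refine le_trans (le_of_eq ?_) (norm_le_pi_norm t i)
      rw [Int.norm_eq_abs, Nat.cast_natAbs, Int.cast_abs]
    calc ((S i).card : ℝ≥0∞) ≤ ((t i).natAbs : ℝ≥0∞) := by exact_mod_cast h4
      _ = ENNReal.ofReal ((t i).natAbs : ℝ) := by rw [ENNReal.ofReal_natCast]
      _ ≤ _ := ENNReal.ofReal_le_ofReal h5
  have hsum : ∑ y ∈ (stdGrid n).blk ν z, jump ν t y ≤
      ∑ i, ((Fintype.piFinset (Function.update I i (S i))).card : ℝ≥0∞) := by
    rw [hblk]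
    calc ∑ y ∈ Fintype.piFinset I, jump ν t y
        ≤ ∑ y ∈ Fintype.piFinset I, ∑ i,
          if y ∈ Fintype.piFinset (Function.update I i (S i)) then (1 : ℝ≥0∞) else 0 := by
          refine Finset.sum_le_sum fun y hy => ?_
          rw [jump]
          split_ifs with h
          · exact zero_le
          · obtain ⟨i, hi⟩ := Function.ne_iff.1 h
            refine le_trans ?_ (Finset.single_le_sum (f := fun i =>
              if y ∈ Fintype.piFinset (Function.update I i (S i)) then (1 : ℝ≥0∞) else 0)
              (fun _ _ => zero_le) (Finset.mem_univ i))
            rw [if_pos]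
            rw [Fintype.mem_piFinset] at hy ⊢
            intro k
            rcases eq_or_ne k i with rfl | hk
            · simp only [Function.update_self, hS, Finset.mem_filter]
              exact ⟨hy k, hi⟩
            · simpa [hk] using hy k
      _ = ∑ i, ∑ y ∈ Fintype.piFinset I,
          if y ∈ Fintype.piFinset (Function.update I i (S i)) then (1 : ℝ≥0∞) else 0 :=
          Finset.sum_comm
      _ ≤ _ := by
          gcongr with i
          rw [Finset.sum_ite_mem, Finset.sum_const, nsmul_one]
          exact_mod_cast Finset.card_le_card Finset.inter_subset_right
  rw [Filt.avg]
  calc _ ≤ ((stdGrid n).size ν : ℝ≥0∞)⁻¹ *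
        ∑ i : Fin n, ENNReal.ofReal ‖t‖ * ((stdGrid n).size ν * (2 ^ ν)⁻¹) := by
        gcongr
        exact hsum.trans (Finset.sum_le_sum fun i _ => hcard i)
    _ = (((stdGrid n).size ν : ℝ≥0∞)⁻¹ * (stdGrid n).size ν) *
          (n * ENNReal.ofReal ‖t‖ * (2 ^ ν)⁻¹) := by
        rw [Finset.sum_const, Finset.card_univ, Fintype.card_fin, nsmul_eq_mul]
        ring
    _ = _ := by
        rw [ENNReal.inv_mul_cancel ((stdGrid n).size_ne_zero ν) (by simp), one_mul,
          ENNReal.ofReal_div_of_pos (by positivity), ENNReal.ofReal_mul (by positivity),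
          ENNReal.ofReal_natCast, ENNReal.ofReal_pow (by norm_num), div_eq_mul_inv]
        simp

/-- The weighted measure of the translations `2 ^ κ • m` which move a point to a different block
of level `κ + j`. -/
def theta (γ : ℝ) (κ j : ℕ) (x : Fin n → ℤ) : ℝ≥0∞ :=
  ∑' m, wt n γ m * jump (κ + j) ((2:ℤ) ^ κ • m) x

lemma theta_eq_neg (γ : ℝ) (κ j : ℕ) (x : Fin n → ℤ) :
    ∑' m, wt n γ m * jump (κ + j) (-((2:ℤ) ^ κ • m)) x = theta γ κ j x := by
  rw [theta, ← (Equiv.neg (Fin n → ℤ)).tsum_eq]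
  refine tsum_congr fun m => ?_
  simp [wt_neg]

lemma theta_le (γ : ℝ) (κ j : ℕ) (x : Fin n → ℤ) : theta γ κ j x ≤ ∑' m, wt n γ m :=
  ENNReal.tsum_le_tsum fun _ => mul_le_of_le_one_right' (jump_le_one _ _ _)

lemma wt_mul_min_le {γ : ℝ} (hγ : 0 < γ) (hγ1 : γ ≤ 1) (j : ℕ) (m : Fin n → ℤ) (a : ℝ≥0∞)
    (h1 : a ≤ 1) (h2 : a ≤ ENNReal.ofReal (n * ‖m‖ / 2 ^ j)) :
    wt n γ m * a ≤ ENNReal.ofReal (n ^ (γ / 2)) * 2 ^ (-(γ / 2 * j)) * wt n (γ / 2) m := by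
  have ht : a ≤ ENNReal.ofReal ((n * ‖m‖ / 2 ^ j) ^ (γ / 2)) := by
    rcases le_or_gt 1 (n * ‖m‖ / 2 ^ j) with h | h
    · refine h1.trans ?_
      rw [← ENNReal.ofReal_one]
      exact ENNReal.ofReal_le_ofReal (Real.one_le_rpow h (by linarith))
    · refine h2.trans (ENNReal.ofReal_le_ofReal ?_)
      conv_lhs => rw [← Real.rpow_one (n * ‖m‖ / 2 ^ j)]
      exact Real.rpow_le_rpow_of_exponent_ge_of_imp (by positivity) h.le (by linarith)
        (fun _ h => by linarith)
  refine (mul_le_mul_right ht _).trans ?_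
  rw [wt, wt, ← ofReal_two_rpow, ← ENNReal.ofReal_mul (by positivity),
    ← ENNReal.ofReal_mul (by positivity), ← ENNReal.ofReal_mul (by positivity)]
  refine ENNReal.ofReal_le_ofReal ?_
  rw [Real.div_rpow (by positivity) (by positivity), Real.mul_rpow (by positivity) (by positivity),
    ← Real.rpow_natCast 2 j, ← Real.rpow_mul (by norm_num), div_eq_mul_inv,
    ← Real.rpow_neg (by norm_num), show -((j:ℝ) * (γ / 2)) = -(γ / 2 * j) by ring,
    show -((n:ℝ) + γ / 2) = -(n + γ) + γ / 2 by ring,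
    Real.rpow_add (by have := norm_nonneg m; linarith)]
  have : ‖m‖ ^ (γ / 2) ≤ (1 + ‖m‖) ^ (γ / 2) := by gcongr; linarith
  calc _ = ((1 + ‖m‖) ^ (-(n + γ)) * (n ^ (γ / 2) * 2 ^ (-(γ / 2 * j)))) * ‖m‖ ^ (γ / 2) := by ring
    _ ≤ ((1 + ‖m‖) ^ (-(n + γ)) * (n ^ (γ / 2) * 2 ^ (-(γ / 2 * j)))) * (1 + ‖m‖) ^ (γ / 2) := by
        gcongr
    _ = _ := by ring

lemma avg_theta_le {γ : ℝ} (hγ : 0 < γ) (hγ1 : γ ≤ 1) : ∃ C : NNReal,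
    ∀ (κ j : ℕ) (x : Fin n → ℤ),
      (stdGrid n).avg (κ + j) (theta γ κ j) x ≤ C * 2 ^ (-(γ / 2 * j)) := by
  set D : ℝ≥0∞ := ENNReal.ofReal (n ^ (γ / 2)) * ∑' m : Fin n → ℤ, wt n (γ / 2) m with hD
  have hDt : D ≠ ⊤ := ENNReal.mul_ne_top ENNReal.ofReal_ne_top (tsum_wt_ne_top (by linarith))
  refine ⟨D.toNNReal, fun κ j x => ?_⟩
  rw [ENNReal.coe_toNNReal hDt]
  have h0 : (stdGrid n).avg (κ + j) (theta γ κ j) x = ∑' m, wt n γ m *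
      (stdGrid n).avg (κ + j) (jump (κ + j) ((2:ℤ) ^ κ • m)) x := by
    rw [← show _ = _ from tsum_congr fun m => (stdGrid n).avg_const_mul (κ + j) (wt n γ m)
      (jump (κ + j) ((2:ℤ) ^ κ • m)) x, ← Filt.avg_tsum]
    rfl
  calc _ = _ := h0
    _ ≤ ∑' m, ENNReal.ofReal (n ^ (γ / 2)) * 2 ^ (-(γ / 2 * j)) * wt n (γ / 2) m := by
        refine ENNReal.tsum_le_tsum fun m => wt_mul_min_le hγ hγ1 j m _ ?_ ?_
        · refine ((stdGrid n).avg_mono (jump_le_one _ _) x).trans_eq ?_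
          exact (stdGrid n).avg_const (fun _ _ _ => rfl) x
        · refine (avg_jump_le _ _ _).trans (ENNReal.ofReal_le_ofReal ?_)
          have : ‖(2:ℤ) ^ κ • m‖ = 2 ^ κ * ‖m‖ := by
            rw [norm_smul]
            simp [Int.norm_eq_abs]
          rw [this, pow_add]
          refine le_of_eq ?_
          field_simp
    _ = _ := by rw [ENNReal.tsum_mul_left, hD]; ring

end Jump

/-- The weighted Cauchy–Schwarz inequality. -/
lemma tsum_mul_sq_le {ι : Type*} (a b : ι → ℝ≥0∞) :
    (∑' m, a m * b m) ^ 2 ≤ (∑' m, a m) * ∑' m, a m * b m ^ 2 := by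
  have h2 : (2:ℝ).HolderConjugate 2 := by
    rw [Real.holderConjugate_iff]; norm_num
  have e : ∀ m, a m = a m ^ (1/2 : ℝ) * a m ^ (1/2 : ℝ) := fun m => by
    rw [← ENNReal.rpow_add_of_nonneg _ _ (by norm_num) (by norm_num)]
    norm_num
  have h := tsum_mul_le_seqNorm h2 (fun m => a m ^ (1/2 : ℝ)) (fun m => a m ^ (1/2 : ℝ) * b m)
  simp_rw [← mul_assoc, ← e] at h
  refine (pow_le_pow_left' h 2).trans_eq ?_
  rw [mul_pow, ← ENNReal.rpow_two, ← ENNReal.rpow_two, seqNorm_rpow (by norm_num),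
    seqNorm_rpow (by norm_num)]
  simp_rw [ENNReal.mul_rpow_of_nonneg _ _ zero_le_two, ← ENNReal.rpow_mul]
  norm_num

/-- Cauchy–Schwarz with geometric weights. -/
lemma tsum_sq_le_geometric (η : ℝ) (a : ℕ → ℝ≥0∞) :
    (∑' j, a j) ^ 2 ≤ (∑' j : ℕ, (2:ℝ≥0∞) ^ (-(η * j))) * ∑' j : ℕ, 2 ^ (η * j) * a j ^ 2 := by
  have e : ∀ j : ℕ, (2:ℝ≥0∞) ^ (-(η * j)) * 2 ^ (η * j) = 1 := fun j => by
    rw [← two_rpow_add, neg_add_cancel, ENNReal.rpow_zero]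
  have h := tsum_mul_sq_le (fun j : ℕ => (2:ℝ≥0∞) ^ (-(η * j))) (fun j => 2 ^ (η * j) * a j)
  simp_rw [← mul_assoc, e, one_mul] at h
  refine h.trans_eq ?_
  congr 1
  refine tsum_congr fun j => ?_
  rw [mul_pow, sq ((2:ℝ≥0∞) ^ (η * (j:ℝ))), ← mul_assoc, ← mul_assoc, e, one_mul]

section TransDiff

variable {n : ℕ}

/-- The weighted sum of the differences of `h` along the translations by multiples of `2 ^ κ`. -/
def transDiff (γ : ℝ) (κ : ℕ) (h : (Fin n → ℤ) → ℝ) (x : Fin n → ℤ) : ℝ≥0∞ :=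
  ∑' m, wt n γ m * ‖h (x + (2:ℤ) ^ κ • m) - h x‖ₑ

lemma transDiff_sq_le {γ : ℝ} (hγ : 0 < γ) : ∃ C : NNReal,
    ∀ (κ j : ℕ) (d : (Fin n → ℤ) → ℝ), (stdGrid n).IsConst (κ + j) d → ∀ x,
      transDiff γ κ d x ^ 2 ≤
        C * (theta γ κ j x * poisson γ (κ + j) (fun y => ‖d y‖ₑ ^ 2) x) := by
  obtain ⟨C, hC⟩ := tsum_wt_avg_le_poisson (n := n) hγ
  set W : ℝ≥0∞ := ∑' m : Fin n → ℤ, wt n γ m with hW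
  have hWt : W ≠ ⊤ := tsum_wt_ne_top hγ
  have hDt : 2 * C + 2 * W ≠ ⊤ := by finiteness
  refine ⟨(2 * C + 2 * W).toNNReal, fun κ j d hd x => ?_⟩
  rw [ENNReal.coe_toNNReal hDt]
  set u : (Fin n → ℤ) → ℝ≥0∞ := fun y => ‖d y‖ₑ ^ 2 with hu
  have huc : (stdGrid n).IsConst (κ + j) u := hd.comp (fun t => ‖t‖ₑ ^ 2)
  have hP : u x ≤ poisson γ (κ + j) u x := by
    rw [← (stdGrid n).avg_const huc]
    exact avg_le_poisson γ _ _ _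
  have h1 : transDiff γ κ d x =
      ∑' m, (wt n γ m * jump (κ + j) ((2:ℤ) ^ κ • m) x) * ‖d (x + (2:ℤ) ^ κ • m) - d x‖ₑ := by
    refine tsum_congr fun m => ?_
    rw [jump]
    split_ifs with h
    · rw [hd _ _ (mem_stdGrid_blk.2 h)]
      simp
    · rw [mul_one]
  rw [h1]
  refine (tsum_mul_sq_le _ _).trans ?_
  calc _ ≤ theta γ κ j x * ∑' m, (2 * (wt n γ m * (stdGrid n).avg (κ + j) u (x + (2:ℤ) ^ κ • m)) +
        2 * (wt n γ m * u x)) := by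
        rw [theta]
        gcongr with m
        rw [(stdGrid n).avg_const huc]
        calc _ ≤ wt n γ m * (2 * u (x + (2:ℤ) ^ κ • m) + 2 * u x) := by
              gcongr
              · exact mul_le_of_le_one_right' (jump_le_one _ _ _)
              · exact enorm_sub_sq_le _ _
          _ = _ := by ring
    _ ≤ theta γ κ j x * (2 * (C * poisson γ (κ + j) u x) + 2 * (W * poisson γ (κ + j) u x)) := by
        rw [ENNReal.tsum_add, ENNReal.tsum_mul_left, ENNReal.tsum_mul_left, ENNReal.tsum_mul_right]
        gcongr
        exact hC κ j u x
    _ = _ := by ring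

lemma enorm_ravg_sub_le (hn : 0 < n) {g : (Fin n → ℤ) → ℝ} (hg : g.support.Finite) (κ : ℕ)
    (x y : Fin n → ℤ) :
    ‖(stdGrid n).ravg κ g y - (stdGrid n).ravg κ g x‖ₑ ≤
      ∑' j, ‖(stdGrid n).dif (κ + j) g y - (stdGrid n).dif (κ + j) g x‖ₑ := by
  set F := stdGrid n
  have hA := Filt.tsum_enorm_ne_top hg
  set A := ∑' x, ‖g x‖ₑ with hAd
  have hsmall : ∀ L z, ‖F.ravg L g z‖ₑ ≤ (F.size L : ℝ≥0∞)⁻¹ * A := fun L z =>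
    (F.enorm_ravg_le L g z).trans (mul_le_mul_right (ENNReal.sum_le_tsum _) _)
  have htel : ∀ L z, F.ravg κ g z =
      ∑ j ∈ Finset.range L, F.dif (κ + j) g z + F.ravg (κ + L) g z := by
    intro L z
    induction L with
    | zero => simp
    | succ L ih => rw [ih, Finset.sum_range_succ, Filt.dif]; simp only [← add_assoc]; ring
  have hlim : Filter.Tendsto (fun L => ∑' j, ‖F.dif (κ + j) g y - F.dif (κ + j) g x‖ₑ +
      ((F.size (κ + L) : ℝ≥0∞)⁻¹ * A + (F.size (κ + L) : ℝ≥0∞)⁻¹ * A)) Filter.atTop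
      (nhds (∑' j, ‖F.dif (κ + j) g y - F.dif (κ + j) g x‖ₑ + (0 * A + 0 * A))) := by
    have h0 := (F.tendsto_size_inv (tendsto_stdGrid_size hn)).comp
      (Filter.tendsto_add_atTop_nat κ)
    simp only [Function.comp_def, add_comm _ κ] at h0
    have h1 := ENNReal.Tendsto.mul_const h0 (Or.inr hA)
    exact tendsto_const_nhds.add (h1.add h1)
  refine (ge_of_tendsto' hlim fun L => ?_).trans_eq (by simp)
  rw [htel L y, htel L x, add_sub_add_comm, ← Finset.sum_sub_distrib]
  refine (enorm_add_le _ _).trans ?_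
  gcongr
  · exact (enorm_sum_le _ _).trans (ENNReal.sum_le_tsum _)
  · rw [sub_eq_add_neg]
    refine (enorm_add_le _ _).trans ?_
    rw [enorm_neg]
    gcongr <;> exact hsmall _ _

lemma transDiff_ravg_sq_le (hn : 0 < n) (γ η : ℝ) {g : (Fin n → ℤ) → ℝ} (hg : g.support.Finite)
    (κ : ℕ) (x : Fin n → ℤ) :
    transDiff γ κ ((stdGrid n).ravg κ g) x ^ 2 ≤ (∑' j : ℕ, (2:ℝ≥0∞) ^ (-(η * j))) *
      ∑' j : ℕ, 2 ^ (η * j) * transDiff γ κ ((stdGrid n).dif (κ + j) g) x ^ 2 := by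
  refine le_trans (pow_le_pow_left' ?_ 2) (tsum_sq_le_geometric η _)
  simp only [transDiff]
  rw [ENNReal.tsum_comm]
  simp_rw [ENNReal.tsum_mul_left]
  gcongr with m
  exact enorm_ravg_sub_le hn hg _ _ _

lemma exists_seqNorm_square_le {r : ℝ} (hr : 1 ≤ r) : ∃ C : NNReal, ∀ f : (Fin n → ℤ) → ℝ,
    seqNorm r (fun x => ∑' i, ‖(stdGrid n).dif i f x‖ₑ ^ 2) ≤
      C * seqNorm r (fun x => ‖f x‖ₑ ^ 2) := by
  rcases hr.eq_or_lt with rfl | hr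
  · exact ⟨1, fun f => by simpa using (stdGrid n).seqNorm_one_square_le stdGrid_size_zero f⟩
  · refine ⟨(ENNReal.ofReal r * (3 + 2 * ENNReal.ofReal r.conjExponent)).toNNReal, fun f => ?_⟩
    rw [ENNReal.coe_toNNReal (by finiteness)]
    exact (stdGrid n).seqNorm_square_le hr stdGrid_size_zero f

/-- Square function estimate for the differences of conditional expectations. -/
theorem seqNorm_transDiff_le (hn : 0 < n) {γ r : ℝ} (hγ : 0 < γ) (hγ1 : γ ≤ 1) (hr : 1 ≤ r) :
    ∃ C : NNReal, ∀ g : (Fin n → ℤ) → ℝ, g.support.Finite →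
      seqNorm r (fun x => ∑' κ, transDiff γ κ ((stdGrid n).ravg κ g) x ^ 2) ≤
        C * seqNorm r (fun x => ‖g x‖ₑ ^ 2) := by
  have hr0 : 0 < r := by linarith
  obtain ⟨C₁, hC₁⟩ := transDiff_sq_le (n := n) hγ
  obtain ⟨C₂, hC₂⟩ := avg_theta_le (n := n) hγ hγ1
  obtain ⟨C₃, hC₃⟩ := seqNorm_tsum_poisson_le (n := n) hγ hr
  obtain ⟨C₄, hC₄⟩ := exists_seqNorm_square_le (n := n) hr
  set W : ℝ≥0∞ := ∑' m : Fin n → ℤ, wt n γ m with hW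
  have hWt : W ≠ ⊤ := tsum_wt_ne_top hγ
  have hW0 : W ≠ 0 := by
    refine (lt_of_lt_of_le one_pos ?_).ne'
    rw [← wt_zero (n := n) γ]
    exact ENNReal.le_tsum 0
  set η : ℝ := γ / (4 * r) with hη
  have hη0 : 0 < η := by positivity
  set A : ℝ≥0∞ := ∑' j : ℕ, (2:ℝ≥0∞) ^ (-(η * j)) with hA
  have hAt : A ≠ ⊤ := tsum_two_rpow_ne_top hη0
  set D : ℝ≥0∞ := A * (C₁ * (W * ((ENNReal.ofReal r * (W⁻¹ * C₂)) ^ (1 / r) * (C₃ * C₄)))) * A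
    with hD
  have hDt : D ≠ ⊤ := by
    have : W⁻¹ ≠ ⊤ := by simpa using hW0
    have h2 : (ENNReal.ofReal r * (W⁻¹ * C₂)) ^ (1 / r) ≠ ⊤ :=
      ENNReal.rpow_ne_top_of_nonneg (by positivity) (by finiteness)
    finiteness
  refine ⟨D.toNNReal, fun g hg => ?_⟩
  rw [ENNReal.coe_toNNReal hDt]
  set N := seqNorm r (fun x => ‖g x‖ₑ ^ 2)
  set P : ℕ → (Fin n → ℤ) → ℝ≥0∞ := fun i => poisson γ i (fun y => ‖(stdGrid n).dif i g y‖ₑ ^ 2)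
    with hPdef
  have hPN : seqNorm r (fun x => ∑' i, P i x) ≤ C₃ * C₄ * N := by
    refine (hC₃ _).trans ?_
    rw [mul_assoc]
    gcongr
    exact hC₄ g
  have hlayer : ∀ j : ℕ, seqNorm r (fun x => ∑' κ, theta γ κ j x * P (κ + j) x) ≤
      W * ((ENNReal.ofReal r * (W⁻¹ * C₂)) ^ (1 / r) * 2 ^ (-(2 * η * j)) * (C₃ * C₄ * N)) := by
    intro j
    have h1 := ((stdGrid n).shift j).tsum_layer_rpow_le hr (κ := W⁻¹ * (C₂ * 2 ^ (-(γ / 2 * j))))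
      (fun κ x => W⁻¹ * theta γ κ j x) (fun κ => P (κ + j))
      (fun κ x => (mul_le_mul_right (theta_le γ κ j x) _).trans_eq (ENNReal.inv_mul_cancel hW0 hWt))
      (fun κ x => by
        rw [Filt.shift_avg, Filt.avg_const_mul]
        gcongr
        exact hC₂ κ j x)
      (fun κ => isConst_poisson γ _ _)
    have h2 : seqNorm r (fun x => ∑' κ, W⁻¹ * theta γ κ j x * P (κ + j) x) ≤
        (ENNReal.ofReal r * (W⁻¹ * (C₂ * 2 ^ (-(γ / 2 * j))))) ^ (1 / r) *
          seqNorm r (fun x => ∑' κ, P (κ + j) x) := by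
      rw [seqNorm_le_iff hr0, ENNReal.mul_rpow_of_nonneg _ _ hr0.le, ← ENNReal.rpow_mul,
        one_div_mul_cancel hr0.ne', ENNReal.rpow_one, seqNorm_rpow hr0]
      exact h1
    have h3 : ∀ x, ∑' κ, theta γ κ j x * P (κ + j) x =
        W * ∑' κ, W⁻¹ * theta γ κ j x * P (κ + j) x := fun x => by
      rw [← ENNReal.tsum_mul_left]
      refine tsum_congr fun κ => ?_
      rw [← mul_assoc, ← mul_assoc, ENNReal.mul_inv_cancel hW0 hWt, one_mul]
    simp_rw [h3]
    rw [seqNorm_const_mul hr0]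
    gcongr
    refine h2.trans ?_
    have h4 : (ENNReal.ofReal r * (W⁻¹ * (C₂ * 2 ^ (-(γ / 2 * j))))) ^ (1 / r) =
        (ENNReal.ofReal r * (W⁻¹ * C₂)) ^ (1 / r) * 2 ^ (-(2 * η * j)) := by
      rw [← mul_assoc, ← mul_assoc, ENNReal.mul_rpow_of_nonneg _ _ (by positivity),
        ← ENNReal.rpow_mul, mul_assoc (ENNReal.ofReal r)]
      congr 2
      rw [hη]
      field_simp
      ring
    rw [h4]
    gcongr
    refine (seqNorm_mono hr0 fun x => ?_).trans hPN
    exact ENNReal.tsum_comp_le_tsum_of_injective (add_left_injective j) (fun i => P i x)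
  calc seqNorm r (fun x => ∑' κ, transDiff γ κ ((stdGrid n).ravg κ g) x ^ 2)
      ≤ seqNorm r (fun x =>
          A * ∑' j : ℕ, 2 ^ (η * j) * (C₁ * ∑' κ, theta γ κ j x * P (κ + j) x)) := by
        refine seqNorm_mono hr0 fun x => ?_
        calc _ ≤ ∑' κ, A * ∑' j : ℕ, 2 ^ (η * j) * (C₁ * (theta γ κ j x * P (κ + j) x)) := by
              gcongr with κ
              refine (transDiff_ravg_sq_le hn γ η hg κ x).trans ?_
              gcongr with j
              exact hC₁ κ j _ ((stdGrid n).isConst_dif _ _) x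
          _ = _ := by
              rw [ENNReal.tsum_mul_left, ENNReal.tsum_comm]
              simp_rw [ENNReal.tsum_mul_left]
    _ ≤ A * ∑' j : ℕ, 2 ^ (η * j) * (C₁ * (W * ((ENNReal.ofReal r * (W⁻¹ * C₂)) ^ (1 / r) *
          2 ^ (-(2 * η * j)) * (C₃ * C₄ * N)))) := by
        rw [seqNorm_const_mul hr0]
        gcongr
        refine (seqNorm_tsum_le hr _).trans ?_
        gcongr with j
        rw [seqNorm_const_mul hr0, seqNorm_const_mul hr0]
        gcongr
        exact hlayer j
    _ = A * ∑' j : ℕ, 2 ^ (-(η * j)) * (C₁ * (W * ((ENNReal.ofReal r * (W⁻¹ * C₂)) ^ (1 / r) *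
          (C₃ * C₄ * N)))) := by
        congr 1
        refine tsum_congr fun j => ?_
        rw [show -(η * j) = η * j + -(2 * η * j) by ring, two_rpow_add]
        ring
    _ = _ := by
        rw [ENNReal.tsum_mul_right, hD]
        ring

end TransDiff

lemma Filt.ravg_sum {X ι : Type*} (F : Filt X) (ν : ℕ) (s : Finset ι) (f : ι → X → ℝ) (x : X) :
    F.ravg ν (fun y => ∑ i ∈ s, f i y) x = ∑ i ∈ s, F.ravg ν (f i) x := by
  simp only [Filt.ravg]
  rw [Finset.sum_comm, Finset.mul_sum]

lemma Filt.dif_sum {X ι : Type*} (F : Filt X) (ν : ℕ) (s : Finset ι) (f : ι → X → ℝ) (x : X) :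
    F.dif ν (fun y => ∑ i ∈ s, f i y) x = ∑ i ∈ s, F.dif ν (f i) x := by
  simp only [Filt.dif, Filt.ravg_sum, Finset.sum_sub_distrib]

lemma Filt.dif_eq_zero {X : Type*} (F : Filt X) {i κ : ℕ} (h : i + 1 ≤ κ) {f : X → ℝ}
    (hf : F.IsConst κ f) (x : X) : F.dif i f x = 0 := by
  rw [Filt.dif, F.ravg_const (hf.mono (by omega)), F.ravg_const (hf.mono h), sub_self]

lemma seqNorm_add_le' {X : Type*} {r : ℝ} (hr : 1 ≤ r) {u v w : X → ℝ≥0∞} {a b : ℝ≥0∞}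
    (h : ∀ x, w x ≤ u x + v x) (hu : seqNorm r u ≤ a) (hv : seqNorm r v ≤ b) :
    seqNorm r w ≤ a + b :=
  (seqNorm_mono (by linarith) h).trans ((seqNorm_add_le hr u v).trans (add_le_add hu hv))

section TransSum

variable {n : ℕ}

/-- The sum of the differences of the functions `c m` and their translates by `2 ^ κ • m`. -/
def transSum (κ : ℕ) (M : Finset (Fin n → ℤ)) (c : (Fin n → ℤ) → (Fin n → ℤ) → ℝ)
    (x : Fin n → ℤ) : ℝ :=
  ∑ m ∈ M, (c m (x - (2:ℤ) ^ κ • m) - c m x)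

lemma isConst_transSum {κ : ℕ} (M : Finset (Fin n → ℤ)) {c : (Fin n → ℤ) → (Fin n → ℤ) → ℝ}
    (hc : ∀ m, (stdGrid n).IsConst κ (c m)) : (stdGrid n).IsConst κ (transSum κ M c) := by
  intro x y hy
  refine Finset.sum_congr rfl fun m _ => ?_
  rw [hc m x y hy, hc m (x - (2:ℤ) ^ κ • m) (y - (2:ℤ) ^ κ • m)]
  rw [mem_stdGrid_blk] at hy ⊢
  rw [sub_eq_add_neg, sub_eq_add_neg, ← smul_neg, cell_add_smul, cell_add_smul, hy]

/-- The indicator that exactly one of `y`, `y + t` lies in the block `w`. -/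
def crossing (ν : ℕ) (w t y : Fin n → ℤ) : ℝ≥0∞ :=
  (if cell ν y = w then jump ν t y else 0) + if cell ν (y + t) = w then jump ν (-t) (y + t) else 0

lemma enorm_sum_blk_sub_le (ν : ℕ) (c : (Fin n → ℤ) → ℝ) (t x : Fin n → ℤ) :
    ‖∑ z ∈ (stdGrid n).blk ν x, (c (z - t) - c z)‖ₑ ≤
      ∑' y, crossing ν (cell ν x) t y * ‖c y‖ₑ := by
  classical
  set Q := (stdGrid n).blk ν x with hQ
  have h1 : ∑ z ∈ Q, c (z - t) = ∑ y ∈ Q.map (Equiv.subRight t).toEmbedding, c y := by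
    rw [Finset.sum_map]; rfl
  set Q' := Q.map (Equiv.subRight t).toEmbedding with hQ'
  have hm : ∀ y, y ∈ Q' ↔ cell ν (y + t) = cell ν x := fun y => by
    rw [hQ', Finset.mem_map_equiv, hQ, mem_stdGrid_blk]
    rfl
  rw [Finset.sum_sub_distrib, h1, ← Finset.sum_sdiff_sub_sum_sdiff, sub_eq_add_neg]
  refine (enorm_add_le _ _).trans ?_
  rw [enorm_neg]
  have h2 : ∀ (a : (Fin n → ℤ) → ℝ≥0∞) (S : Finset (Fin n → ℤ)), (∀ y ∈ S, 1 ≤ a y) →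
      ‖∑ y ∈ S, c y‖ₑ ≤ ∑' y, a y * ‖c y‖ₑ := fun a S hS =>
    ((enorm_sum_le _ _).trans (Finset.sum_le_sum fun y hy =>
      le_mul_of_one_le_left' (hS y hy))).trans (ENNReal.sum_le_tsum S)
  simp only [crossing, add_mul]
  rw [ENNReal.tsum_add, add_comm]
  gcongr
  · refine h2 _ _ fun y hy => ?_
    rw [Finset.mem_sdiff, hm, hQ, mem_stdGrid_blk] at hy
    rw [if_pos hy.1, jump, if_neg (by rw [hy.1]; exact hy.2)]
  · refine h2 _ _ fun y hy => ?_
    rw [Finset.mem_sdiff, hm, hQ, mem_stdGrid_blk] at hy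
    rw [if_pos hy.1, jump, add_neg_cancel_right, if_neg (by rw [hy.1]; exact hy.2)]

lemma tsum_crossing (ν : ℕ) (t x : Fin n → ℤ) :
    2 ^ (-(ν * n : ℝ)) * ∑' y, crossing ν (cell ν x) t y =
      (stdGrid n).avg ν (jump ν t) x + (stdGrid n).avg ν (jump ν (-t)) x := by
  rw [stdGrid_avg, stdGrid_avg, ← mul_add]
  congr 1
  simp only [crossing]
  rw [ENNReal.tsum_add]
  congr 1
  exact (Equiv.addRight t).tsum_eq fun y => if cell ν y = cell ν x then jump ν (-t) y else 0

lemma enorm_ravg_transSum_sq_le {γ : ℝ} (hγ : 0 < γ) (hγ1 : γ ≤ 1) : ∃ C : NNReal,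
    ∀ (κ j : ℕ) (M : Finset (Fin n → ℤ)) (c : (Fin n → ℤ) → (Fin n → ℤ) → ℝ)
      (B : (Fin n → ℤ) → ℝ≥0∞), (∀ m x, ‖c m x‖ₑ ≤ wt n γ m * B x) → ∀ x,
      ‖(stdGrid n).ravg (κ + j) (transSum κ M c) x‖ₑ ^ 2 ≤
        C * (2 ^ (-(γ / 2 * j)) * poisson γ (κ + j) (fun y => B y ^ 2) x) := by
  obtain ⟨C₁, hC₁⟩ := tsum_wt_cell_shift_le (n := n) hγ
  obtain ⟨C₂, hC₂⟩ := avg_theta_le (n := n) hγ hγ1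
  set W : ℝ≥0∞ := ∑' m : Fin n → ℤ, wt n γ m with hW
  have hWt : W ≠ ⊤ := tsum_wt_ne_top hγ
  have hDt : 2 * C₂ * (W + C₁) ≠ ⊤ := by finiteness
  refine ⟨(2 * C₂ * (W + C₁)).toNNReal, fun κ j M c B hB x => ?_⟩
  rw [ENNReal.coe_toNNReal hDt]
  set S : ℝ≥0∞ := 2 ^ (-((κ + j : ℕ) * n : ℝ)) with hS
  set Θ : (Fin n → ℤ) → ℝ≥0∞ := fun y =>
    ∑' m, wt n γ m * crossing (κ + j) (cell (κ + j) x) ((2:ℤ) ^ κ • m) y with hΘ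
  have h1 : ‖(stdGrid n).ravg (κ + j) (transSum κ M c) x‖ₑ ≤ S * ∑' y, Θ y * B y := by
    rw [Filt.ravg, enorm_mul, enorm_inv (by exact_mod_cast ((stdGrid n).size_pos _).ne'),
      hS, ENNReal.rpow_neg, ← grid_size (0 : Fin n → ℤ)]
    gcongr
    · simp
    · simp only [transSum]
      rw [Finset.sum_comm]
      calc _ ≤ ∑ m ∈ M, ‖∑ z ∈ (stdGrid n).blk (κ + j) x, (c m (z - (2:ℤ) ^ κ • m) - c m z)‖ₑ :=
            enorm_sum_le _ _
        _ ≤ ∑ m ∈ M, ∑' y, wt n γ m *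
              crossing (κ + j) (cell (κ + j) x) ((2:ℤ) ^ κ • m) y * B y := by
            refine Finset.sum_le_sum fun m _ => ?_
            refine (enorm_sum_blk_sub_le _ _ _ _).trans (ENNReal.tsum_le_tsum fun y => ?_)
            rw [mul_comm (wt n γ m), mul_assoc]
            exact mul_le_mul_right (hB m y) _
        _ ≤ _ := ENNReal.sum_le_tsum _
        _ = _ := by
            rw [ENNReal.tsum_comm]
            simp_rw [hΘ, ENNReal.tsum_mul_right]
  have h2 : S * ∑' y, Θ y ≤ 2 * C₂ * 2 ^ (-(γ / 2 * j)) := by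
    have hc : ∀ t : (Fin n → ℤ) → (Fin n → ℤ),
        ∑' m, wt n γ m * (stdGrid n).avg (κ + j) (jump (κ + j) (t m)) x =
        (stdGrid n).avg (κ + j) (fun x => ∑' m, wt n γ m * jump (κ + j) (t m) x) x := fun t => by
      rw [Filt.avg_tsum]
      exact tsum_congr fun m => ((stdGrid n).avg_const_mul _ _ _ _).symm
    calc S * ∑' y, Θ y = ∑' m, wt n γ m * (S *
          ∑' y, crossing (κ + j) (cell (κ + j) x) ((2:ℤ) ^ κ • m) y) := by
          rw [hΘ, ENNReal.tsum_comm, ← ENNReal.tsum_mul_left]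
          refine tsum_congr fun m => ?_
          rw [ENNReal.tsum_mul_left]
          ring
      _ = (stdGrid n).avg (κ + j) (theta γ κ j) x + (stdGrid n).avg (κ + j) (theta γ κ j) x := by
          simp_rw [hS, tsum_crossing, mul_add]
          rw [ENNReal.tsum_add, hc, hc]
          simp_rw [theta_eq_neg]
          rfl
      _ ≤ C₂ * 2 ^ (-(γ / 2 * j)) + C₂ * 2 ^ (-(γ / 2 * j)) := by
          gcongr <;> exact hC₂ κ j x
      _ = _ := by ring
  have h3 : ∀ y, Θ y ≤ (W + C₁) * wt n γ (cell (κ + j) x - cell (κ + j) y) := by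
    intro y
    calc Θ y ≤ ∑' m, (wt n γ m * wt n γ (cell (κ + j) x - cell (κ + j) y) +
          if cell (κ + j) (y + (2:ℤ) ^ κ • m) = cell (κ + j) x then wt n γ m else 0) := by
          refine ENNReal.tsum_le_tsum fun m => ?_
          rw [crossing, mul_add]
          gcongr
          · split_ifs with h
            · rw [h, sub_self, wt_zero]
              exact jump_le_one _ _ _
            · exact zero_le
          · split_ifs with h
            · exact mul_le_of_le_one_right' (jump_le_one _ _ _)
            · simp
      _ ≤ W * wt n γ (cell (κ + j) x - cell (κ + j) y) +
          C₁ * wt n γ (cell (κ + j) x - cell (κ + j) y) := by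
          rw [ENNReal.tsum_add, ENNReal.tsum_mul_right]
          gcongr
          exact hC₁ κ j y _
      _ = _ := by ring
  calc _ ≤ (S * ∑' y, Θ y * B y) ^ 2 := pow_le_pow_left' h1 2
    _ ≤ S ^ 2 * ((∑' y, Θ y) * ∑' y, Θ y * B y ^ 2) := by
        rw [mul_pow]
        gcongr
        exact tsum_mul_sq_le _ _
    _ = (S * ∑' y, Θ y) * (S * ∑' y, Θ y * B y ^ 2) := by ring
    _ ≤ (2 * C₂ * 2 ^ (-(γ / 2 * j))) * (S * ∑' y, (W + C₁) *
          wt n γ (cell (κ + j) x - cell (κ + j) y) * B y ^ 2) := by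
        gcongr with y
        exact h3 y
    _ = _ := by
        rw [poisson, hS]
        simp_rw [mul_assoc, ENNReal.tsum_mul_left]
        ring

lemma enorm_dif_transSum_sq_le {γ : ℝ} (hγ : 0 < γ) (hγ1 : γ ≤ 1) : ∃ C : NNReal,
    ∀ (κ j : ℕ) (M : Finset (Fin n → ℤ)) (c : (Fin n → ℤ) → (Fin n → ℤ) → ℝ)
      (B : (Fin n → ℤ) → ℝ≥0∞), (∀ m x, ‖c m x‖ₑ ≤ wt n γ m * B x) → ∀ x,
      ‖(stdGrid n).dif (κ + j) (transSum κ M c) x‖ₑ ^ 2 ≤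
        C * (2 ^ (-(γ / 2 * j)) * (poisson γ (κ + j) (fun y => B y ^ 2) x +
          poisson γ (κ + j + 1) (fun y => B y ^ 2) x)) := by
  obtain ⟨C, hC⟩ := enorm_ravg_transSum_sq_le (n := n) hγ hγ1
  refine ⟨2 * C, fun κ j M c B hB x => ?_⟩
  rw [Filt.dif]
  refine (enorm_sub_sq_le _ _).trans ?_
  calc _ ≤ 2 * (C * (2 ^ (-(γ / 2 * j)) * poisson γ (κ + j) (fun y => B y ^ 2) x)) +
        2 * (C * (2 ^ (-(γ / 2 * j)) * poisson γ (κ + j + 1) (fun y => B y ^ 2) x)) := by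
        gcongr
        · exact hC κ j M c B hB x
        · refine (hC κ (j + 1) M c B hB x).trans ?_
          gcongr
          · norm_num
          · simp
          · exact le_rfl
    _ = _ := by push_cast; ring

lemma tsum_shift_ite (j : ℕ) (b : ℕ → ℝ≥0∞) :
    ∑' i, (if j ≤ i then b (i - j) else 0) = ∑' κ, b κ := by
  have h := Summable.sum_add_tsum_nat_add' (f := fun i => if j ≤ i then b (i - j) else 0) (k := j)
    ENNReal.summable
  rw [← h, Finset.sum_eq_zero fun i hi => if_neg (by simpa using hi), zero_add]
  exact tsum_congr fun i => by rw [if_pos (Nat.le_add_left _ _), Nat.add_sub_cancel]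

/-- Norm estimate for sums of differences of translates. -/
theorem seqNorm_transSum_le (hn : 0 < n) {γ r : ℝ} (hγ : 0 < γ) (hγ1 : γ ≤ 1) (hr : 1 ≤ r) :
    ∃ C : NNReal, ∀ (L : ℕ) (M : Finset (Fin n → ℤ))
      (c : ℕ → (Fin n → ℤ) → (Fin n → ℤ) → ℝ) (B : ℕ → (Fin n → ℤ) → ℝ≥0∞),
      (∀ κ m, (stdGrid n).IsConst κ (c κ m)) → (∀ κ m, (c κ m).support.Finite) →
      (∀ κ m x, ‖c κ m x‖ₑ ≤ wt n γ m * B κ x) →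
      seqNorm r (fun x => ‖∑ κ ∈ Finset.range L, transSum κ M (c κ) x‖ₑ ^ 2) ≤
        C * seqNorm r (fun x => ∑' κ, B κ x ^ 2) := by
  have hr0 : 0 < r := by linarith
  obtain ⟨C₁, hC₁⟩ := enorm_dif_transSum_sq_le (n := n) hγ hγ1
  obtain ⟨C₂, hC₂⟩ := seqNorm_tsum_poisson_le (n := n) hγ hr
  set C₃ := (ENNReal.ofReal (5 * r ^ 2) *
    (ENNReal.ofReal (2 * r).conjExponent ^ 2) ^ (r - 1)) with hC₃
  have hC₃t : C₃ ≠ ⊤ := ENNReal.mul_ne_top (by finiteness)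
    (ENNReal.rpow_ne_top_of_nonneg (by linarith) (by finiteness))
  set η : ℝ := γ / 4 with hη
  have hη0 : 0 < η := by positivity
  set A : ℝ≥0∞ := ∑' j : ℕ, (2:ℝ≥0∞) ^ (-(η * j)) with hA
  have hAt : A ≠ ⊤ := tsum_two_rpow_ne_top hη0
  set D : ℝ≥0∞ := C₃ * (A * (A * (C₁ * (C₂ + C₂)))) with hD
  have hDt : D ≠ ⊤ := by finiteness
  refine ⟨D.toNNReal, fun L M c B hc hcf hB => ?_⟩
  rw [ENNReal.coe_toNNReal hDt]
  set N := seqNorm r (fun x => ∑' κ, B κ x ^ 2) with hN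
  set u : ℕ → ℕ → (Fin n → ℤ) → ℝ≥0∞ := fun j i x => if j ≤ i then B (i - j) x ^ 2 else 0 with hu
  set v : ℕ → ℕ → (Fin n → ℤ) → ℝ≥0∞ := fun j i x => if j + 1 ≤ i then B (i - (j + 1)) x ^ 2 else 0
    with hv
  have hushift : ∀ j x, ∑' i, u j i x = ∑' κ, B κ x ^ 2 := fun j x => by
    exact tsum_shift_ite j fun κ => B κ x ^ 2
  set a : ℕ → ℕ → (Fin n → ℤ) → ℝ≥0∞ := fun j i x =>
    if j ≤ i then ‖(stdGrid n).dif i (transSum (i - j) M (c (i - j))) x‖ₑ else 0 with ha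
  have ha2 : ∀ j i x, a j i x ^ 2 ≤ C₁ * (2 ^ (-(γ / 2 * j)) *
      (poisson γ i (u j i) x + poisson γ (i + 1) (v j (i + 1)) x)) := by
    intro j i x
    simp only [ha, hu, hv]
    split_ifs with h h' h'
    · obtain ⟨κ, rfl⟩ : ∃ κ, i = κ + j := ⟨i - j, by omega⟩
      simpa using hC₁ κ j M (c κ) (B κ) (hB κ) x
    · omega
    · simp
    · simp
  have hdif : ∀ i x, ‖(stdGrid n).dif i (fun x => ∑ κ ∈ Finset.range L,
      transSum κ M (c κ) x) x‖ₑ ≤ ∑' j, a j i x := by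
    intro i x
    rw [Filt.dif_sum]
    refine (enorm_sum_le _ _).trans ?_
    calc _ ≤ ∑ κ ∈ Finset.range (i + 1), ‖(stdGrid n).dif i (transSum κ M (c κ)) x‖ₑ := by
          refine Finset.sum_le_sum_of_ne_zero fun κ _ hκ => ?_
          rw [Finset.mem_range]
          by_contra hlt
          exact hκ (by rw [(stdGrid n).dif_eq_zero (by omega) (isConst_transSum M (hc κ)),
            enorm_zero])
      _ = ∑ j ∈ Finset.range (i + 1), a j i x := by
          rw [← Finset.sum_range_reflect]
          refine Finset.sum_congr rfl fun j hj => ?_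
          rw [Finset.mem_range] at hj
          simp only [ha]
          rw [if_pos (by omega)]
          simp
      _ ≤ _ := ENNReal.sum_le_tsum _
  have hfin : (fun x => ∑ κ ∈ Finset.range L, transSum κ M (c κ) x).support.Finite := by
    have h1 : ∀ κ m, (fun x => c κ m (x - (2:ℤ) ^ κ • m) - c κ m x).support.Finite := fun κ m => by
      refine ((((hcf κ m).image (· + (2:ℤ) ^ κ • m))).union (hcf κ m)).subset fun x hx => ?_
      by_contra hn
      simp only [Set.mem_union, not_or, Function.mem_support, not_not] at hn
      refine hx ?_
      have : c κ m (x - (2:ℤ) ^ κ • m) = 0 := by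
        by_contra h0
        exact hn.1 ⟨_, h0, by simp⟩
      simp only [this, hn.2, sub_zero]
    refine ((Finset.range L).finite_toSet.biUnion fun κ _ => M.finite_toSet.biUnion
      fun m _ => h1 κ m).subset fun x hx => ?_
    obtain ⟨κ, hκ, h⟩ := Finset.exists_ne_zero_of_sum_ne_zero hx
    obtain ⟨m, hm, h'⟩ := Finset.exists_ne_zero_of_sum_ne_zero h
    exact Set.mem_biUnion hκ (Set.mem_biUnion hm h')
  have hj : ∀ j : ℕ, seqNorm r (fun x => ∑' i, a j i x ^ 2) ≤
      C₁ * (2 ^ (-(γ / 2 * j)) * (C₂ * N + C₂ * N)) := by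
    intro j
    have e1 : seqNorm r (fun x => ∑' i, poisson γ i (u j i) x) ≤ C₂ * N := by
      refine (hC₂ (u j)).trans_eq ?_
      simp_rw [hushift]
      rfl
    have e2 : seqNorm r (fun x => ∑' i, poisson γ (i + 1) (v j (i + 1)) x) ≤ C₂ * N := by
      refine le_trans (seqNorm_mono hr0 fun x => ?_) ((hC₂ (v j)).trans_eq ?_)
      · exact ENNReal.tsum_comp_le_tsum_of_injective (add_left_injective 1)
          (fun i => poisson γ i (v j i) x)
      · simp_rw [show v j = u (j + 1) from rfl, hushift]
        rfl
    calc _ ≤ seqNorm r (fun x => C₁ * (2 ^ (-(γ / 2 * j)) * (∑' i, poisson γ i (u j i) x +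
          ∑' i, poisson γ (i + 1) (v j (i + 1)) x))) := by
          refine seqNorm_mono hr0 fun x => (ENNReal.tsum_le_tsum fun i => ha2 j i x).trans_eq ?_
          rw [ENNReal.tsum_mul_left, ENNReal.tsum_mul_left, ENNReal.tsum_add]
      _ ≤ _ := by
          rw [seqNorm_const_mul hr0, seqNorm_const_mul hr0]
          gcongr
          exact seqNorm_add_le' hr (fun _ => le_rfl) e1 e2
  calc _ ≤ C₃ * seqNorm r (fun x => ∑' i, ‖(stdGrid n).dif i (fun x => ∑ κ ∈ Finset.range L,
        transSum κ M (c κ) x) x‖ₑ ^ 2) :=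
        (stdGrid n).seqNorm_sq_le_square hr stdGrid_size_zero (tendsto_stdGrid_size hn) hfin
    _ ≤ C₃ * seqNorm r (fun x => A * ∑' j : ℕ, 2 ^ (η * j) * ∑' i, a j i x ^ 2) := by
        gcongr
        refine seqNorm_mono hr0 fun x => ?_
        calc _ ≤ ∑' i, A * ∑' j : ℕ, 2 ^ (η * j) * a j i x ^ 2 := by
              gcongr with i
              exact (pow_le_pow_left' (hdif i x) 2).trans (tsum_sq_le_geometric η _)
          _ = _ := by
              rw [ENNReal.tsum_mul_left, ENNReal.tsum_comm]
              simp_rw [ENNReal.tsum_mul_left]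
    _ ≤ C₃ * (A * ∑' j : ℕ, 2 ^ (η * j) * (C₁ * (2 ^ (-(γ / 2 * j)) * (C₂ * N + C₂ * N)))) := by
        rw [seqNorm_const_mul hr0]
        gcongr
        refine (seqNorm_tsum_le hr _).trans ?_
        gcongr with j
        rw [seqNorm_const_mul hr0]
        gcongr
        exact hj j
    _ = C₃ * (A * ∑' j : ℕ, 2 ^ (-(η * j)) * (C₁ * (C₂ * N + C₂ * N))) := by
        congr 2
        refine tsum_congr fun j => ?_
        rw [show -(η * j) = η * j + -(γ / 2 * j) by rw [hη]; ring, two_rpow_add]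
        ring
    _ = _ := by
        rw [ENNReal.tsum_mul_right, hD]
        ring

end TransSum

section LatticeHaar

/-- One-dimensional Haar function on `ℤ`, adapted to the interval
`2 ^ (ν + 1) * a + [0, 2 ^ (ν + 1))`
and normalised in `ℓ∞`. -/
def latHaar1 (ν : ℕ) (a : ℤ) (η : Bool) (t : ℤ) : ℝ :=
  if t / 2 ^ (ν + 1) = a then (if η ∧ t / 2 ^ ν % 2 ≠ 0 then -1 else 1) else 0

lemma abs_latHaar1 (ν : ℕ) (a : ℤ) (η : Bool) (t : ℤ) :
    |latHaar1 ν a η t| = if t / 2 ^ (ν + 1) = a then 1 else 0 := by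
  rw [latHaar1]
  split_ifs <;> simp

lemma ediv_two_pow_eq_iff {ν : ℕ} {a t : ℤ} :
    t / 2 ^ ν = a ↔ t ∈ Finset.Ico (2 ^ ν * a) (2 ^ ν * a + 2 ^ ν) := by
  rw [Int.ediv_eq_iff_of_pos (by positivity), Finset.mem_Ico]
  constructor <;> rintro ⟨h1, h2⟩ <;> constructor <;> linarith

lemma ediv_two_pow_succ (ν : ℕ) (t : ℤ) : t / 2 ^ (ν + 1) = t / 2 ^ ν / 2 := by
  rw [Int.ediv_ediv_of_nonneg (by positivity), pow_succ]

lemma ediv_two_pow_of_le {ν μ : ℕ} (h : ν ≤ μ) {t t' : ℤ} (ht : t / 2 ^ ν = t' / 2 ^ ν) :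
    t / 2 ^ μ = t' / 2 ^ μ := by
  obtain ⟨j, rfl⟩ := Nat.exists_eq_add_of_le h
  rw [pow_add, ← Int.ediv_ediv_of_nonneg (by positivity), ht,
    Int.ediv_ediv_of_nonneg (by positivity)]

lemma latHaar1_congr {ν : ℕ} (a : ℤ) (η : Bool) {t t' : ℤ} (h : t / 2 ^ ν = t' / 2 ^ ν) :
    latHaar1 ν a η t = latHaar1 ν a η t' := by
  simp only [latHaar1, h, ediv_two_pow_of_le ν.le_succ h]

lemma sum_latHaar1_true (ν : ℕ) (a : ℤ) :
    ∑ t ∈ Finset.Ico (2 ^ (ν + 1) * a) (2 ^ (ν + 1) * a + 2 ^ (ν + 1)), latHaar1 ν a true t = 0 := by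
  have hN : (0:ℤ) < 2 ^ ν := by positivity
  have h1 : ∀ t ∈ Finset.Ico (2 ^ ν * (2 * a)) (2 ^ ν * (2 * a) + 2 ^ ν),
      latHaar1 ν a true t = 1 := fun t ht => by
    have := ediv_two_pow_eq_iff.2 ht
    rw [latHaar1, ediv_two_pow_succ, this]
    simp
  have h2 : ∀ t ∈ Finset.Ico (2 ^ ν * (2 * a + 1)) (2 ^ ν * (2 * a + 1) + 2 ^ ν),
      latHaar1 ν a true t = -1 := fun t ht => by
    have := ediv_two_pow_eq_iff.2 ht
    rw [latHaar1, ediv_two_pow_succ, this, if_pos (by omega), if_pos ⟨rfl, by omega⟩]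
  rw [← Finset.Ico_union_Ico_eq_Ico (b := 2 ^ ν * (2 * a) + 2 ^ ν) (by rw [pow_succ]; linarith)
    (by rw [pow_succ]; linarith), Finset.sum_union (Finset.Ico_disjoint_Ico_consecutive _ _ _)]
  rw [show (2:ℤ) ^ (ν + 1) * a = 2 ^ ν * (2 * a) by ring, Finset.sum_congr rfl h1,
    show (2:ℤ) ^ ν * (2 * a) + 2 ^ ν = 2 ^ ν * (2 * a + 1) by ring,
    show (2:ℤ) ^ ν * (2 * a) + 2 ^ (ν + 1) = 2 ^ ν * (2 * a + 1) + 2 ^ ν by ring,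
    Finset.sum_congr rfl h2]
  simp [mul_add]

lemma sum_latHaar1_true_mul {ν : ℕ} (a : ℤ) {g : ℤ → ℝ}
    (hg : ∀ t t', t / 2 ^ (ν + 1) = t' / 2 ^ (ν + 1) → g t = g t') :
    ∑ t ∈ Finset.Ico (2 ^ (ν + 1) * a) (2 ^ (ν + 1) * a + 2 ^ (ν + 1)),
      latHaar1 ν a true t * g t = 0 := by
  have : ∀ t ∈ Finset.Ico (2 ^ (ν + 1) * a) (2 ^ (ν + 1) * a + 2 ^ (ν + 1)),
      latHaar1 ν a true t * g t = latHaar1 ν a true t * g (2 ^ (ν + 1) * a) := fun t ht => by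
    rw [hg t (2 ^ (ν + 1) * a)]
    rw [ediv_two_pow_eq_iff.2 ht, Int.mul_ediv_cancel_left _ (by positivity)]
  rw [Finset.sum_congr rfl this, ← Finset.sum_mul, sum_latHaar1_true, zero_mul]

lemma latHaar1_false_congr {ν : ℕ} (a : ℤ) {t t' : ℤ}
    (h : t / 2 ^ (ν + 1) = t' / 2 ^ (ν + 1)) :
    latHaar1 ν a false t = latHaar1 ν a false t' := by
  simp [latHaar1, h]

variable {n : ℕ}

/-- The Haar function on the lattice `ℤⁿ` with parameters `(ν, w, η)`, adapted to the block
`{z | cell (ν + 1) z = w}` and normalised in `ℓ∞`. -/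
def latHaar (q : ℕ × (Fin n → ℤ) × (Fin n → Bool)) (z : Fin n → ℤ) : ℝ :=
  ∏ i, latHaar1 q.1 (q.2.1 i) (q.2.2 i) (z i)

lemma abs_latHaar (q : ℕ × (Fin n → ℤ) × (Fin n → Bool)) (z : Fin n → ℤ) :
    |latHaar q z| = if cell (q.1 + 1) z = q.2.1 then 1 else 0 := by
  rw [latHaar, Finset.abs_prod]
  simp_rw [abs_latHaar1]
  rw [Finset.prod_ite_zero]
  simp [funext_iff, cell]

lemma latHaar_eq_zero {q : ℕ × (Fin n → ℤ) × (Fin n → Bool)} {z : Fin n → ℤ}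
    (h : cell (q.1 + 1) z ≠ q.2.1) : latHaar q z = 0 := by
  rw [← abs_eq_zero, abs_latHaar, if_neg h]

/-- The block carrying `latHaar q`. -/
def latBlk (q : ℕ × (Fin n → ℤ) × (Fin n → Bool)) : Finset (Fin n → ℤ) :=
  Fintype.piFinset fun i =>
    Finset.Ico (2 ^ (q.1 + 1) * q.2.1 i) (2 ^ (q.1 + 1) * q.2.1 i + 2 ^ (q.1 + 1))

lemma mem_latBlk {q : ℕ × (Fin n → ℤ) × (Fin n → Bool)} {z : Fin n → ℤ} :
    z ∈ latBlk q ↔ cell (q.1 + 1) z = q.2.1 := by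
  simp_rw [latBlk, Fintype.mem_piFinset, ← ediv_two_pow_eq_iff, funext_iff, cell]

lemma support_latHaar_finite (q : ℕ × (Fin n → ℤ) × (Fin n → Bool)) :
    (latHaar q).support.Finite :=
  (latBlk q).finite_toSet.subset fun z hz => by
    by_contra h
    exact hz (latHaar_eq_zero fun h' => h (Finset.mem_coe.2 (mem_latBlk.2 h')))

lemma tsum_latHaar_mul (q : ℕ × (Fin n → ℤ) × (Fin n → Bool)) (g : (Fin n → ℤ) → ℝ) :
    ∑' z, latHaar q z * g z = ∑ z ∈ latBlk q, latHaar q z * g z :=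
  tsum_eq_sum fun z hz => by rw [latHaar_eq_zero (mt mem_latBlk.2 hz), zero_mul]

lemma isConst_latHaar (q : ℕ × (Fin n → ℤ) × (Fin n → Bool)) :
    (stdGrid n).IsConst q.1 (latHaar q) := fun x y hy => by
  rw [mem_stdGrid_blk] at hy
  exact Finset.prod_congr rfl fun i _ => latHaar1_congr _ _ (congrFun hy i)

lemma tsum_latHaar_mul_self (q : ℕ × (Fin n → ℤ) × (Fin n → Bool)) :
    ∑' z, latHaar q z * latHaar q z = (2:ℝ) ^ ((q.1 + 1) * n) := by
  rw [tsum_latHaar_mul, Finset.sum_congr rfl fun z hz => by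
    rw [← abs_mul_abs_self, abs_latHaar, if_pos (mem_latBlk.1 hz), one_mul]]
  have h : ((2:ℤ) ^ (q.1 + 1)).toNat = 2 ^ (q.1 + 1) := by
    rw [Int.toNat_pow_of_nonneg (by norm_num)]; rfl
  simp [latBlk, pow_mul, h]

lemma tsum_latHaar_mul_eq_zero_of_le {q q' : ℕ × (Fin n → ℤ) × (Fin n → Bool)}
    (hq : q.2.2 ≠ fun _ => false) (hne : q ≠ q') (hle : q.1 ≤ q'.1) :
    ∑' z, latHaar q z * latHaar q' z = 0 := by
  rw [tsum_latHaar_mul]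
  simp_rw [latHaar, ← Finset.prod_mul_distrib]
  rw [latBlk, ← Finset.prod_univ_sum _
    (fun i t => latHaar1 q.1 (q.2.1 i) (q.2.2 i) t * latHaar1 q'.1 (q'.2.1 i) (q'.2.2 i) t)]
  obtain ⟨ν, w, η⟩ := q
  obtain ⟨ν', w', η'⟩ := q'
  simp only at hq hle ⊢
  suffices h : ∃ i, ∑ t ∈ Finset.Ico (2 ^ (ν + 1) * w i) (2 ^ (ν + 1) * w i + 2 ^ (ν + 1)),
      latHaar1 ν (w i) (η i) t * latHaar1 ν' (w' i) (η' i) t = 0 by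
    obtain ⟨i, hi⟩ := h
    exact Finset.prod_eq_zero (Finset.mem_univ i) hi
  rcases hle.lt_or_eq with hlt | rfl
  · obtain ⟨i, hi⟩ := Function.ne_iff.1 hq
    refine ⟨i, ?_⟩
    rw [Bool.eq_true_of_not_eq_false hi]
    exact sum_latHaar1_true_mul _ fun t t' h => latHaar1_congr _ _ (ediv_two_pow_of_le hlt h)
  by_cases hw : w = w'
  · subst hw
    obtain ⟨i, hi⟩ := Function.ne_iff.1 (fun h => hne (by rw [h]) : η ≠ η')
    refine ⟨i, ?_⟩
    rcases Bool.eq_false_or_eq_true (η i) with h | h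
    · rw [h, Bool.eq_false_of_not_eq_true fun h' => hi (h.trans h'.symm)]
      exact sum_latHaar1_true_mul _ fun t t' h => latHaar1_false_congr _ h
    · rw [h, Bool.eq_true_of_not_eq_false fun h' => hi (h.trans h'.symm)]
      refine (Finset.sum_congr rfl fun t _ => mul_comm _ _).trans ?_
      exact sum_latHaar1_true_mul _ fun t t' h => latHaar1_false_congr _ h
  · obtain ⟨i, hi⟩ := Function.ne_iff.1 hw
    refine ⟨i, Finset.sum_eq_zero fun t ht => ?_⟩
    rw [← ediv_two_pow_eq_iff] at ht
    have : latHaar1 ν (w' i) (η' i) t = 0 := if_neg (by rw [ht]; exact hi)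
    rw [this, mul_zero]

lemma tsum_latHaar_mul_latHaar {q q' : ℕ × (Fin n → ℤ) × (Fin n → Bool)}
    (hq : q.2.2 ≠ fun _ => false) (hq' : q'.2.2 ≠ fun _ => false) :
    ∑' z, latHaar q z * latHaar q' z = if q = q' then (2:ℝ) ^ ((q.1 + 1) * n) else 0 := by
  split_ifs with h
  · rw [← h, tsum_latHaar_mul_self]
  · rcases le_total q.1 q'.1 with h' | h'
    · exact tsum_latHaar_mul_eq_zero_of_le hq h h'
    · simp_rw [mul_comm (latHaar q _)]
      exact tsum_latHaar_mul_eq_zero_of_le hq' (Ne.symm h) h'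

lemma sum_blk_latHaar {q : ℕ × (Fin n → ℤ) × (Fin n → Bool)} (hq : q.2.2 ≠ fun _ => false)
    (x : Fin n → ℤ) : ∑ z ∈ (stdGrid n).blk (q.1 + 1) x, latHaar q z = 0 := by
  by_cases hx : cell (q.1 + 1) x = q.2.1
  · have : (stdGrid n).blk (q.1 + 1) x = latBlk q := by
      ext z
      rw [mem_stdGrid_blk, mem_latBlk, hx]
    obtain ⟨i, hi⟩ := Function.ne_iff.1 hq
    simp_rw [this, latHaar, latBlk]
    rw [← Finset.prod_univ_sum _ (fun i t => latHaar1 q.1 (q.2.1 i) (q.2.2 i) t)]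
    refine Finset.prod_eq_zero (Finset.mem_univ i) ?_
    rw [Bool.eq_true_of_not_eq_false hi]
    exact sum_latHaar1_true _ _
  · refine Finset.sum_eq_zero fun z hz => latHaar_eq_zero ?_
    rw [mem_stdGrid_blk.1 hz]
    exact hx

lemma dif_latHaar {q : ℕ × (Fin n → ℤ) × (Fin n → Bool)} (hq : q.2.2 ≠ fun _ => false) (μ : ℕ) :
    (stdGrid n).dif μ (latHaar q) = if q.1 = μ then latHaar q else 0 := by
  have h1 : ∀ μ ≤ q.1, (stdGrid n).ravg μ (latHaar q) = latHaar q := fun μ h => by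
    funext x
    exact (stdGrid n).ravg_const ((isConst_latHaar q).mono h) x
  have h2 : ∀ μ, q.1 + 1 ≤ μ → (stdGrid n).ravg μ (latHaar q) = 0 := fun μ h => by
    rw [← (stdGrid n).ravg_ravg h]
    have : (stdGrid n).ravg (q.1 + 1) (latHaar q) = 0 := by
      funext x
      rw [Filt.ravg, sum_blk_latHaar hq, mul_zero]; rfl
    rw [this]
    funext x
    simp [Filt.ravg]
  funext x
  rw [Filt.dif]
  split_ifs with h
  · rw [h1 μ h.ge, h2 (μ + 1) (by omega)]
    simp
  · rcases lt_or_gt_of_ne h with h | h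
    · rw [h2 μ h, h2 (μ + 1) (by omega)]; simp
    · rw [h1 μ h.le, h1 (μ + 1) h]; simp

/-- A finite Haar sum on the lattice. -/
def latSum (F : Finset (ℕ × (Fin n → ℤ) × (Fin n → Bool)))
    (c : ℕ × (Fin n → ℤ) × (Fin n → Bool) → ℝ) (z : Fin n → ℤ) : ℝ :=
  ∑ q ∈ F, c q * latHaar q z

variable {F : Finset (ℕ × (Fin n → ℤ) × (Fin n → Bool))}

lemma support_latSum_finite (c : ℕ × (Fin n → ℤ) × (Fin n → Bool) → ℝ) :
    (latSum F c).support.Finite := by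
  refine (F.finite_toSet.biUnion fun q _ => support_latHaar_finite q).subset fun x hx => ?_
  obtain ⟨q, hq, h⟩ := Finset.exists_ne_zero_of_sum_ne_zero hx
  exact Set.mem_biUnion hq (right_ne_zero_of_mul h)

lemma dif_latSum (hF : ∀ q ∈ F, q.2.2 ≠ fun _ => false)
    (c : ℕ × (Fin n → ℤ) × (Fin n → Bool) → ℝ) (μ : ℕ) :
    (stdGrid n).dif μ (latSum F c) = latSum (F.filter (·.1 = μ)) c := by
  funext x
  unfold latSum
  rw [Filt.dif_sum, Finset.sum_filter]
  refine Finset.sum_congr rfl fun q hq => ?_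
  have : (stdGrid n).dif μ (fun z => c q * latHaar q z) x =
      c q * (stdGrid n).dif μ (latHaar q) x := by
    simp only [Filt.dif, Filt.ravg, ← Finset.mul_sum]
    ring
  rw [this, dif_latHaar (hF q hq)]
  split_ifs <;> simp

lemma tsum_latHaar_mul_latSum (hF : ∀ q ∈ F, q.2.2 ≠ fun _ => false)
    (c : ℕ × (Fin n → ℤ) × (Fin n → Bool) → ℝ) {q : ℕ × (Fin n → ℤ) × (Fin n → Bool)}
    (hq : q.2.2 ≠ fun _ => false) :
    ∑' z, latHaar q z * latSum F c z = if q ∈ F then c q * (2:ℝ) ^ ((q.1 + 1) * n) else 0 := by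
  calc _ = ∑ q' ∈ F, c q' * ∑' z, latHaar q z * latHaar q' z := by
        simp_rw [tsum_latHaar_mul, latSum, Finset.mul_sum]
        rw [Finset.sum_comm]
        exact Finset.sum_congr rfl fun _ _ => Finset.sum_congr rfl fun _ _ => by ring
    _ = ∑ q' ∈ F, if q = q' then c q' * (2:ℝ) ^ ((q'.1 + 1) * n) else 0 := by
        refine Finset.sum_congr rfl fun q' hq' => ?_
        rw [tsum_latHaar_mul_latHaar hq (hF q' hq')]
        split_ifs with h
        · rw [h]
        · simp
    _ = _ := Finset.sum_ite_eq F q fun q' => c q' * (2:ℝ) ^ ((q'.1 + 1) * n)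

/-- A Haar coefficient is dominated by the average of the martingale difference. -/
lemma enorm_coeff_le (hF : ∀ q ∈ F, q.2.2 ≠ fun _ => false)
    (c : ℕ × (Fin n → ℤ) × (Fin n → Bool) → ℝ) {q : ℕ × (Fin n → ℤ) × (Fin n → Bool)}
    (hq : q ∈ F) :
    2 ^ (((q.1 + 1 : ℕ) * n : ℝ)) * ‖c q‖ₑ ≤
      ∑' z, if cell (q.1 + 1) z = q.2.1 then ‖(stdGrid n).dif q.1 (latSum F c) z‖ₑ else 0 := by
  have h1 := tsum_latHaar_mul_latSum (F := F.filter (·.1 = q.1))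
    (fun q' hq' => hF q' (Finset.mem_filter.1 hq').1) c (hF q hq)
  rw [if_pos (by simp [hq]), ← dif_latSum hF, tsum_latHaar_mul] at h1
  have h2 : (2:ℝ≥0∞) ^ (((q.1 + 1 : ℕ) * n : ℝ)) * ‖c q‖ₑ = ‖c q * (2:ℝ) ^ ((q.1 + 1) * n)‖ₑ := by
    rw [enorm_mul, enorm_pow, mul_comm, ← Nat.cast_mul, ENNReal.rpow_natCast]
    congr 2
    simp [enorm_eq_nnnorm]
  rw [h2, ← h1]
  refine (enorm_sum_le _ _).trans ((Finset.sum_le_sum fun z hz => ?_).trans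
    (ENNReal.sum_le_tsum (latBlk q)))
  rw [if_pos (mem_latBlk.1 hz), enorm_mul, ← Real.enorm_abs, abs_latHaar, if_pos (mem_latBlk.1 hz)]
  simp

end LatticeHaar

lemma Filt.avg_mul_sq_le {X : Type*} (F : Filt X) (ν : ℕ) (u v : X → ℝ≥0∞) (x : X) :
    F.avg ν (fun y => u y * v y) x ^ 2 ≤
      F.avg ν (fun y => u y ^ 2) x * F.avg ν (fun y => v y ^ 2) x := by
  have h2 : (2:ℝ).HolderConjugate 2 := by
    rw [Real.holderConjugate_iff]; norm_num
  have h := pow_le_pow_left' (ENNReal.inner_le_Lp_mul_Lq (F.blk ν x) u v h2) 2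
  have e : ∀ a : ℝ≥0∞, (a ^ (1 / 2 : ℝ)) ^ 2 = a := fun a => by
    rw [← ENNReal.rpow_natCast, ← ENNReal.rpow_mul]; norm_num
  rw [mul_pow, e, e] at h
  simp only [Filt.avg]
  simp only [ENNReal.rpow_two] at h
  calc _ = (F.size ν : ℝ≥0∞)⁻¹ ^ 2 * (∑ i ∈ F.blk ν x, u i * v i) ^ 2 := by ring
    _ ≤ (F.size ν : ℝ≥0∞)⁻¹ ^ 2 * ((∑ i ∈ F.blk ν x, u i ^ 2) * ∑ i ∈ F.blk ν x, v i ^ 2) := by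
        gcongr
    _ = _ := by ring

section Boundary
variable {n : ℕ}

/-- The indicator of the points of `ℤⁿ` which are at distance at most `2 ^ (κ - j)` from the
boundary of their block of level `κ`, measured along a diagonal. -/
def layer (κ j : ℕ) (z : Fin n → ℤ) : ℝ≥0∞ :=
  jump κ ((2:ℤ) ^ (κ - j) • 1) z ⊔ jump κ ((2:ℤ) ^ (κ - j) • (-1)) z

lemma layer_le_one (κ j : ℕ) (z : Fin n → ℤ) : layer κ j z ≤ 1 :=
  sup_le (jump_le_one _ _ _) (jump_le_one _ _ _)

lemma layer_sq_le (κ j : ℕ) (z : Fin n → ℤ) : layer κ j z ^ 2 ≤ layer κ j z := by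
  rw [pow_two]
  exact mul_le_of_le_one_right' (layer_le_one κ j z)

lemma isConst_layer {κ j : ℕ} (h : j ≤ κ) : (stdGrid n).IsConst (κ - j) (layer (n := n) κ j) := by
  have hc : ∀ x, cell (n := n) κ x = cell j (cell (κ - j) x) := fun x => by
    rw [cell_cell, Nat.sub_add_cancel h]
  intro x y hy
  rw [mem_stdGrid_blk] at hy
  have e : ∀ m : Fin n → ℤ, jump κ ((2:ℤ) ^ (κ - j) • m) y = jump κ ((2:ℤ) ^ (κ - j) • m) x := by
    intro m
    simp only [jump, hc, cell_add_smul, hy]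
  simp only [layer, e]

lemma avg_layer_le {κ j : ℕ} (h : j ≤ κ) (x : Fin n → ℤ) :
    (stdGrid n).avg κ (layer κ j) x ≤ 2 * n * 2 ^ (-(j:ℝ)) := by
  have e : ∀ m : Fin n → ℤ, ‖m‖ ≤ 1 →
      (stdGrid n).avg κ (jump κ ((2:ℤ) ^ (κ - j) • m)) x ≤ n * 2 ^ (-(j:ℝ)) := by
    intro m hm
    refine (avg_jump_le κ _ x).trans ?_
    rw [← ofReal_two_rpow, ← ENNReal.ofReal_natCast n, ← ENNReal.ofReal_mul (by positivity)]
    refine ENNReal.ofReal_le_ofReal ?_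
    rw [mul_div_assoc]
    gcongr
    rw [norm_smul, div_le_iff₀ (by positivity), Real.rpow_neg (by norm_num), Real.rpow_natCast]
    have : ‖(2:ℤ) ^ (κ - j)‖ = (2:ℝ) ^ (κ - j) := by
      rw [norm_pow]; simp [Int.norm_eq_abs]
    rw [this]
    calc (2:ℝ) ^ (κ - j) * ‖m‖ ≤ (2:ℝ) ^ (κ - j) * 1 := by gcongr
      _ = ((2:ℝ) ^ j)⁻¹ * 2 ^ κ := by
        rw [mul_one, pow_sub₀ _ (by norm_num) h, mul_comm]
  have hone : ‖(1 : Fin n → ℤ)‖ ≤ 1 := (pi_norm_le_iff_of_nonneg zero_le_one).2 fun i => by simp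
  calc _ ≤ (stdGrid n).avg κ (fun z => jump κ ((2:ℤ) ^ (κ - j) • 1) z +
          jump κ ((2:ℤ) ^ (κ - j) • (-1)) z) x := by
        refine (stdGrid n).avg_mono (fun z => sup_le le_self_add le_add_self) x
    _ ≤ n * 2 ^ (-(j:ℝ)) + n * 2 ^ (-(j:ℝ)) := by
        rw [Filt.avg_add]
        exact add_le_add (e 1 hone) (e (-1) (by rwa [norm_neg]))
    _ = _ := by ring

/-- A weight concentrated near the boundary of the blocks of level `κ`. -/
def bdry (γ : ℝ) (s κ : ℕ) (z : Fin n → ℤ) : ℝ≥0∞ :=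
  ∑ j ∈ Finset.range (s + 1), 2 ^ (-(γ * (s - j : ℝ))) * layer κ j z

lemma isConst_bdry (γ : ℝ) {s κ : ℕ} (h : s ≤ κ) :
    (stdGrid n).IsConst (κ - s) (bdry (n := n) γ s κ) := by
  refine Filt.IsConst.sum fun j hj => ?_
  rw [Finset.mem_range] at hj
  exact ((isConst_layer (by omega)).mono (by omega)).comp (2 ^ (-(γ * (s - j : ℝ))) * ·)

lemma bdry_sq_le (γ : ℝ) (s κ : ℕ) (z : Fin n → ℤ) :
    bdry γ s κ z ^ 2 ≤
      (s + 1) * ∑ j ∈ Finset.range (s + 1), 2 ^ (-(2 * γ * (s - j : ℝ))) * layer κ j z := by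
  have h := ENNReal.rpow_sum_le_const_mul_sum_rpow (Finset.range (s + 1))
    (fun j => (2:ℝ≥0∞) ^ (-(γ * (s - j : ℝ))) * layer κ j z) (p := 2) (by norm_num)
  simp only [Finset.card_range, ENNReal.rpow_two] at h
  norm_num at h
  refine h.trans ?_
  gcongr with j
  rw [mul_pow, ← ENNReal.rpow_natCast, ← ENNReal.rpow_mul]
  gcongr
  · norm_num
  · push_cast; linarith
  · exact layer_sq_le κ j z

lemma avg_bdry_sq_le {γ μ : ℝ} (hμγ : μ ≤ γ) (hμ : μ ≤ 1 / 2) {s κ : ℕ} (h : s ≤ κ)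
    (x : Fin n → ℤ) :
    (stdGrid n).avg κ (fun z => bdry γ s κ z ^ 2) x ≤
      2 * n * ((s + 1) * 2 ^ (-(μ * s))) ^ 2 := by
  calc _ ≤ (stdGrid n).avg κ (fun z => (s + 1) *
        ∑ j ∈ Finset.range (s + 1), 2 ^ (-(2 * γ * (s - j : ℝ))) * layer κ j z) x :=
        (stdGrid n).avg_mono (fun z => bdry_sq_le γ s κ z) x
    _ = (s + 1) * ∑ j ∈ Finset.range (s + 1), 2 ^ (-(2 * γ * (s - j : ℝ))) *
          (stdGrid n).avg κ (layer κ j) x := by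
        rw [Filt.avg_const_mul, Filt.avg_sum]
        simp_rw [Filt.avg_const_mul]
    _ ≤ (s + 1) * ∑ j ∈ Finset.range (s + 1), 2 * n * (2:ℝ≥0∞) ^ (-(2 * μ * s)) := by
        refine mul_le_mul_right (Finset.sum_le_sum fun j hj => ?_) _
        rw [Finset.mem_range] at hj
        calc _ ≤ 2 ^ (-(2 * γ * (s - j : ℝ))) * (2 * n * (2:ℝ≥0∞) ^ (-(j:ℝ))) := by
              exact mul_le_mul_right (avg_layer_le (by omega) x) _
          _ = 2 * n * 2 ^ (-(2 * γ * (s - j : ℝ)) + -(j:ℝ)) := by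
              rw [two_rpow_add]; ring
          _ ≤ _ := by
              refine mul_le_mul_right (ENNReal.rpow_le_rpow_of_exponent_le one_le_two ?_) _
              have : (j:ℝ) ≤ s := by exact_mod_cast (by omega : j ≤ s)
              nlinarith [Nat.cast_nonneg (α := ℝ) j]
    _ = _ := by
        rw [Finset.sum_const, Finset.card_range, mul_pow, ← ENNReal.rpow_natCast (2 ^ (-(μ * s))),
          ← ENNReal.rpow_mul, nsmul_eq_mul]
        push_cast
        rw [show -(2 * μ * (s:ℝ)) = -(μ * s) * 2 by ring]
        ring

lemma sum_level_le (F : Finset (ℕ × (Fin n → ℤ) × (Fin n → Bool))) (ν : ℕ) (z : Fin n → ℤ)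
    (a : ℕ × (Fin n → ℤ) × (Fin n → Bool) → ℝ≥0∞) {b : ℝ≥0∞}
    (h : ∀ q ∈ F, q.1 = ν → cell (ν + 1) z = q.2.1 → a q ≤ b) :
    ∑ q ∈ F.filter (·.1 = ν), (if cell (ν + 1) z = q.2.1 then a q else 0) ≤ 2 ^ n * b := by
  rw [← Finset.sum_filter, Finset.filter_filter]
  refine (Finset.sum_le_card_nsmul _ _ b fun q hq => ?_).trans ?_
  · rw [Finset.mem_filter] at hq
    exact h q hq.1 hq.2.1 hq.2.2
  · rw [nsmul_eq_mul]
    gcongr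
    have : (F.filter fun q => q.1 = ν ∧ cell (ν + 1) z = q.2.1).card ≤
        (Finset.univ : Finset (Fin n → Bool)).card := by
      refine Finset.card_le_card_of_injOn (·.2.2) (fun _ _ => Finset.mem_univ _) ?_
      rintro ⟨ν₁, w₁, η₁⟩ h₁ ⟨ν₂, w₂, η₂⟩ h₂ h
      simp only [Finset.coe_filter, Set.mem_ofPred_eq] at h₁ h₂ h
      rw [h₁.2.1, h₂.2.1, ← h₁.2.2, ← h₂.2.2, h]
    rw [Finset.card_univ, Fintype.card_fun, Fintype.card_bool, Fintype.card_fin] at this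
    exact_mod_cast this

end Boundary

section LatticeOperator
variable {n : ℕ}

/-- The coefficients `α` satisfy the size bounds of the matrix coefficients of an operator with
standard kernel, at scale separation `s`. -/
def CoeffBound (γ : ℝ) (s : ℕ) (A : ℝ≥0∞) (F : Finset (ℕ × (Fin n → ℤ) × (Fin n → Bool)))
    (α : ℕ × (Fin n → ℤ) × (Fin n → Bool) → (Fin n → ℤ) → ℝ) : Prop :=
  ∀ q ∈ F, ∀ m z, cell (q.1 + 1) z = q.2.1 →
    ‖α q m‖ₑ ≤ A * (wt n γ m * (2 ^ (-(s * n : ℝ)) * bdry γ s (q.1 + 1 + s) z))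

/-- The lattice version of the operator `Φ̃_s`, with finitely many translations. -/
def latOp (s : ℕ) (F : Finset (ℕ × (Fin n → ℤ) × (Fin n → Bool)))
    (α : ℕ × (Fin n → ℤ) × (Fin n → Bool) → (Fin n → ℤ) → ℝ)
    (c : ℕ × (Fin n → ℤ) × (Fin n → Bool) → ℝ) (M : Finset (Fin n → ℤ)) (z : Fin n → ℤ) : ℝ :=
  ∑ m ∈ M, ∑ q ∈ F, α q m * c q *
    ((if cell (q.1 + 1 + s) z = cell s q.2.1 + m then 1 else 0) -
      if cell (q.1 + 1 + s) z = cell s q.2.1 then 1 else 0)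

variable {F : Finset (ℕ × (Fin n → ℤ) × (Fin n → Bool))}

lemma exists_cell_eq (κ : ℕ) (w : Fin n → ℤ) : ∃ z : Fin n → ℤ, cell κ z = w :=
  ⟨(2:ℤ) ^ κ • w, by
    have := cell_add_smul κ 0 w
    rw [zero_add] at this
    rw [this]
    funext i
    simp [cell]⟩

lemma enorm_levelTerm_le {γ : ℝ} {s : ℕ} {A : ℝ≥0∞} (hF : ∀ q ∈ F, q.2.2 ≠ fun _ => false)
    {α : ℕ × (Fin n → ℤ) × (Fin n → Bool) → (Fin n → ℤ) → ℝ} (hα : CoeffBound γ s A F α)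
    (c : ℕ × (Fin n → ℤ) × (Fin n → Bool) → ℝ) {ν : ℕ} (m x : Fin n → ℤ)
    {q : ℕ × (Fin n → ℤ) × (Fin n → Bool)} (hqF : q ∈ F) (hq : q.1 = ν) :
    ‖α q m * c q * (if cell (ν + 1 + s) x = cell s q.2.1 then 1 else 0)‖ₑ ≤
      A * wt n γ m * 2 ^ (-((ν + 1 + s : ℕ) * n : ℝ)) * ∑' z, if cell (ν + 1) z = q.2.1 then
        (if cell (ν + 1 + s) z = cell (ν + 1 + s) x then
          bdry γ s (ν + 1 + s) z * ‖(stdGrid n).dif ν (latSum F c) z‖ₑ else 0) else 0 := by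
  subst hq
  obtain ⟨κ, hκ⟩ : ∃ κ, κ = q.1 + 1 + s := ⟨_, rfl⟩
  rw [← hκ]
  split_ifs with hx
  swap
  · simp
  rw [mul_one, enorm_mul]
  have e : (2:ℝ≥0∞) ^ (-(s * n : ℝ)) =
      2 ^ (-(κ * n : ℝ)) * 2 ^ (((q.1 + 1 : ℕ) * n : ℝ)) := by
    rw [← two_rpow_add, hκ]
    congr 1
    push_cast
    ring
  obtain ⟨z₀, hz₀⟩ := exists_cell_eq (q.1 + 1) q.2.1
  have hb : ∀ z, cell (q.1 + 1) z = q.2.1 → bdry γ s κ z = bdry γ s κ z₀ := fun z hz => by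
    refine isConst_bdry γ (s := s) (κ := κ) (by omega) _ _ (mem_stdGrid_blk.2 ?_)
    rw [show κ - s = q.1 + 1 by omega, hz, hz₀]
  calc _ ≤ (A * (wt n γ m * (2 ^ (-(s * n : ℝ)) * bdry γ s κ z₀))) * ‖c q‖ₑ := by
        have := hα q hqF m z₀ hz₀
        rw [← hκ] at this
        exact mul_le_mul_left this _
    _ = A * wt n γ m * 2 ^ (-(κ * n : ℝ)) * (bdry γ s κ z₀ *
          (2 ^ (((q.1 + 1 : ℕ) * n : ℝ)) * ‖c q‖ₑ)) := by
        rw [e]; ring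
    _ ≤ A * wt n γ m * 2 ^ (-(κ * n : ℝ)) * (bdry γ s κ z₀ *
          ∑' z, if cell (q.1 + 1) z = q.2.1 then
            ‖(stdGrid n).dif q.1 (latSum F c) z‖ₑ else 0) :=
        mul_le_mul_right (mul_le_mul_right (enorm_coeff_le hF c hqF) _) _
    _ ≤ _ := by
        rw [← ENNReal.tsum_mul_left]
        refine mul_le_mul_right (ENNReal.tsum_le_tsum fun z => ?_) _
        split_ifs with h h'
        · rw [hb z h]
        · exact absurd (by rw [hx, hκ, ← cell_cell, h]) h'
        · simp

lemma tsum_level_le (F : Finset (ℕ × (Fin n → ℤ) × (Fin n → Bool))) (ν κ : ℕ) (x : Fin n → ℤ)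
    (D : (Fin n → ℤ) → ℝ≥0∞) :
    ∑' z, ∑ q ∈ F.filter (·.1 = ν), (if cell (ν + 1) z = q.2.1 then
      (if cell κ z = cell κ x then D z else 0) else 0) ≤
      2 ^ n * ∑' z, if cell κ z = cell κ x then D z else 0 := by
  rw [← ENNReal.tsum_mul_left]
  exact ENNReal.tsum_le_tsum fun z => sum_level_le F ν z
    (fun _ => if cell κ z = cell κ x then D z else 0) fun _ _ _ _ => le_rfl

lemma enorm_levelSum_le {γ : ℝ} {s : ℕ} {A : ℝ≥0∞} (hF : ∀ q ∈ F, q.2.2 ≠ fun _ => false)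
    {α : ℕ × (Fin n → ℤ) × (Fin n → Bool) → (Fin n → ℤ) → ℝ} (hα : CoeffBound γ s A F α)
    (c : ℕ × (Fin n → ℤ) × (Fin n → Bool) → ℝ) (ν : ℕ) (m x : Fin n → ℤ) :
    ‖∑ q ∈ F.filter (·.1 = ν), α q m * c q *
        (if cell (ν + 1 + s) x = cell s q.2.1 then 1 else 0)‖ₑ ≤
      wt n γ m * (A * (2 ^ n * (stdGrid n).avg (ν + 1 + s)
        (fun z => bdry γ s (ν + 1 + s) z * ‖(stdGrid n).dif ν (latSum F c) z‖ₑ) x)) := by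
  refine (enorm_sum_le _ _).trans ((Finset.sum_le_sum fun q hq =>
    enorm_levelTerm_le hF hα c m x (Finset.mem_filter.1 hq).1 (Finset.mem_filter.1 hq).2).trans ?_)
  rw [← Finset.mul_sum, ← Summable.tsum_finsetSum fun _ _ => ENNReal.summable]
  refine (mul_le_mul_right (tsum_level_le F ν (ν + 1 + s) x
    fun z => bdry γ s (ν + 1 + s) z * ‖(stdGrid n).dif ν (latSum F c) z‖ₑ) _).trans_eq ?_
  rw [stdGrid_avg]
  ring

lemma latOp_eq_sum_transSum (s : ℕ)
    (α : ℕ × (Fin n → ℤ) × (Fin n → Bool) → (Fin n → ℤ) → ℝ)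
    (c : ℕ × (Fin n → ℤ) × (Fin n → Bool) → ℝ) (M : Finset (Fin n → ℤ)) :
    ∃ L, ∀ z, latOp s F α c M z = ∑ κ ∈ Finset.range L, transSum κ M (fun m x =>
      if s + 1 ≤ κ then ∑ q ∈ F.filter (·.1 = κ - (s + 1)), α q m * c q *
        (if cell κ x = cell s q.2.1 then 1 else 0) else 0) z := by
  refine ⟨F.sup (fun q => q.1) + (s + 2), fun z => ?_⟩
  have hL : ∀ q ∈ F, q.1 + (s + 1) ∈ Finset.range (F.sup (fun q => q.1) + (s + 2)) := fun q hq => by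
    have := Finset.le_sup (f := fun q : ℕ × (Fin n → ℤ) × (Fin n → Bool) => q.1) hq
    rw [Finset.mem_range]
    omega
  rw [latOp]
  simp only [transSum]
  refine Eq.trans (Finset.sum_congr rfl fun m _ => ?_) Finset.sum_comm
  rw [← Finset.sum_fiberwise_of_maps_to hL]
  refine Finset.sum_congr rfl fun κ _ => ?_
  by_cases hκ : s + 1 ≤ κ
  · simp only [if_pos hκ]
    rw [← Finset.sum_sub_distrib]
    have : F.filter (fun q => q.1 + (s + 1) = κ) = F.filter (fun q => q.1 = κ - (s + 1)) :=
      Finset.filter_congr fun q _ => by omega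
    rw [this]
    refine Finset.sum_congr rfl fun q hq => ?_
    have e : q.1 + 1 + s = κ := by
      have := (Finset.mem_filter.1 hq).2
      omega
    have e2 : cell κ (z - (2:ℤ) ^ κ • m) = cell κ z - m := by
      rw [sub_eq_add_neg, ← smul_neg, cell_add_smul, sub_eq_add_neg]
    rw [e, e2, ← mul_sub]
    simp only [sub_eq_iff_eq_add]
  · simp only [if_neg hκ, sub_zero]
    refine Finset.sum_eq_zero fun q hq => ?_
    have := (Finset.mem_filter.1 hq).2
    omega

lemma support_indicator_cell_finite (κ : ℕ) (w : Fin n → ℤ) :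
    {x : Fin n → ℤ | cell κ x = w}.Finite := by
  rcases Set.eq_empty_or_nonempty {x : Fin n → ℤ | cell κ x = w} with h | ⟨x₀, hx₀⟩
  · rw [h]; exact Set.finite_empty
  · refine ((stdGrid n).blk κ x₀).finite_toSet.subset fun x hx => ?_
    rw [Finset.mem_coe, mem_stdGrid_blk]
    exact Eq.trans hx (Eq.symm hx₀)

/-- The lattice estimate in `ℓ^{2r}`, `r ≥ 1`. -/
theorem seqNorm_latOp_sq_le (hn : 0 < n) {γ r : ℝ} (hγ : 0 < γ) (hγ1 : γ ≤ 1) (hr : 1 ≤ r) :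
    ∃ C : NNReal, ∀ (s : ℕ) (A : ℝ≥0∞) (F : Finset (ℕ × (Fin n → ℤ) × (Fin n → Bool)))
      (α : ℕ × (Fin n → ℤ) × (Fin n → Bool) → (Fin n → ℤ) → ℝ)
      (c : ℕ × (Fin n → ℤ) × (Fin n → Bool) → ℝ) (M : Finset (Fin n → ℤ)) (μ : ℝ),
      μ ≤ γ → μ ≤ 1 / 2 → (∀ q ∈ F, q.2.2 ≠ fun _ => false) → CoeffBound γ s A F α →
      seqNorm r (fun z => ‖latOp s F α c M z‖ₑ ^ 2) ≤
        C * ((A * ((s + 1) * 2 ^ (-(μ * s)))) ^ 2 * seqNorm r (fun z => ‖latSum F c z‖ₑ ^ 2)) := by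
  have hr0 : 0 < r := by linarith
  obtain ⟨C₁, hC₁⟩ := seqNorm_transSum_le hn hγ hγ1 hr
  obtain ⟨C₂, hC₂⟩ := exists_seqNorm_square_le (n := n) hr
  have hDt : C₁ * ((2 ^ n) ^ 2 * (2 * n)) * (ENNReal.ofReal r * C₂) ≠ ⊤ := by finiteness
  refine ⟨(C₁ * ((2 ^ n) ^ 2 * (2 * n)) * (ENNReal.ofReal r * C₂)).toNNReal,
    fun s A F α c M μ hμγ hμ hF hα => ?_⟩
  rw [ENNReal.coe_toNNReal hDt]
  obtain ⟨L, hL⟩ := latOp_eq_sum_transSum (F := F) s α c M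
  simp_rw [hL]
  set E : ℝ≥0∞ := (s + 1) * 2 ^ (-(μ * s)) with hE
  set d : ℕ → (Fin n → ℤ) → ℝ≥0∞ := fun ν z => ‖(stdGrid n).dif ν (latSum F c) z‖ₑ with hd
  refine (hC₁ L M _ (fun κ x => if s + 1 ≤ κ then A * (2 ^ n * (stdGrid n).avg κ
    (fun z => bdry γ s κ z * d (κ - (s + 1)) z) x) else 0) ?_ ?_ ?_).trans ?_
  · intro κ m
    exact isConst_of_cell (κ := κ) fun y => if s + 1 ≤ κ then
      ∑ q ∈ F.filter (·.1 = κ - (s + 1)), α q m * c q * (if y = cell s q.2.1 then 1 else 0) else 0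
  · intro κ m
    refine (F.finite_toSet.biUnion fun q _ =>
      support_indicator_cell_finite κ (cell s q.2.1)).subset fun x hx => ?_
    rw [Function.mem_support] at hx
    split_ifs at hx with h
    · obtain ⟨q, hq, h⟩ := Finset.exists_ne_zero_of_sum_ne_zero hx
      refine Set.mem_biUnion (Finset.filter_subset _ _ hq) ?_
      by_contra h'
      exact h (by rw [if_neg (show ¬ cell κ x = cell s q.2.1 from h'), mul_zero])
    · exact absurd rfl hx
  · intro κ m x
    split_ifs with h
    · obtain ⟨ν, rfl⟩ : ∃ ν, κ = ν + 1 + s := ⟨κ - (s + 1), by omega⟩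
      simp only [show ν + 1 + s - (s + 1) = ν by omega]
      exact enorm_levelSum_le hF hα c ν m x
    · simp
  · have key : ∀ x, ∑' κ, (if s + 1 ≤ κ then A * (2 ^ n * (stdGrid n).avg κ
        (fun z => bdry γ s κ z * d (κ - (s + 1)) z) x) else 0) ^ 2 ≤
        (((2 ^ n) ^ 2 * (2 * n)) * (A * E) ^ 2) * ∑' κ, (stdGrid n).avg κ
          (fun z => if s + 1 ≤ κ then d (κ - (s + 1)) z ^ 2 else 0) x := by
      intro x
      rw [← ENNReal.tsum_mul_left]
      refine ENNReal.tsum_le_tsum fun κ => ?_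
      split_ifs with h
      · calc _ = (A * 2 ^ n) ^ 2 * (stdGrid n).avg κ
              (fun z => bdry γ s κ z * d (κ - (s + 1)) z) x ^ 2 := by ring
          _ ≤ (A * 2 ^ n) ^ 2 * ((2 * n * E ^ 2) *
              (stdGrid n).avg κ (fun z => d (κ - (s + 1)) z ^ 2) x) := by
            refine mul_le_mul_right (((stdGrid n).avg_mul_sq_le κ _ _ x).trans ?_) _
            exact mul_le_mul_left (avg_bdry_sq_le hμγ hμ (by omega) x) _
          _ = _ := by ring
      · simp
    calc _ ≤ C₁ * ((((2 ^ n) ^ 2 * (2 * n)) * (A * E) ^ 2) * (ENNReal.ofReal r *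
          (C₂ * seqNorm r (fun z => ‖latSum F c z‖ₑ ^ 2)))) := by
          refine mul_le_mul_right ((seqNorm_mono hr0 key).trans ?_) _
          rw [seqNorm_const_mul hr0]
          refine mul_le_mul_right (((stdGrid n).seqNorm_tsum_avg_le hr _).trans ?_) _
          refine mul_le_mul_right (le_trans (seqNorm_mono hr0 fun x => ?_) (hC₂ (latSum F c))) _
          exact (tsum_shift_ite (s + 1) fun ν => d ν x ^ 2).le
      _ = _ := by ring

end LatticeOperator

section LatticeDual
variable {n : ℕ} {F : Finset (ℕ × (Fin n → ℤ) × (Fin n → Bool))}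

lemma cell_two_pow_smul (κ : ℕ) (w : Fin n → ℤ) : cell κ ((2:ℤ) ^ κ • w) = w := by
  have := cell_add_smul κ 0 w
  rw [zero_add] at this
  rw [this]
  funext i
  simp [cell]

/-- The Haar coefficients of the adjoint of `latOp` applied to `g`. -/
def adjCoeff (s : ℕ) (α : ℕ × (Fin n → ℤ) × (Fin n → Bool) → (Fin n → ℤ) → ℝ)
    (M : Finset (Fin n → ℤ)) (g : (Fin n → ℤ) → ℝ)
    (q : ℕ × (Fin n → ℤ) × (Fin n → Bool)) : ℝ :=
  2 ^ (s * n) * ∑ m ∈ M, α q m *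
    ((stdGrid n).ravg (q.1 + 1 + s) g ((2:ℤ) ^ (q.1 + 1) • q.2.1 + (2:ℤ) ^ (q.1 + 1 + s) • m) -
      (stdGrid n).ravg (q.1 + 1 + s) g ((2:ℤ) ^ (q.1 + 1) • q.2.1))

lemma sum_mul_indicator_cell {g : (Fin n → ℤ) → ℝ} {S : Finset (Fin n → ℤ)}
    (hS : ∀ z, z ∉ S → g z = 0) (κ : ℕ) (x : Fin n → ℤ) :
    ∑ z ∈ S, (if cell κ z = cell κ x then 1 else 0) * g z =
      2 ^ (κ * n) * (stdGrid n).ravg κ g x := by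
  have hsz : ((stdGrid n).size κ : ℝ) = 2 ^ (κ * n) := by
    have := grid_size (0 : Fin n → ℤ) κ
    rw [← Nat.cast_mul, ENNReal.rpow_natCast] at this
    exact_mod_cast this
  rw [Filt.ravg, hsz]
  have h0 : (2:ℝ) ^ (κ * n) ≠ 0 := by positivity
  field_simp
  simp only [ite_mul, one_mul, zero_mul]
  rw [← Finset.sum_filter]
  refine Finset.sum_subset_zero_on_sdiff (fun z hz => ?_) (fun z hz => ?_) fun _ _ => rfl
  · exact mem_stdGrid_blk.2 (Finset.mem_filter.1 hz).2
  · rw [Finset.mem_sdiff, Finset.mem_filter, mem_stdGrid_blk] at hz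
    exact hS z fun h => hz.2 ⟨h, hz.1⟩

lemma sum_latOp_mul (hF : ∀ q ∈ F, q.2.2 ≠ fun _ => false) (s : ℕ)
    (α : ℕ × (Fin n → ℤ) × (Fin n → Bool) → (Fin n → ℤ) → ℝ)
    (c : ℕ × (Fin n → ℤ) × (Fin n → Bool) → ℝ) (M : Finset (Fin n → ℤ))
    {g : (Fin n → ℤ) → ℝ} {S : Finset (Fin n → ℤ)} (hS : ∀ z, z ∉ S → g z = 0) :
    ∑ z ∈ S, latOp s F α c M z * g z =
      ∑' z, latSum F c z * latSum F (adjCoeff s α M g) z := by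
  have hR : ∑' z, latSum F c z * latSum F (adjCoeff s α M g) z =
      ∑ q ∈ F, c q * (adjCoeff s α M g q * (2:ℝ) ^ ((q.1 + 1) * n)) := by
    have h1 (z) : latSum F c z * latSum F (adjCoeff s α M g) z =
        ∑ q ∈ F, c q * (latHaar q z * latSum F (adjCoeff s α M g) z) := by
      rw [latSum, Finset.sum_mul]
      exact Finset.sum_congr rfl fun q _ => by ring
    simp_rw [h1]
    rw [Summable.tsum_finsetSum]
    · refine Finset.sum_congr rfl fun q hq => ?_
      rw [tsum_mul_left, tsum_latHaar_mul_latSum hF _ (hF q hq), if_pos hq]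
    · intro q _
      refine summable_of_hasFiniteSupport ((support_latHaar_finite q).subset fun z hz => ?_)
      rw [Function.mem_support] at hz ⊢
      exact fun h => hz (by rw [h]; ring)
  rw [hR]
  simp only [latOp, Finset.sum_mul]
  rw [Finset.sum_comm]
  simp_rw [Finset.sum_comm (s := S)]
  rw [Finset.sum_comm]
  refine Finset.sum_congr rfl fun q _ => ?_
  rw [adjCoeff, Finset.mul_sum, Finset.sum_mul, Finset.mul_sum]
  refine Finset.sum_congr rfl fun m _ => ?_
  have hc : cell (q.1 + 1 + s) ((2:ℤ) ^ (q.1 + 1) • q.2.1) = cell s q.2.1 := by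
    rw [← cell_cell, cell_two_pow_smul]
  have e1 := sum_mul_indicator_cell hS (q.1 + 1 + s) ((2:ℤ) ^ (q.1 + 1) • q.2.1)
  have e2 := sum_mul_indicator_cell hS (q.1 + 1 + s)
    ((2:ℤ) ^ (q.1 + 1) • q.2.1 + (2:ℤ) ^ (q.1 + 1 + s) • m)
  rw [cell_add_smul, hc] at e2
  rw [hc] at e1
  calc _ = α q m * c q * (∑ z ∈ S, (if cell (q.1 + 1 + s) z = cell s q.2.1 + m then 1 else 0) * g z -
        ∑ z ∈ S, (if cell (q.1 + 1 + s) z = cell s q.2.1 then 1 else 0) * g z) := by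
        rw [← Finset.sum_sub_distrib, Finset.mul_sum]
        exact Finset.sum_congr rfl fun z _ => by ring
    _ = _ := by
        rw [e1, e2, add_mul, pow_add]
        ring

lemma enorm_adjCoeff_le {γ : ℝ} {s : ℕ} {A : ℝ≥0∞}
    {α : ℕ × (Fin n → ℤ) × (Fin n → Bool) → (Fin n → ℤ) → ℝ} (hα : CoeffBound γ s A F α)
    (M : Finset (Fin n → ℤ)) (g : (Fin n → ℤ) → ℝ) {q : ℕ × (Fin n → ℤ) × (Fin n → Bool)}
    (hq : q ∈ F) {x : Fin n → ℤ} (hx : cell (q.1 + 1) x = q.2.1) :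
    ‖adjCoeff s α M g q‖ₑ ≤ A * (bdry γ s (q.1 + 1 + s) x *
      transDiff γ (q.1 + 1 + s) ((stdGrid n).ravg (q.1 + 1 + s) g) x) := by
  have hc : cell (q.1 + 1 + s) ((2:ℤ) ^ (q.1 + 1) • q.2.1) = cell (q.1 + 1 + s) x := by
    rw [← cell_cell, cell_two_pow_smul, ← hx, cell_cell]
  have hr : ∀ y z : Fin n → ℤ, cell (q.1 + 1 + s) y = cell (q.1 + 1 + s) z →
      (stdGrid n).ravg (q.1 + 1 + s) g y = (stdGrid n).ravg (q.1 + 1 + s) g z := fun y z h =>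
    (stdGrid n).isConst_ravg _ g _ _ (mem_stdGrid_blk.2 h)
  have h2 : ‖(2:ℝ) ^ (s * n)‖ₑ = 2 ^ ((s * n : ℝ)) := by
    rw [enorm_pow, ← Nat.cast_mul, ENNReal.rpow_natCast]
    congr 1
    simp [enorm_eq_nnnorm]
  rw [adjCoeff, enorm_mul, h2, transDiff]
  calc _ ≤ 2 ^ ((s * n : ℝ)) * ∑ m ∈ M, A * (wt n γ m * (2 ^ (-(s * n : ℝ)) *
        bdry γ s (q.1 + 1 + s) x)) * ‖(stdGrid n).ravg (q.1 + 1 + s) g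
          (x + (2:ℤ) ^ (q.1 + 1 + s) • m) - (stdGrid n).ravg (q.1 + 1 + s) g x‖ₑ := by
        refine mul_le_mul_right ((enorm_sum_le _ _).trans (Finset.sum_le_sum fun m _ => ?_)) _
        rw [enorm_mul, hr _ _ hc, hr _ (x + (2:ℤ) ^ (q.1 + 1 + s) • m)
          (by rw [cell_add_smul, cell_add_smul, hc])]
        exact mul_le_mul_left (hα q hq m x hx) _
    _ = (2 ^ ((s * n : ℝ)) * 2 ^ (-(s * n : ℝ))) * (A * (bdry γ s (q.1 + 1 + s) x *
        ∑ m ∈ M, wt n γ m * ‖(stdGrid n).ravg (q.1 + 1 + s) g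
          (x + (2:ℤ) ^ (q.1 + 1 + s) • m) - (stdGrid n).ravg (q.1 + 1 + s) g x‖ₑ)) := by
        simp only [Finset.mul_sum]
        exact Finset.sum_congr rfl fun m _ => by ring
    _ ≤ _ := by
        rw [← two_rpow_add, add_neg_cancel, ENNReal.rpow_zero, one_mul]
        exact mul_le_mul_right (mul_le_mul_right (ENNReal.sum_le_tsum M) _) _

lemma enorm_dif_adj_le {γ : ℝ} {s : ℕ} {A : ℝ≥0∞} (hF : ∀ q ∈ F, q.2.2 ≠ fun _ => false)
    {α : ℕ × (Fin n → ℤ) × (Fin n → Bool) → (Fin n → ℤ) → ℝ} (hα : CoeffBound γ s A F α)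
    (M : Finset (Fin n → ℤ)) (g : (Fin n → ℤ) → ℝ) (ν : ℕ) (x : Fin n → ℤ) :
    ‖(stdGrid n).dif ν (latSum F (adjCoeff s α M g)) x‖ₑ ≤
      2 ^ n * (A * (bdry γ s (ν + 1 + s) x *
        transDiff γ (ν + 1 + s) ((stdGrid n).ravg (ν + 1 + s) g) x)) := by
  rw [dif_latSum hF, latSum]
  refine ((enorm_sum_le _ _).trans (Finset.sum_le_sum fun q hq => ?_)).trans
    (sum_level_le F ν x (fun q => ‖adjCoeff s α M g q‖ₑ) fun q hq hν hx => ?_)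
  · obtain ⟨_, rfl⟩ := Finset.mem_filter.1 hq
    rw [enorm_mul, ← Real.enorm_abs (latHaar q x), abs_latHaar]
    split_ifs <;> simp
  · subst hν
    exact enorm_adjCoeff_le hα M g hq hx

lemma seqNorm_layer_le {γ r : ℝ} (hr : 1 ≤ r) (s j : ℕ) (hj : j ≤ s) (g : (Fin n → ℤ) → ℝ) :
    seqNorm r (fun x => ∑' κ, (if s + 1 ≤ κ then layer κ j x else 0) *
        transDiff γ κ ((stdGrid n).ravg κ g) x ^ 2) ≤
      (ENNReal.ofReal r * (2 * n * 2 ^ (-(j:ℝ)))) ^ (1 / r) *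
        seqNorm r (fun x => ∑' κ, transDiff γ κ ((stdGrid n).ravg κ g) x ^ 2) := by
  have hr0 : 0 < r := by linarith
  rw [seqNorm, seqNorm, ← ENNReal.mul_rpow_of_nonneg _ _ (by positivity)]
  refine ENNReal.rpow_le_rpow ((stdGrid n).tsum_layer_rpow_le hr
    (fun κ x => if s + 1 ≤ κ then layer κ j x else 0)
    (fun κ x => transDiff γ κ ((stdGrid n).ravg κ g) x ^ 2) ?_ ?_ ?_) (by positivity)
  · intro κ x
    split_ifs
    · exact layer_le_one _ _ _
    · exact zero_le
  · intro κ x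
    by_cases h : s + 1 ≤ κ
    · simp only [if_pos h]
      exact avg_layer_le (by omega) x
    · simp only [if_neg h]
      simp [Filt.avg]
  · intro κ x y hy
    rw [mem_stdGrid_blk] at hy
    have hr : ∀ y z : Fin n → ℤ, cell κ y = cell κ z →
        (stdGrid n).ravg κ g y = (stdGrid n).ravg κ g z := fun y z h =>
      (stdGrid n).isConst_ravg _ g _ _ (mem_stdGrid_blk.2 h)
    simp only [transDiff]
    rw [hr y x hy]
    congr 1
    refine tsum_congr fun m => ?_
    rw [hr (y + _) (x + (2:ℤ) ^ κ • m) (by rw [cell_add_smul, cell_add_smul, hy])]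

/-- The estimate for the adjoint of `latOp` in `ℓ^{2r}`, `r ≥ 1`. -/
theorem seqNorm_adj_sq_le (hn : 0 < n) {γ r : ℝ} (hγ : 0 < γ) (hγ1 : γ ≤ 1) (hr : 1 ≤ r) :
    ∃ C : NNReal, ∀ (s : ℕ) (A : ℝ≥0∞) (F : Finset (ℕ × (Fin n → ℤ) × (Fin n → Bool)))
      (α : ℕ × (Fin n → ℤ) × (Fin n → Bool) → (Fin n → ℤ) → ℝ) (M : Finset (Fin n → ℤ))
      (g : (Fin n → ℤ) → ℝ) (μ : ℝ), g.support.Finite →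
      μ ≤ γ → μ ≤ 1 / (2 * r) → (∀ q ∈ F, q.2.2 ≠ fun _ => false) → CoeffBound γ s A F α →
      seqNorm r (fun z => ‖latSum F (adjCoeff s α M g) z‖ₑ ^ 2) ≤
        C * ((A * ((s + 1) * 2 ^ (-(μ * s)))) ^ 2 * seqNorm r (fun z => ‖g z‖ₑ ^ 2)) := by
  have hr0 : 0 < r := by linarith
  obtain ⟨C₁, hC₁⟩ := seqNorm_transDiff_le hn hγ hγ1 hr
  obtain ⟨C₀, hC₀, hC₀t⟩ : ∃ C₀ : ℝ≥0∞, (∀ f : (Fin n → ℤ) → ℝ, f.support.Finite →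
      seqNorm r (fun x => ‖f x‖ₑ ^ 2) ≤
        C₀ * seqNorm r (fun x => ∑' i, ‖(stdGrid n).dif i f x‖ₑ ^ 2)) ∧ C₀ ≠ ⊤ :=
    ⟨_, fun f hf => (stdGrid n).seqNorm_sq_le_square hr stdGrid_size_zero
      (tendsto_stdGrid_size hn) hf,
      ENNReal.mul_ne_top (by finiteness) (ENNReal.rpow_ne_top_of_nonneg (by linarith)
        (by finiteness))⟩
  have hct : (ENNReal.ofReal r * (2 * n)) ^ (1 / r) ≠ ⊤ :=
    ENNReal.rpow_ne_top_of_nonneg (by positivity) (by finiteness)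
  have hDt : C₀ * ((2 ^ n) ^ 2 * ((ENNReal.ofReal r * (2 * n)) ^ (1 / r) * C₁)) ≠ ⊤ := by
    finiteness
  refine ⟨(C₀ * ((2 ^ n) ^ 2 * ((ENNReal.ofReal r * (2 * n)) ^ (1 / r) * C₁))).toNNReal,
    fun s A F α M g μ hg hμγ hμ hF hα => ?_⟩
  rw [ENNReal.coe_toNNReal hDt]
  refine (hC₀ _ (support_latSum_finite _)).trans ?_
  have key : ∀ x, ∑' ν, ‖(stdGrid n).dif ν (latSum F (adjCoeff s α M g)) x‖ₑ ^ 2 ≤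
      ∑ j ∈ Finset.range (s + 1), ((2 ^ n * A) ^ 2 * (s + 1) * 2 ^ (-(2 * γ * (s - j : ℝ)))) *
        ∑' κ, (if s + 1 ≤ κ then layer κ j x else 0) *
          transDiff γ κ ((stdGrid n).ravg κ g) x ^ 2 := by
    intro x
    simp only [← ENNReal.tsum_mul_left]
    rw [← Summable.tsum_finsetSum fun _ _ => ENNReal.summable]
    refine le_trans (ENNReal.tsum_le_tsum fun ν => ?_) (ENNReal.tsum_comp_le_tsum_of_injective
      (f := fun ν : ℕ => ν + 1 + s) (fun a b h => by simpa using h) _)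
    simp only [show ∀ ν, s + 1 ≤ ν + 1 + s from fun ν => by omega, if_true]
    calc _ ≤ (2 ^ n * (A * (bdry γ s (ν + 1 + s) x *
          transDiff γ (ν + 1 + s) ((stdGrid n).ravg (ν + 1 + s) g) x))) ^ 2 :=
          pow_le_pow_left' (enorm_dif_adj_le hF hα M g ν x) 2
      _ = (2 ^ n * A) ^ 2 * transDiff γ (ν + 1 + s) ((stdGrid n).ravg (ν + 1 + s) g) x ^ 2 *
            bdry γ s (ν + 1 + s) x ^ 2 := by ring
      _ ≤ (2 ^ n * A) ^ 2 * transDiff γ (ν + 1 + s) ((stdGrid n).ravg (ν + 1 + s) g) x ^ 2 *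
            _ := mul_le_mul_right (bdry_sq_le γ s _ x) _
      _ = _ := by
          simp only [Finset.mul_sum]
          exact Finset.sum_congr rfl fun j _ => by ring
  refine (mul_le_mul_right ((seqNorm_mono hr0 key).trans (seqNorm_sum_le hr _ _)) _).trans ?_
  have hj : ∀ j ∈ Finset.range (s + 1), seqNorm r (fun x =>
      ((2 ^ n * A) ^ 2 * (s + 1) * 2 ^ (-(2 * γ * (s - j : ℝ)))) *
        ∑' κ, (if s + 1 ≤ κ then layer κ j x else 0) *
          transDiff γ κ ((stdGrid n).ravg κ g) x ^ 2) ≤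
      (2 ^ n * A) ^ 2 * (s + 1) * (2 ^ (-(μ * s))) ^ 2 *
        ((ENNReal.ofReal r * (2 * n)) ^ (1 / r) * (C₁ * seqNorm r (fun z => ‖g z‖ₑ ^ 2))) := by
    intro j hj
    have hjs : j ≤ s := by rw [Finset.mem_range] at hj; omega
    have hjs' : (j:ℝ) ≤ s := by exact_mod_cast hjs
    rw [seqNorm_const_mul hr0]
    have e : (2:ℝ≥0∞) ^ (-(2 * γ * (s - j : ℝ))) * (2 ^ (-(j:ℝ))) ^ (1 / r) ≤
        (2 ^ (-(μ * s))) ^ 2 := by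
      rw [← ENNReal.rpow_mul, ← two_rpow_add, ← ENNReal.rpow_natCast, ← ENNReal.rpow_mul]
      refine ENNReal.rpow_le_rpow_of_exponent_le one_le_two ?_
      have h1 : μ * (s - j) ≤ γ * (s - j) := mul_le_mul_of_nonneg_right hμγ (by linarith)
      have h2 : μ * j ≤ 1 / (2 * r) * j := mul_le_mul_of_nonneg_right hμ (by positivity)
      have h3 : 1 / (2 * r) * j = j * (1 / r) / 2 := by field_simp
      push_cast
      linarith
    calc _ ≤ (2 ^ n * A) ^ 2 * (s + 1) * 2 ^ (-(2 * γ * (s - j : ℝ))) *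
          ((ENNReal.ofReal r * (2 * n * 2 ^ (-(j:ℝ)))) ^ (1 / r) *
            (C₁ * seqNorm r (fun z => ‖g z‖ₑ ^ 2))) :=
          mul_le_mul_right ((seqNorm_layer_le hr s j hjs g).trans
            (mul_le_mul_right (hC₁ g hg) _)) _
      _ = (2 ^ n * A) ^ 2 * (s + 1) * (2 ^ (-(2 * γ * (s - j : ℝ))) * (2 ^ (-(j:ℝ))) ^ (1 / r)) *
          ((ENNReal.ofReal r * (2 * n)) ^ (1 / r) *
            (C₁ * seqNorm r (fun z => ‖g z‖ₑ ^ 2))) := by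
          rw [← mul_assoc (ENNReal.ofReal r), ENNReal.mul_rpow_of_nonneg _ _ (by positivity :
            0 ≤ 1 / r)]
          ring
      _ ≤ _ := mul_le_mul_left (mul_le_mul_right e _) _
  refine (mul_le_mul_right (Finset.sum_le_sum hj) _).trans_eq ?_
  rw [Finset.sum_const, Finset.card_range, nsmul_eq_mul]
  push_cast
  ring

end LatticeDual

section LatticeMain
variable {n : ℕ} {F : Finset (ℕ × (Fin n → ℤ) × (Fin n → Bool))}

lemma support_latOp_finite (s : ℕ) (α : ℕ × (Fin n → ℤ) × (Fin n → Bool) → (Fin n → ℤ) → ℝ)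
    (c : ℕ × (Fin n → ℤ) × (Fin n → Bool) → ℝ) (M : Finset (Fin n → ℤ)) :
    (latOp s F α c M).support.Finite := by
  refine ((F.finite_toSet.biUnion fun q _ => (M.finite_toSet.biUnion fun m _ =>
    support_indicator_cell_finite (q.1 + 1 + s) (cell s q.2.1 + m))).union
    (F.finite_toSet.biUnion fun q _ =>
      support_indicator_cell_finite (q.1 + 1 + s) (cell s q.2.1))).subset fun z hz => ?_
  rw [Function.mem_support] at hz
  by_contra h
  refine hz (Finset.sum_eq_zero fun m hm => Finset.sum_eq_zero fun q hq => ?_)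
  rw [Set.mem_union, not_or] at h
  have h1 : ¬ cell (q.1 + 1 + s) z = cell s q.2.1 + m := fun e =>
    h.1 (Set.mem_biUnion hq (Set.mem_biUnion hm e))
  have h2 : ¬ cell (q.1 + 1 + s) z = cell s q.2.1 := fun e => h.2 (Set.mem_biUnion hq e)
  rw [if_neg h1, if_neg h2, sub_zero, mul_zero]

lemma le_mul_of_sq_le {C : NNReal} {a b : ℝ≥0∞} (h : a ^ 2 ≤ C * b ^ 2) : a ≤ (C + 1) * b := by
  rw [← ENNReal.pow_le_pow_left_iff two_ne_zero, mul_pow]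
  refine h.trans (mul_le_mul_left ?_ _)
  norm_cast
  nlinarith [C.2, sq_nonneg C]

lemma seqNorm_ne_top_of_finite {X : Type*} {f : X → ℝ} (hf : f.support.Finite) {p : ℝ}
    (hp : 0 < p) : seqNorm p (fun x => ‖f x‖ₑ) ≠ ⊤ := by
  have h := Filt.seqNorm_enorm_sq_ne_top hf (r := p / 2) (by positivity)
  rw [seqNorm_sq (by positivity) (fun x => ‖f x‖ₑ), mul_div_cancel₀ _ two_ne_zero] at h
  exact fun e => h (by rw [e]; simp)

lemma enorm_abs_rpow_mul_sign (t : ℝ) {a : ℝ} (ha : 0 < a) :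
    ‖|t| ^ a * SignType.sign t‖ₑ = ‖t‖ₑ ^ a := by
  rw [enorm_mul, Real.enorm_rpow_of_nonneg (abs_nonneg t) ha.le, Real.enorm_abs]
  rcases lt_trichotomy t 0 with h | h | h
  · simp [h]
  · simp [h, ha]
  · simp [h]

/-- Passing from the adjoint estimate in `ℓ^q` to the estimate in `ℓ^p`. -/
lemma seqNorm_latOp_le_of_adj {p q : ℝ} (hpq : p.HolderConjugate q) {s : ℕ}
    (hF : ∀ q ∈ F, q.2.2 ≠ fun _ => false)
    (α : ℕ × (Fin n → ℤ) × (Fin n → Bool) → (Fin n → ℤ) → ℝ)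
    (c : ℕ × (Fin n → ℤ) × (Fin n → Bool) → ℝ) (M : Finset (Fin n → ℤ)) {D : ℝ≥0∞}
    (hD : ∀ g : (Fin n → ℤ) → ℝ, g.support.Finite →
      seqNorm q (fun z => ‖latSum F (adjCoeff s α M g) z‖ₑ) ≤ D * seqNorm q (fun z => ‖g z‖ₑ)) :
    seqNorm p (fun z => ‖latOp s F α c M z‖ₑ) ≤ D * seqNorm p (fun z => ‖latSum F c z‖ₑ) := by
  have hp1 := hpq.lt
  have hp0 := hpq.pos
  have hq0 := hpq.symm.pos
  have hfin := support_latOp_finite (F := F) s α c M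
  have hS : ∀ z, z ∉ hfin.toFinset → latOp s F α c M z = 0 := fun z hz => by
    simpa using hz
  generalize hΦ : latOp s F α c M = Φ at hfin hS
  obtain ⟨g, hg⟩ : ∃ g : (Fin n → ℤ) → ℝ, g = fun z => |Φ z| ^ (p - 1) * SignType.sign (Φ z) :=
    ⟨_, rfl⟩
  have hg0 : ∀ z, Φ z = 0 → g z = 0 := fun z h => by simp [hg, h]
  have hge : ∀ z, ‖g z‖ₑ = ‖Φ z‖ₑ ^ (p - 1) := fun z => by
    rw [hg]
    exact enorm_abs_rpow_mul_sign _ (by linarith)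
  have hgfin : g.support.Finite := hfin.subset fun z hz => by
    rw [Function.mem_support] at hz ⊢
    exact fun h => hz (hg0 z h)
  refine le_of_rpow_le_mul (r := p) (seqNorm_ne_top_of_finite hfin hp0) ?_
  have hΦg : ∑' z, ‖Φ z‖ₑ ^ p ≤ ∑' z, ‖latSum F c z‖ₑ * ‖latSum F (adjCoeff s α M g) z‖ₑ := by
    have e1 : ∑' z, ‖Φ z‖ₑ ^ p = ‖∑ z ∈ hfin.toFinset, Φ z * g z‖ₑ := by
      have hpos : ∀ z, Φ z * g z = |Φ z| ^ p := fun z => by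
        rw [hg]
        rcases eq_or_ne (Φ z) 0 with h | h
        · simp [h, hp0.ne']
        · have : |Φ z| ^ p = |Φ z| ^ (p - 1) * |Φ z| := by
            rw [← Real.rpow_add_one (abs_pos.2 h).ne', sub_add_cancel]
          rw [this, mul_left_comm, self_mul_sign]
      simp_rw [hpos]
      rw [Real.enorm_eq_ofReal (Finset.sum_nonneg fun z _ => by positivity),
        ENNReal.ofReal_sum_of_nonneg fun z _ => by positivity,
        tsum_eq_sum (s := hfin.toFinset) fun z hz => by rw [hS z hz]; simp [hp0]]
      refine Finset.sum_congr rfl fun z _ => ?_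
      rw [← Real.enorm_abs, Real.enorm_eq_ofReal (abs_nonneg _),
        ENNReal.ofReal_rpow_of_nonneg (abs_nonneg _) hp0.le]
    have e2 := sum_latOp_mul hF s α c M (g := g) (S := hfin.toFinset) fun z hz => hg0 z (hS z hz)
    rw [hΦ] at e2
    rw [e1, e2]
    exact (enorm_tsum_le_tsum_enorm).trans (ENNReal.tsum_le_tsum fun z => (enorm_mul _ _).le)
  have hgn : seqNorm q (fun z => ‖g z‖ₑ) = seqNorm p (fun z => ‖Φ z‖ₑ) ^ (p - 1) := by
    rw [seqNorm, seqNorm, ← ENNReal.rpow_mul]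
    simp_rw [hge, ← ENNReal.rpow_mul]
    have h1 : (p - 1) * q = p := hpq.sub_one_mul_conj
    have h2 : 1 / p * (p - 1) = 1 / q := by
      field_simp
      linarith
    rw [h1, h2]
  calc _ = ∑' z, ‖Φ z‖ₑ ^ p := seqNorm_rpow hp0 _
    _ ≤ seqNorm p (fun z => ‖latSum F c z‖ₑ) *
        seqNorm q (fun z => ‖latSum F (adjCoeff s α M g) z‖ₑ) :=
        hΦg.trans (tsum_mul_le_seqNorm hpq _ _)
    _ ≤ seqNorm p (fun z => ‖latSum F c z‖ₑ) * (D * seqNorm q (fun z => ‖g z‖ₑ)) :=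
        mul_le_mul_right (hD g hgfin) _
    _ = _ := by rw [hgn]; ring

/-- The lattice version of the `L^p` bound for `Φ̃_s`. -/
theorem seqNorm_latOp_le (hn : 0 < n) {p γ : ℝ} (hp : 1 < p) (hγ : 0 < γ) (hγ1 : γ ≤ 1) :
    ∃ C : NNReal, ∀ (s : ℕ) (A : ℝ≥0∞) (F : Finset (ℕ × (Fin n → ℤ) × (Fin n → Bool)))
      (α : ℕ × (Fin n → ℤ) × (Fin n → Bool) → (Fin n → ℤ) → ℝ)
      (c : ℕ × (Fin n → ℤ) × (Fin n → Bool) → ℝ) (M : Finset (Fin n → ℤ)),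
      (∀ q ∈ F, q.2.2 ≠ fun _ => false) → CoeffBound γ s A F α →
      seqNorm p (fun z => ‖latOp s F α c M z‖ₑ) ≤
        C * (A * ((s + 1) * 2 ^ (-(min γ (min (1 / 2) (1 - 1 / p)) * s)))) *
          seqNorm p (fun z => ‖latSum F c z‖ₑ) := by
  rcases le_or_gt 2 p with h2 | h2
  · obtain ⟨C, hC⟩ := seqNorm_latOp_sq_le hn (r := p / 2) hγ hγ1 (by linarith)
    refine ⟨C + 1, fun s A F α c M hF hα => ?_⟩
    have := hC s A F α c M _ (min_le_left _ _)
      ((min_le_right γ _).trans (min_le_left _ (1 - 1 / p)))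
      hF hα
    rw [seqNorm_sq (by positivity) fun z => ‖latOp s F α c M z‖ₑ,
      seqNorm_sq (by positivity) fun z => ‖latSum F c z‖ₑ, mul_div_cancel₀ _ two_ne_zero,
      ← mul_pow] at this
    refine (le_mul_of_sq_le this).trans_eq ?_
    push_cast
    ring
  · have hpq := Real.HolderConjugate.conjExponent hp
    generalize p.conjExponent = q at hpq
    have hinv : 1 - 1 / p = 1 / q := by
      have := hpq.inv_add_inv_eq_one
      rw [one_div, one_div]
      linarith
    have hq2 : 1 ≤ q / 2 := by
      have h3 : 1 / q ≤ 1 / 2 := by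
        rw [← hinv]
        have : 1 / 2 ≤ 1 / p := one_div_le_one_div_of_le (by linarith) h2.le
        linarith
      have := (one_div_le_one_div hpq.symm.pos two_pos).1 h3
      linarith
    obtain ⟨C, hC⟩ := seqNorm_adj_sq_le hn (r := q / 2) hγ hγ1 hq2
    refine ⟨C + 1, fun s A F α c M hF hα => ?_⟩
    refine seqNorm_latOp_le_of_adj hpq hF α c M fun g hg => ?_
    have := hC s A F α M g _ hg (min_le_left _ (min (1 / 2) (1 - 1 / p))) ?_ hF hα
    · rw [seqNorm_sq (by linarith) fun z => ‖latSum F (adjCoeff s α M g) z‖ₑ,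
        seqNorm_sq (by linarith) fun z => ‖g z‖ₑ, mul_div_cancel₀ _ two_ne_zero,
        ← mul_pow] at this
      refine (le_mul_of_sq_le this).trans_eq ?_
      push_cast
      ring
    · refine (min_le_right _ _).trans ((min_le_right _ _).trans_eq ?_)
      rw [hinv, mul_div_cancel₀ _ two_ne_zero]

end LatticeMain

section Discretization
variable {n : ℕ}

/-- The index of the dyadic cube of generation `N` containing `x`. -/
def gridIdx (N : ℤ) (x : Fin n → ℝ) : Fin n → ℤ := fun i => ⌊(2:ℝ) ^ N * x i⌋

lemma floor_zpow_sub (N : ℤ) (j : ℕ) (t : ℝ) :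
    ⌊(2:ℝ) ^ (N - j) * t⌋ = ⌊(2:ℝ) ^ N * t⌋ / 2 ^ j := by
  rw [zpow_sub₀ two_ne_zero, zpow_natCast, div_mul_eq_mul_div]
  have := Int.floor_div_natCast ((2:ℝ) ^ N * t) (2 ^ j)
  push_cast at this
  exact this

lemma mem_dyadicIco_iff (k w : ℤ) (t : ℝ) :
    t ∈ Set.Ico ((2:ℝ) ^ (-k) * w) ((2:ℝ) ^ (-k) * (w + 1)) ↔ ⌊(2:ℝ) ^ k * t⌋ = w := by
  have h : (0:ℝ) < 2 ^ k := by positivity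
  rw [Int.floor_eq_iff, Set.mem_Ico, zpow_neg, inv_mul_le_iff₀ h, lt_inv_mul_iff₀ h]

lemma haar1D_eq {N k : ℤ} {ν : ℕ} (h : k + 1 + ν = N) (w : ℤ) (η : Bool) (t : ℝ) :
    haar1D k w η t = (Real.sqrt ((2:ℝ) ^ (-k)))⁻¹ * latHaar1 ν w η ⌊(2:ℝ) ^ N * t⌋ := by
  have h0 : ⌊(2:ℝ) ^ N * t⌋ / 2 ^ (ν + 1) = ⌊(2:ℝ) ^ k * t⌋ := by
    rw [← floor_zpow_sub, ← h]
    congr 3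
    push_cast
    ring
  have h1 : ⌊(2:ℝ) ^ N * t⌋ / 2 ^ ν = ⌊(2:ℝ) ^ (k + 1) * t⌋ := by
    rw [← floor_zpow_sub, ← h, add_sub_cancel_right]
  have h2 : ⌊(2:ℝ) ^ (k + 1) * t⌋ / 2 = ⌊(2:ℝ) ^ k * t⌋ := by
    have := floor_zpow_sub (k + 1) 1 t
    rw [pow_one, Nat.cast_one, add_sub_cancel_right] at this
    exact this.symm
  have hz : (2:ℝ) ^ (-k) = 2 ^ (-(k + 1)) * 2 := by
    rw [neg_add, zpow_add₀ two_ne_zero, zpow_neg_one]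
    ring
  have e1 : (2:ℝ) ^ (-k) * w = 2 ^ (-(k + 1)) * ((2 * w : ℤ) : ℝ) := by
    rw [hz]; push_cast; ring
  have e2 : (2:ℝ) ^ (-k) * (w + 1 / 2) = 2 ^ (-(k + 1)) * (((2 * w : ℤ) : ℝ) + 1) := by
    rw [hz]; push_cast; ring
  have e2' : (2:ℝ) ^ (-k) * (w + 1 / 2) = 2 ^ (-(k + 1)) * ((2 * w + 1 : ℤ) : ℝ) := by
    rw [hz]; push_cast; ring
  have e3 : (2:ℝ) ^ (-k) * (w + 1) = 2 ^ (-(k + 1)) * (((2 * w + 1 : ℤ) : ℝ) + 1) := by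
    rw [hz]; push_cast; ring
  have m0 := mem_dyadicIco_iff k w t
  have m1 := mem_dyadicIco_iff (k + 1) (2 * w) t
  have m2 := mem_dyadicIco_iff (k + 1) (2 * w + 1) t
  rw [← e1, ← e2] at m1
  rw [← e2', ← e3] at m2
  rw [haar1D, latHaar1, h0, h1]
  congr 1
  cases η
  · simp only [Bool.false_eq_true, if_false, false_and, Set.indicator_apply, m0, Pi.one_apply]
  · simp only [if_true, true_and, Set.indicator_apply, m1, m2, Pi.one_apply]
    generalize ⌊(2:ℝ) ^ (k + 1) * t⌋ = b at *
    generalize ⌊(2:ℝ) ^ k * t⌋ = a at *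
    split_ifs <;> first | omega | simp

lemma haarFn_eq {N k : ℤ} {ν : ℕ} (h : k + 1 + ν = N) (w : Fin n → ℤ) (η : Fin n → Bool)
    (x : Fin n → ℝ) : haarFn n k w η x =
      (Real.sqrt ((2:ℝ) ^ (-k)))⁻¹ ^ n * latHaar (ν, w, η) (gridIdx N x) := by
  rw [haarFn, latHaar]
  simp_rw [haar1D_eq h]
  rw [Finset.prod_mul_distrib, Finset.prod_const, Finset.card_univ, Fintype.card_fin]
  rfl

lemma haarZero_eq {N k : ℤ} {ν : ℕ} (h : k + 1 + ν = N) (w : Fin n → ℤ) (x : Fin n → ℝ) :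
    haarZero n k w x = (Real.sqrt ((2:ℝ) ^ (-k)))⁻¹ ^ n *
      if cell (ν + 1) (gridIdx N x) = w then 1 else 0 := by
  rw [haarZero, haarFn_eq h, latHaar]
  congr 1
  simp only [latHaar1, Bool.false_eq_true, false_and, if_false]
  rw [Finset.prod_ite_zero]
  simp [funext_iff, cell]

lemma ancestorIdx_eq (s : ℕ) (w : Fin n → ℤ) : ancestorIdx s w = cell s w :=
  funext fun _ => Int.fdiv_eq_ediv_of_nonneg _ (by positivity)

lemma measurable_gridIdx (N : ℤ) : Measurable (gridIdx (n := n) N) :=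
  measurable_pi_lambda _ fun i => Int.measurable_floor.comp ((measurable_pi_apply i).const_mul _)

lemma map_gridIdx_singleton (N : ℤ) (z : Fin n → ℤ) :
    (volume.map (gridIdx (n := n) N)) {z} = ENNReal.ofReal (2 ^ (-N)) ^ n := by
  rw [Measure.map_apply (measurable_gridIdx N) (measurableSet_singleton z)]
  have : gridIdx N ⁻¹' {z} = Set.univ.pi fun i =>
      Set.Ico ((2:ℝ) ^ (-N) * z i) ((2:ℝ) ^ (-N) * (z i + 1)) := by
    ext x
    simp only [Set.mem_preimage, Set.mem_singleton_iff, Set.mem_univ_pi, mem_dyadicIco_iff,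
      funext_iff, gridIdx]
  rw [this, Real.volume_pi_Ico]
  simp [mul_add]

lemma lintegral_comp_gridIdx (N : ℤ) (U : (Fin n → ℤ) → ℝ≥0∞) :
    ∫⁻ x, U (gridIdx N x) = ENNReal.ofReal (2 ^ (-N)) ^ n * ∑' z, U z := by
  rw [← lintegral_map (μ := volume) (measurable_of_countable U) (measurable_gridIdx N),
    lintegral_countable', ← ENNReal.tsum_mul_left]
  simp_rw [map_gridIdx_singleton, mul_comm]

lemma integrable_comp_gridIdx (N : ℤ) {g : (Fin n → ℤ) → ℝ} (hg : g.support.Finite) :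
    Integrable (fun x => g (gridIdx N x)) := by
  refine ⟨((measurable_of_countable g).comp (measurable_gridIdx N)).aestronglyMeasurable, ?_⟩
  rw [HasFiniteIntegral, lintegral_comp_gridIdx N fun z => ‖g z‖ₑ]
  exact ENNReal.mul_lt_top (by finiteness) (Filt.tsum_enorm_ne_top hg).lt_top

lemma integral_comp_gridIdx (N : ℤ) {g : (Fin n → ℤ) → ℝ} (hg : g.support.Finite) :
    ∫ x, g (gridIdx N x) = (2 ^ (-N)) ^ n * ∑' z, g z := by
  have hm : AEStronglyMeasurable g (volume.map (gridIdx (n := n) N)) :=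
    (measurable_of_countable g).aestronglyMeasurable
  rw [← integral_map (measurable_gridIdx N).aemeasurable hm, integral_countable,
    ← tsum_mul_left]
  · refine tsum_congr fun z => ?_
    rw [Measure.real, map_gridIdx_singleton, smul_eq_mul, ENNReal.toReal_pow,
      ENNReal.toReal_ofReal (by positivity)]
  · rw [integrable_map_measure hm (measurable_gridIdx N).aemeasurable]
    exact integrable_comp_gridIdx N hg

lemma exists_scale (k : ℤ) {N : ℤ} (h : k < N) : ∃ ν : ℕ, k + 1 + ν = N :=
  ⟨(N - k - 1).toNat, by omega⟩

lemma support_latHaar_mul_finite (q q' : ℕ × (Fin n → ℤ) × (Fin n → Bool)) :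
    (fun z => latHaar q z * latHaar q' z).support.Finite :=
  (support_latHaar_finite q).subset fun z hz => by
    rw [Function.mem_support] at hz ⊢
    exact fun h => hz (by rw [h, zero_mul])

lemma haarFn_mul_haarFn {N k k' : ℤ} {ν ν' : ℕ} (h : k + 1 + ν = N) (h' : k' + 1 + ν' = N)
    (w w' : Fin n → ℤ) (η η' : Fin n → Bool) (x : Fin n → ℝ) :
    haarFn n k w η x * haarFn n k' w' η' x =
      ((Real.sqrt ((2:ℝ) ^ (-k)))⁻¹ ^ n * (Real.sqrt ((2:ℝ) ^ (-k')))⁻¹ ^ n) *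
        (latHaar (ν, w, η) (gridIdx N x) * latHaar (ν', w', η') (gridIdx N x)) := by
  rw [haarFn_eq h, haarFn_eq h']
  ring

lemma integrable_haarFn_mul (k k' : ℤ) (w w' : Fin n → ℤ) (η η' : Fin n → Bool) :
    Integrable (fun x => haarFn n k w η x * haarFn n k' w' η' x) := by
  obtain ⟨ν, hν⟩ := exists_scale k (N := max k k' + 1) (by omega)
  obtain ⟨ν', hν'⟩ := exists_scale k' (N := max k k' + 1) (by omega)
  simp_rw [haarFn_mul_haarFn hν hν']
  exact (integrable_comp_gridIdx _ (support_latHaar_mul_finite _ _)).const_mul _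

/-- The Haar functions are orthonormal. -/
lemma pairing_haarFn_haarFn {q q' : ℤ × (Fin n → ℤ) × (Fin n → Bool)}
    (hq : q.2.2 ≠ fun _ => false) (hq' : q'.2.2 ≠ fun _ => false) :
    pairing (haarFn n q.1 q.2.1 q.2.2) (haarFn n q'.1 q'.2.1 q'.2.2) =
      if q = q' then 1 else 0 := by
  obtain ⟨k, w, η⟩ := q
  obtain ⟨k', w', η'⟩ := q'
  obtain ⟨N, hN⟩ : ∃ N, N = max k k' + 1 := ⟨_, rfl⟩
  obtain ⟨ν, hν⟩ := exists_scale k (N := N) (by omega)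
  obtain ⟨ν', hν'⟩ := exists_scale k' (N := N) (by omega)
  rw [pairing]
  simp_rw [haarFn_mul_haarFn hν hν']
  rw [integral_const_mul, integral_comp_gridIdx N (support_latHaar_mul_finite _ _),
    tsum_latHaar_mul_latHaar hq hq']
  by_cases h : k = k' ∧ w = w' ∧ η = η'
  · obtain ⟨rfl, rfl, rfl⟩ := h
    obtain rfl : ν = ν' := by omega
    rw [if_pos rfl, if_pos rfl, ← mul_pow, ← mul_inv, Real.mul_self_sqrt (by positivity),
      pow_mul, ← mul_pow, ← mul_pow, ← zpow_natCast (2:ℝ) (ν + 1), ← zpow_neg,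
      ← zpow_add₀ two_ne_zero, ← zpow_add₀ two_ne_zero]
    rw [show - -k + (-N + ((ν + 1 : ℕ) : ℤ)) = 0 by push_cast; omega]
    simp
  · rw [if_neg, if_neg]
    · simp
    · simpa only [Prod.mk.injEq] using h
    · simp only [Prod.mk.injEq]
      exact fun h' => h ⟨by omega, h'.2⟩

end Discretization

lemma seqNorm_tsum_real_le {X ι : Type*} {p : ℝ} (hp : 0 < p) (V : ι → X → ℝ) {B : ℝ≥0∞}
    (h : ∀ M : Finset ι, seqNorm p (fun z => ‖∑ m ∈ M, V m z‖ₑ) ≤ B) :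
    seqNorm p (fun z => ‖∑' m, V m z‖ₑ) ≤ B := by
  classical
  rw [seqNorm_le_iff hp]
  rw [ENNReal.tsum_eq_iSup_sum]
  refine iSup_le fun Z => ?_
  rw [← Finset.sum_filter_add_sum_filter_not Z (fun z => Summable fun m => V m z)]
  rw [Finset.sum_eq_zero (s := Z.filter fun z => ¬ Summable fun m => V m z) fun z hz => by
    rw [tsum_eq_zero_of_not_summable (Finset.mem_filter.1 hz).2]; simp [hp], add_zero]
  have ht : Filter.Tendsto (fun M : Finset ι => ∑ z ∈ Z.filter (fun z => Summable fun m => V m z),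
      ‖∑ m ∈ M, V m z‖ₑ ^ p) Filter.atTop
      (nhds (∑ z ∈ Z.filter (fun z => Summable fun m => V m z), ‖∑' m, V m z‖ₑ ^ p)) := by
    refine tendsto_finsetSum _ fun z hz => ?_
    have h1 : Filter.Tendsto (fun M : Finset ι => ∑ m ∈ M, V m z) Filter.atTop
      (nhds (∑' m, V m z)) := (Finset.mem_filter.1 hz).2.hasSum
    exact (ENNReal.continuous_rpow_const.comp continuous_enorm).continuousAt.tendsto.comp h1
  exact le_of_tendsto' ht fun M =>
    (ENNReal.sum_le_tsum _).trans ((seqNorm_le_iff hp _ _).1 (h M))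

section Reduction
variable {n : ℕ}

/-- The matrix coefficient `⟨h⁰_{I^{(s)}∔m}, T h^η_I⟩`. -/
def haarCoeff (K : (Fin n → ℝ) → (Fin n → ℝ) → ℝ) (s : ℕ)
    (q : ℤ × (Fin n → ℤ) × (Fin n → Bool)) (m : Fin n → ℤ) : ℝ :=
  pairing (haarZero n (q.1 - s) (ancestorIdx s q.2.1 + m))
    (czIntegral K (haarFn n q.1 q.2.1 q.2.2))

lemma pairing_haarFn_sum {F : Finset (ℤ × (Fin n → ℤ) × (Fin n → Bool))}
    (hF : ∀ q ∈ F, q.2.2 ≠ fun _ => false) (c : ℤ × (Fin n → ℤ) × (Fin n → Bool) → ℝ)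
    {q : ℤ × (Fin n → ℤ) × (Fin n → Bool)} (hq : q.2.2 ≠ fun _ => false) :
    pairing (haarFn n q.1 q.2.1 q.2.2) (fun x => ∑ q ∈ F, c q * haarFn n q.1 q.2.1 q.2.2 x) =
      if q ∈ F then c q else 0 := by
  rw [pairing]
  simp_rw [Finset.mul_sum, mul_left_comm _ (c _)]
  rw [integral_finsetSum _ fun q' _ => (integrable_haarFn_mul _ _ _ _ _ _).const_mul _]
  simp_rw [integral_const_mul]
  have : ∀ q' ∈ F, c q' * ∫ x, haarFn n q.1 q.2.1 q.2.2 x * haarFn n q'.1 q'.2.1 q'.2.2 x =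
      if q = q' then c q' else 0 := fun q' hq' => by
    have := pairing_haarFn_haarFn hq (hF q' hq')
    rw [pairing] at this
    rw [this, mul_ite, mul_one, mul_zero]
  rw [Finset.sum_congr rfl this, Finset.sum_ite_eq]

lemma phiTildeNZ_eq (K : (Fin n → ℝ) → (Fin n → ℝ) → ℝ) (s : ℕ)
    {F : Finset (ℤ × (Fin n → ℤ) × (Fin n → Bool))} (hF : ∀ q ∈ F, q.2.2 ≠ fun _ => false)
    (c : ℤ × (Fin n → ℤ) × (Fin n → Bool) → ℝ) (x : Fin n → ℝ) :
    PhiTildeNZ n K s (fun x => ∑ q ∈ F, c q * haarFn n q.1 q.2.1 q.2.2 x) x =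
      ∑' m, if m = 0 then 0 else ∑ q ∈ F,
        (haarZero n (q.1 - s) (ancestorIdx s q.2.1 + m) x -
          haarZero n (q.1 - s) (ancestorIdx s q.2.1) x) * haarCoeff K s q m * c q := by
  classical
  rw [PhiTildeNZ]
  refine tsum_congr fun m => ?_
  by_cases hm : m = 0
  · simp [hm]
  simp only [hm, false_or, if_false]
  generalize hH : (fun q : ℤ × (Fin n → ℤ) × (Fin n → Bool) =>
    (haarZero n (q.1 - s) (ancestorIdx s q.2.1 + m) x -
      haarZero n (q.1 - s) (ancestorIdx s q.2.1) x) * haarCoeff K s q m) = H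
  have hη : ∀ η : Fin n → Bool, (if η = (fun _ => false) then 0 else ∑' (k : ℤ) (w : Fin n → ℤ),
      (haarZero n (k - s) (ancestorIdx s w + m) x - haarZero n (k - s) (ancestorIdx s w) x) *
        pairing (haarZero n (k - s) (ancestorIdx s w + m)) (czIntegral K (haarFn n k w η)) *
        pairing (haarFn n k w η) (fun x => ∑ q ∈ F, c q * haarFn n q.1 q.2.1 q.2.2 x)) =
      ∑ k ∈ F.image (fun q => q.1), ∑ w ∈ F.image (fun q => q.2.1),
        if (k, w, η) ∈ F then H (k, w, η) * c (k, w, η) else 0 := by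
    intro η
    split_ifs with hη
    · refine (Finset.sum_eq_zero fun k _ => Finset.sum_eq_zero fun w _ => if_neg fun h => ?_).symm
      exact hF _ h hη
    · have e : ∀ k w, (haarZero n (k - s) (ancestorIdx s w + m) x -
            haarZero n (k - s) (ancestorIdx s w) x) *
          pairing (haarZero n (k - s) (ancestorIdx s w + m)) (czIntegral K (haarFn n k w η)) *
          pairing (haarFn n k w η) (fun x => ∑ q ∈ F, c q * haarFn n q.1 q.2.1 q.2.2 x) =
          if (k, w, η) ∈ F then H (k, w, η) * c (k, w, η) else 0 := fun k w => by
        rw [pairing_haarFn_sum hF c (q := (k, w, η)) hη, mul_ite, mul_zero, ← hH]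
        rfl
      simp_rw [e]
      rw [tsum_eq_sum (s := F.image (fun q => q.1))]
      · refine Finset.sum_congr rfl fun k _ => tsum_eq_sum fun w hw => if_neg fun h => ?_
        exact hw (Finset.mem_image_of_mem (fun q => q.2.1) h)
      · intro k hk
        exact (tsum_congr fun w => if_neg fun h => hk (Finset.mem_image_of_mem
          (f := fun q : ℤ × (Fin n → ℤ) × (Fin n → Bool) => q.1) h)).trans tsum_zero
  simp_rw [hη]
  have hs : F ⊆ (F.image fun q => q.1) ×ˢ
      ((F.image fun q => q.2.1) ×ˢ Finset.univ) := fun q hq => by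
    simp only [Finset.mem_product, Finset.mem_univ, and_true]
    exact ⟨Finset.mem_image_of_mem _ hq, Finset.mem_image_of_mem (fun q => q.2.1) hq⟩
  calc _ = ∑ q ∈ (F.image fun q => q.1) ×ˢ ((F.image fun q => q.2.1) ×ˢ Finset.univ),
        if q ∈ F then H q * c q else 0 := by
        rw [Finset.sum_product, Finset.sum_comm]
        refine Finset.sum_congr rfl fun k _ => ?_
        rw [Finset.sum_product, Finset.sum_comm]
    _ = ∑ q ∈ F, H q * c q := by
        rw [← Finset.sum_filter, Finset.filter_mem_eq_inter, Finset.inter_eq_right.2 hs]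
    _ = _ := by rw [← hH]

/-- The normalising factor `|I|^{-1/2}` for a cube of generation `k`. -/
def haarScale (n : ℕ) (k : ℤ) : ℝ := (Real.sqrt ((2:ℝ) ^ (-k)))⁻¹ ^ n

lemma haarScale_pos (k : ℤ) : 0 < haarScale n k := by
  unfold haarScale
  positivity

/-- The position on the generation-`N` lattice of a dyadic cube. -/
def ofLattice (N : ℤ) (q : ℕ × (Fin n → ℤ) × (Fin n → Bool)) :
    ℤ × (Fin n → ℤ) × (Fin n → Bool) := (N - 1 - q.1, q.2)

lemma ofLattice_injective (N : ℤ) : Function.Injective (ofLattice (n := n) N) := fun a b h => by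
  simp only [ofLattice, Prod.mk.injEq] at h
  exact Prod.ext (by omega) h.2

/-- The coefficients of `Φ̃_s` on the generation-`N` lattice. -/
def latCoeff (K : (Fin n → ℝ) → (Fin n → ℝ) → ℝ) (s : ℕ) (N : ℤ)
    (q : ℕ × (Fin n → ℤ) × (Fin n → Bool)) (m : Fin n → ℤ) : ℝ :=
  if m = 0 then 0 else haarCoeff K s (ofLattice N q) m *
    (haarScale n ((ofLattice N q).1 - s) / haarScale n (ofLattice N q).1)

lemma eLpNorm_comp_gridIdx (N : ℤ) {p : ℝ} (hp : 0 < p) (g : (Fin n → ℤ) → ℝ) :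
    eLpNorm (fun x => g (gridIdx N x)) (ENNReal.ofReal p) volume =
      (ENNReal.ofReal (2 ^ (-N)) ^ n) ^ (1 / p) * seqNorm p (fun z => ‖g z‖ₑ) := by
  rw [eLpNorm_eq_lintegral_rpow_enorm_toReal (by simpa using hp) ENNReal.ofReal_ne_top,
    ENNReal.toReal_ofReal hp.le, lintegral_comp_gridIdx N fun z => ‖g z‖ₑ ^ p, seqNorm,
    ENNReal.mul_rpow_of_nonneg _ _ (by positivity)]

lemma eLpNorm_comp_gridIdx_le (N : ℤ) {p : ℝ} (hp : 0 < p) {g h : (Fin n → ℤ) → ℝ} {B : ℝ≥0∞}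
    (hgh : seqNorm p (fun z => ‖g z‖ₑ) ≤ B * seqNorm p (fun z => ‖h z‖ₑ)) :
    eLpNorm (fun x => g (gridIdx N x)) (ENNReal.ofReal p) volume ≤
      B * eLpNorm (fun x => h (gridIdx N x)) (ENNReal.ofReal p) volume := by
  rw [eLpNorm_comp_gridIdx N hp, eLpNorm_comp_gridIdx N hp, mul_left_comm]
  exact mul_le_mul_right hgh _

/-- The continuous estimate follows from the estimate of the matrix coefficients. -/
theorem eLpNorm_phiTildeNZ_le (hn : 0 < n) {p γ : ℝ} (hp : 1 < p) (hγ : 0 < γ) (hγ1 : γ ≤ 1) :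
    ∃ C : NNReal, ∀ (K : (Fin n → ℝ) → (Fin n → ℝ) → ℝ) (s : ℕ) (A : ℝ≥0∞)
      (F : Finset (ℤ × (Fin n → ℤ) × (Fin n → Bool)))
      (c : ℤ × (Fin n → ℤ) × (Fin n → Bool) → ℝ), (∀ q ∈ F, q.2.2 ≠ fun _ => false) →
      (∀ (N : ℤ) (G : Finset (ℕ × (Fin n → ℤ) × (Fin n → Bool))),
        (∀ q ∈ G, q.2.2 ≠ fun _ => false) → CoeffBound γ s A G (latCoeff K s N)) →
      eLpNorm (PhiTildeNZ n K s fun x => ∑ q ∈ F, c q * haarFn n q.1 q.2.1 q.2.2 x)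
          (ENNReal.ofReal p) volume ≤
        C * (A * ((s + 1) * 2 ^ (-(min γ (min (1 / 2) (1 - 1 / p)) * s)))) *
          eLpNorm (fun x => ∑ q ∈ F, c q * haarFn n q.1 q.2.1 q.2.2 x)
            (ENNReal.ofReal p) volume := by
  have hp0 : 0 < p := by linarith
  obtain ⟨C, hC⟩ := seqNorm_latOp_le hn hp hγ hγ1
  refine ⟨C, fun K s A F c hF hα => ?_⟩
  obtain ⟨N, hN⟩ : ∃ N : ℤ, ∀ q ∈ F, q.1 < N := by
    obtain ⟨B, hB⟩ := (F.image fun q => q.1).bddAbove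
    exact ⟨B + 1, fun q hq => Int.lt_add_one_of_le
      (hB (Finset.mem_coe.2 (Finset.mem_image_of_mem (fun q => q.1) hq)))⟩
  obtain ⟨G, hG⟩ : ∃ G, G = F.preimage (ofLattice N) (ofLattice_injective N).injOn := ⟨_, rfl⟩
  have hsum : ∀ H : ℤ × (Fin n → ℤ) × (Fin n → Bool) → ℝ,
      ∑ q ∈ F, H q = ∑ q ∈ G, H (ofLattice N q) := fun H => by
    rw [hG, Finset.sum_preimage]
    intro q hq hr
    obtain ⟨ν, hν⟩ := exists_scale q.1 (hN q hq)
    exact absurd ⟨(ν, q.2), Prod.ext (by simp only [ofLattice]; omega) rfl⟩ hr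
  have hGF : ∀ q ∈ G, q.2.2 ≠ fun _ => false := fun q hq => by
    rw [hG, Finset.mem_preimage] at hq
    exact hF _ hq
  obtain ⟨d, hd⟩ : ∃ d : ℕ × (Fin n → ℤ) × (Fin n → Bool) → ℝ,
    d = fun q => c (ofLattice N q) * haarScale n (ofLattice N q).1 := ⟨_, rfl⟩
  have hf : (fun x => ∑ q ∈ F, c q * haarFn n q.1 q.2.1 q.2.2 x) =
      fun x => latSum G d (gridIdx N x) := by
    clear hα hC
    funext x
    rw [hsum fun q => c q * haarFn n q.1 q.2.1 q.2.2 x, latSum]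
    refine Finset.sum_congr rfl fun q _ => ?_
    rw [haarFn_eq (N := N) (ν := q.1) (by simp only [ofLattice]; omega), hd]
    simp only [haarScale]
    rw [mul_assoc]
    rfl
  have hm : ∀ m x, (if m = 0 then 0 else ∑ q ∈ F,
        (haarZero n (q.1 - s) (ancestorIdx s q.2.1 + m) x -
          haarZero n (q.1 - s) (ancestorIdx s q.2.1) x) * haarCoeff K s q m * c q) =
      ∑ q ∈ G, latCoeff K s N q m * d q *
        ((if cell (q.1 + 1 + s) (gridIdx N x) = cell s q.2.1 + m then 1 else 0) -
          if cell (q.1 + 1 + s) (gridIdx N x) = cell s q.2.1 then 1 else 0) := by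
    intro m x
    by_cases h : m = 0
    · simp [h, latCoeff]
    rw [if_neg h, hsum]
    refine Finset.sum_congr rfl fun q _ => ?_
    clear hα hC hf
    have e : ∀ u, haarZero n ((ofLattice N q).1 - s) u x = haarScale n ((ofLattice N q).1 - s) *
        if cell (q.1 + 1 + s) (gridIdx N x) = u then 1 else 0 := fun u => by
      rw [haarZero_eq (N := N) (ν := q.1 + s) (by simp only [ofLattice]; push_cast; ring),
        add_right_comm]
      rfl
    rw [e, e, ancestorIdx_eq, latCoeff, if_neg h, hd]
    have := (haarScale_pos (n := n) (ofLattice N q).1).ne'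
    have h2 : (ofLattice N q).2 = q.2 := rfl
    rw [h2]
    generalize (if cell (q.1 + 1 + s) (gridIdx N x) = cell s q.2.1 + m then (1:ℝ) else 0) = u
    generalize (if cell (q.1 + 1 + s) (gridIdx N x) = cell s q.2.1 then (1:ℝ) else 0) = v
    generalize haarCoeff K s (ofLattice N q) m = a
    field_simp
  have hΦ : PhiTildeNZ n K s (fun x => ∑ q ∈ F, c q * haarFn n q.1 q.2.1 q.2.2 x) =
      fun x => ∑' m, ∑ q ∈ G, latCoeff K s N q m * d q *
        ((if cell (q.1 + 1 + s) (gridIdx N x) = cell s q.2.1 + m then 1 else 0) -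
          if cell (q.1 + 1 + s) (gridIdx N x) = cell s q.2.1 then 1 else 0) := by
    funext x
    rw [phiTildeNZ_eq K s hF]
    exact tsum_congr fun m => hm m x
  have hb := seqNorm_tsum_real_le hp0 _ fun M => hC s A G (latCoeff K s N) d M hGF (hα N G hGF)
  clear hm hα hC hsum
  rw [hΦ, hf]
  have hfin := eLpNorm_comp_gridIdx_le N hp0 hb
  exact hfin

end Reduction

section Radial
variable {n : ℕ}

lemma lintegral_fun_norm_eq (hn : 0 < n) {f : ℝ → ℝ} (hf : ∀ y, 0 ≤ f y)
    (hi : IntegrableOn (fun y : ℝ => y ^ (n - 1) * f y) (Set.Ioi 0)) :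
    ∫⁻ x : Fin n → ℝ, ENNReal.ofReal (f ‖x‖) =
      ENNReal.ofReal (n * (volume.real (Metric.ball (0 : Fin n → ℝ) 1) *
        ∫ y in Set.Ioi (0:ℝ), y ^ (n - 1) * f y)) := by
  have : Nonempty (Fin n) := ⟨⟨0, hn⟩⟩
  have hd : Module.finrank ℝ (Fin n → ℝ) = n := by simp
  have h1 : Integrable (fun x : Fin n → ℝ => f ‖x‖) := by
    rw [integrable_fun_norm_addHaar, hd]
    exact hi
  rw [← ofReal_integral_eq_lintegral_ofReal h1 (.of_forall fun x => hf _),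
    integral_fun_norm_addHaar, hd, nsmul_eq_mul, smul_eq_mul]
  rfl

lemma lintegral_norm_rpow_far (hn : 0 < n) {γ : ℝ} (hγ : 0 < γ) :
    ∃ C : NNReal, ∀ R : ℝ, 0 < R → ∀ c : Fin n → ℝ,
      ∫⁻ x in {x | R < ‖x - c‖}, ENNReal.ofReal (‖x - c‖ ^ (-(n:ℝ) - γ)) ≤
        C * ENNReal.ofReal (R ^ (-γ)) := by
  refine ⟨(n * (volume.real (Metric.ball (0 : Fin n → ℝ) 1) * γ⁻¹)).toNNReal,
    fun R hR c => ?_⟩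
  have hm : MeasurableSet {x : Fin n → ℝ | R < ‖x‖} :=
    measurableSet_lt measurable_const measurable_norm
  have hm' : MeasurableSet {x : Fin n → ℝ | R < ‖x - c‖} :=
    measurableSet_lt measurable_const (measurable_id.sub_const c).norm
  have e : ∀ y ∈ Set.Ioi (0:ℝ), y ^ (n - 1) * (Set.Ioi R).indicator (· ^ (-(n:ℝ) - γ)) y =
      (Set.Ioi R).indicator (· ^ (-1 - γ)) y := fun y hy => by
    have hy : 0 < y := hy
    by_cases h : y ∈ Set.Ioi R
    · rw [Set.indicator_of_mem h, Set.indicator_of_mem h, ← Real.rpow_natCast,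
        ← Real.rpow_add hy, Nat.cast_sub hn]
      congr 1
      push_cast
      ring
    · rw [Set.indicator_of_notMem h, Set.indicator_of_notMem h, mul_zero]
  have hsub : Set.Ioi (0:ℝ) ∩ Set.Ioi R = Set.Ioi R :=
    Set.inter_eq_right.2 (Set.Ioi_subset_Ioi hR.le)
  have hi : IntegrableOn (fun y : ℝ => y ^ (n - 1) *
      (Set.Ioi R).indicator (· ^ (-(n:ℝ) - γ)) y) (Set.Ioi 0) := by
    rw [integrableOn_congr_fun e measurableSet_Ioi, IntegrableOn,
      integrable_indicator_iff measurableSet_Ioi, IntegrableOn,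
      Measure.restrict_restrict measurableSet_Ioi, Set.inter_comm, hsub]
    exact integrableOn_Ioi_rpow_of_lt (by linarith) hR
  have h0 : ∀ y, 0 ≤ (Set.Ioi R).indicator (fun y : ℝ => y ^ (-(n:ℝ) - γ)) y := fun y =>
    Set.indicator_apply_nonneg fun hy => Real.rpow_nonneg (hR.le.trans (le_of_lt hy)) _
  have key := lintegral_fun_norm_eq hn h0 hi
  rw [setIntegral_congr_fun measurableSet_Ioi e, setIntegral_indicator measurableSet_Ioi, hsub,
    integral_Ioi_rpow_of_lt (by linarith) hR] at key
  rw [← lintegral_indicator hm']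
  have e2 : ∀ x : Fin n → ℝ, {x | R < ‖x - c‖}.indicator
      (fun x => ENNReal.ofReal (‖x - c‖ ^ (-(n:ℝ) - γ))) x =
      (fun x : Fin n → ℝ => ENNReal.ofReal
        ((Set.Ioi R).indicator (fun y : ℝ => y ^ (-(n:ℝ) - γ)) ‖x‖)) (x - c) := fun x => by
    by_cases h : R < ‖x - c‖
    · rw [Set.indicator_of_mem (by exact h)]
      simp only [Set.indicator_of_mem (show ‖x - c‖ ∈ Set.Ioi R from h)]
    · rw [Set.indicator_of_notMem (by exact h)]
      simp only [Set.indicator_of_notMem (show ‖x - c‖ ∉ Set.Ioi R from h), ENNReal.ofReal_zero]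
  simp_rw [e2]
  rw [lintegral_sub_right_eq_self (fun x : Fin n → ℝ => ENNReal.ofReal
        ((Set.Ioi R).indicator (fun y : ℝ => y ^ (-(n:ℝ) - γ)) ‖x‖)) c, key,
    ← ENNReal.ofReal_coe_nnreal, Real.coe_toNNReal _ (by positivity),
    ← ENNReal.ofReal_mul (by positivity)]
  refine ENNReal.ofReal_le_ofReal (le_of_eq ?_)
  rw [show -1 - γ + 1 = -γ by ring]
  field_simp

lemma lintegral_norm_rpow_near (hn : 0 < n) :
    ∃ C : NNReal, ∀ R : ℝ, 0 < R →
      ∫⁻ x in {x : Fin n → ℝ | ‖x‖ ≤ R}, ENNReal.ofReal (‖x‖ ^ (1 - (n:ℝ))) ≤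
        C * ENNReal.ofReal R := by
  refine ⟨(n * (volume.real (Metric.ball (0 : Fin n → ℝ) 1))).toNNReal, fun R hR => ?_⟩
  have hm : MeasurableSet {x : Fin n → ℝ | ‖x‖ ≤ R} :=
    measurableSet_le measurable_norm measurable_const
  have e : ∀ y ∈ Set.Ioi (0:ℝ), y ^ (n - 1) * (Set.Icc 0 R).indicator (· ^ (1 - (n:ℝ))) y =
      (Set.Icc 0 R).indicator 1 y := fun y hy => by
    have hy : 0 < y := hy
    by_cases h : y ∈ Set.Icc 0 R
    · rw [Set.indicator_of_mem h, Set.indicator_of_mem h, ← Real.rpow_natCast,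
        ← Real.rpow_add hy, Nat.cast_sub hn]
      simp
    · rw [Set.indicator_of_notMem h, Set.indicator_of_notMem h, mul_zero]
  have hsub : Set.Ioi (0:ℝ) ∩ Set.Icc 0 R = Set.Ioc 0 R := by
    ext y
    simp only [Set.mem_inter_iff, Set.mem_Ioi, Set.mem_Icc, Set.mem_Ioc]
    exact ⟨fun h => ⟨h.1, h.2.2⟩, fun h => ⟨h.1, h.1.le, h.2⟩⟩
  have hi : IntegrableOn (fun y : ℝ => y ^ (n - 1) *
      (Set.Icc 0 R).indicator (· ^ (1 - (n:ℝ))) y) (Set.Ioi 0) := by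
    rw [integrableOn_congr_fun e measurableSet_Ioi, IntegrableOn,
      integrable_indicator_iff measurableSet_Icc, IntegrableOn,
      Measure.restrict_restrict measurableSet_Icc, Set.inter_comm, hsub]
    exact integrableOn_const (by simp)
  have h0 : ∀ y, 0 ≤ (Set.Icc 0 R).indicator (fun y : ℝ => y ^ (1 - (n:ℝ))) y := fun y =>
    Set.indicator_apply_nonneg fun hy => Real.rpow_nonneg hy.1 _
  have key := lintegral_fun_norm_eq hn h0 hi
  rw [setIntegral_congr_fun measurableSet_Ioi e, setIntegral_indicator measurableSet_Icc, hsub]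
    at key
  rw [← lintegral_indicator hm]
  have e2 : ∀ x : Fin n → ℝ, {x | ‖x‖ ≤ R}.indicator
      (fun x => ENNReal.ofReal (‖x‖ ^ (1 - (n:ℝ)))) x =
      ENNReal.ofReal ((Set.Icc 0 R).indicator (fun y : ℝ => y ^ (1 - (n:ℝ))) ‖x‖) := fun x => by
    by_cases h : ‖x‖ ≤ R
    · rw [Set.indicator_of_mem (by exact h),
        Set.indicator_of_mem (show ‖x‖ ∈ Set.Icc 0 R from ⟨norm_nonneg _, h⟩)]
    · rw [Set.indicator_of_notMem (by exact h),
        Set.indicator_of_notMem (show ‖x‖ ∉ Set.Icc 0 R from fun h' => h h'.2), ENNReal.ofReal_zero]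
  simp_rw [e2]
  rw [key, ← ENNReal.ofReal_coe_nnreal, Real.coe_toNNReal _ (by positivity),
    ← ENNReal.ofReal_mul (by positivity)]
  refine ENNReal.ofReal_le_ofReal (le_of_eq ?_)
  simp only [Pi.one_apply, integral_const, smul_eq_mul, mul_one, measureReal_restrict_apply_univ,
    Real.volume_real_Ioc, sub_zero, max_eq_left hR.le]
  ring

end Radial

section Overlap
variable {n : ℕ}

lemma volume_box_inter_shift_compl_le (a h : Fin n → ℝ) (l : ℝ) :
    volume {y : Fin n → ℝ | y ∈ Set.univ.pi (fun i => Set.Ico (a i) (a i + l)) ∧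
      h + y ∉ Set.univ.pi (fun i => Set.Ico (a i) (a i + l))} ≤
      n * (ENNReal.ofReal ‖h‖ * ENNReal.ofReal l ^ (n - 1)) := by
  classical
  obtain ⟨S, hS⟩ : ∃ S : Fin n → Set ℝ, S = fun i => if 0 ≤ h i then
    Set.Ico (a i + l - h i) (a i + l) else Set.Ico (a i) (a i - h i) := ⟨_, rfl⟩
  have hsub : {y : Fin n → ℝ | y ∈ Set.univ.pi (fun i => Set.Ico (a i) (a i + l)) ∧
      h + y ∉ Set.univ.pi (fun i => Set.Ico (a i) (a i + l))} ⊆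
      ⋃ i, Set.univ.pi (Function.update (fun i => Set.Ico (a i) (a i + l)) i (S i)) := by
    rintro y ⟨hy, hy'⟩
    simp only [Set.mem_univ_pi, not_forall] at hy hy'
    obtain ⟨i, hi⟩ := hy'
    refine Set.mem_iUnion.2 ⟨i, Set.mem_univ_pi.2 fun j => ?_⟩
    by_cases hj : j = i
    · subst hj
      rw [Function.update_self, hS]
      have h1 := hy j
      simp only [Pi.add_apply, Set.mem_Ico, not_and_or, not_le, not_lt] at hi h1 ⊢
      split_ifs with h0
      · exact ⟨by rcases hi with hi | hi <;> linarith, h1.2⟩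
      · exact ⟨h1.1, by rcases hi with hi | hi <;> linarith⟩
    · rw [Function.update_of_ne hj]
      exact hy j
  refine (measure_mono hsub).trans ((measure_iUnion_le _).trans ?_)
  rw [tsum_fintype]
  refine (Finset.sum_le_card_nsmul _ _ (ENNReal.ofReal ‖h‖ * ENNReal.ofReal l ^ (n - 1))
    fun i _ => ?_).trans (by rw [Finset.card_univ, Fintype.card_fin, nsmul_eq_mul])
  rw [volume_pi_pi]
  have e : ∀ j, volume (Function.update (fun i => Set.Ico (a i) (a i + l)) i (S i) j) =
      Function.update (fun _ => ENNReal.ofReal l) i (volume (S i)) j := fun j => by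
    by_cases hj : j = i
    · subst hj; simp
    · simp [Function.update_of_ne hj]
  simp_rw [e]
  rw [Finset.prod_update_of_mem (Finset.mem_univ i), Finset.prod_const]
  refine mul_le_mul' ?_ (le_of_eq ?_)
  · rw [hS]
    have := norm_le_pi_norm h i
    rw [Real.norm_eq_abs] at this
    simp only
    split_ifs with h0
    · rw [Real.volume_Ico]
      exact ENNReal.ofReal_le_ofReal (by linarith [le_abs_self (h i)])
    · rw [Real.volume_Ico]
      exact ENNReal.ofReal_le_ofReal (by linarith [neg_le_abs (h i)])
  · rw [Finset.card_sdiff]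
    simp

lemma lintegral_lintegral_norm_sub_le (hn : 0 < n) :
    ∃ C : NNReal, ∀ (a : Fin n → ℝ) (l : ℝ), 0 < l → ∀ (B S : Set (Fin n → ℝ)),
      B = Set.univ.pi (fun i => Set.Ico (a i) (a i + l)) → MeasurableSet S →
      (∀ x ∈ S, x ∉ B) → (∀ x ∈ S, ∀ y ∈ B, ‖x - y‖ ≤ 2 * l) →
      ∫⁻ x in S, ∫⁻ y in B, ENNReal.ofReal (‖x - y‖ ^ (-(n:ℝ))) ≤ C * ENNReal.ofReal l ^ n := by
  obtain ⟨C, hC⟩ := lintegral_norm_rpow_near hn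
  refine ⟨n * (C * 2), fun a l hl B S hB hS hSB hd => ?_⟩
  have hBm : MeasurableSet B := by
    rw [hB]
    exact MeasurableSet.univ_pi fun i => measurableSet_Ico
  obtain ⟨φ, hφ⟩ : ∃ φ : (Fin n → ℝ) → ℝ≥0∞, φ = fun x => ENNReal.ofReal (‖x‖ ^ (-(n:ℝ))) :=
    ⟨_, rfl⟩
  have hφm : Measurable φ := by
    rw [hφ]
    exact (measurable_norm.pow_const _).ennreal_ofReal
  have hSi : Measurable (S.indicator (1 : (Fin n → ℝ) → ℝ≥0∞)) := measurable_one.indicator hS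
  have hBi : Measurable (B.indicator (1 : (Fin n → ℝ) → ℝ≥0∞)) := measurable_one.indicator hBm
  have e : ∫⁻ x in S, ∫⁻ y in B, ENNReal.ofReal (‖x - y‖ ^ (-(n:ℝ))) =
      ∫⁻ x, ∫⁻ y, S.indicator 1 x * B.indicator 1 y * φ (x - y) := by
    rw [← lintegral_indicator hS]
    refine lintegral_congr fun x => ?_
    by_cases hx : x ∈ S
    · rw [Set.indicator_of_mem hx, ← lintegral_indicator hBm]
      refine lintegral_congr fun y => ?_
      rw [Set.indicator_of_mem hx]
      by_cases hy : y ∈ B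
      · simp [hy, hφ]
      · simp [hy]
    · simp [hx]
  calc _ = ∫⁻ x, ∫⁻ y, S.indicator 1 x * B.indicator 1 y * φ (x - y) := e
    _ = ∫⁻ y, ∫⁻ x, S.indicator 1 x * B.indicator 1 y * φ (x - y) := by
        refine lintegral_lintegral_swap (Measurable.aemeasurable ?_)
        exact ((hSi.comp measurable_fst).mul (hBi.comp measurable_snd)).mul
          (hφm.comp (measurable_fst.sub measurable_snd))
    _ = ∫⁻ y, ∫⁻ h, S.indicator 1 (h + y) * B.indicator 1 y * φ h := by
        refine lintegral_congr fun y => ?_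
        rw [← lintegral_add_right_eq_self _ y]
        simp_rw [add_sub_cancel_right]
    _ = ∫⁻ h, ∫⁻ y, S.indicator 1 (h + y) * B.indicator 1 y * φ h := by
        refine lintegral_lintegral_swap (Measurable.aemeasurable ?_)
        exact ((hSi.comp (measurable_snd.add measurable_fst)).mul (hBi.comp measurable_fst)).mul
          (hφm.comp measurable_snd)
    _ ≤ ∫⁻ h, {h : Fin n → ℝ | ‖h‖ ≤ 2 * l}.indicator (fun h =>
        (n * ENNReal.ofReal l ^ (n - 1)) * ENNReal.ofReal (‖h‖ ^ (1 - (n:ℝ)))) h := by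
        refine lintegral_mono fun h => ?_
        by_cases hh : ‖h‖ ≤ 2 * l
        · rw [Set.indicator_of_mem (by exact hh)]
          have hsub : ∀ y, S.indicator 1 (h + y) * B.indicator 1 y * φ h ≤
              {y | y ∈ B ∧ h + y ∉ B}.indicator (fun _ => φ h) y := fun y => by
            by_cases h1 : h + y ∈ S
            · by_cases h2 : y ∈ B
              · rw [Set.indicator_of_mem h1, Set.indicator_of_mem h2,
                  Set.indicator_of_mem (show y ∈ {y | y ∈ B ∧ h + y ∉ B} from ⟨h2, hSB _ h1⟩)]
                simp
              · simp [h2]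
            · simp [h1]
          have hm : MeasurableSet {y | y ∈ B ∧ h + y ∉ B} :=
            hBm.inter (measurable_const_add h hBm.compl)
          refine (lintegral_mono hsub).trans ?_
          rw [lintegral_indicator_const hm]
          have hv := volume_box_inter_shift_compl_le a h l
          rw [← hB] at hv
          refine (mul_le_mul_right hv _).trans ?_
          have : φ h * ENNReal.ofReal ‖h‖ ≤ ENNReal.ofReal (‖h‖ ^ (1 - (n:ℝ))) := by
            rw [hφ, ← ENNReal.ofReal_mul (by positivity)]
            refine ENNReal.ofReal_le_ofReal ?_
            rcases (norm_nonneg h).eq_or_lt with h0 | h0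
            · rw [← h0, mul_zero]
              positivity
            · rw [sub_eq_neg_add, Real.rpow_add h0, Real.rpow_one]
          calc _ = (n * ENNReal.ofReal l ^ (n - 1)) * (φ h * ENNReal.ofReal ‖h‖) := by ring
            _ ≤ _ := mul_le_mul_right this _
        · rw [Set.indicator_of_notMem (by exact hh)]
          refine le_of_eq ((lintegral_congr fun y => ?_).trans lintegral_zero)
          by_cases h1 : h + y ∈ S
          · by_cases h2 : y ∈ B
            · have := hd _ h1 _ h2
              rw [add_sub_cancel_right] at this
              exact absurd this hh
            · simp [h2]
          · simp [h1]
    _ = (n * ENNReal.ofReal l ^ (n - 1)) * ∫⁻ x in {x : Fin n → ℝ | ‖x‖ ≤ 2 * l},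
          ENNReal.ofReal (‖x‖ ^ (1 - (n:ℝ))) := by
        rw [lintegral_indicator (measurableSet_le measurable_norm measurable_const),
          lintegral_const_mul _ (measurable_norm.pow_const _).ennreal_ofReal]
    _ ≤ (n * ENNReal.ofReal l ^ (n - 1)) * (C * ENNReal.ofReal (2 * l)) :=
        mul_le_mul_right (hC _ (by positivity)) _
    _ = _ := by
        obtain ⟨k, rfl⟩ : ∃ k, n = k + 1 := ⟨n - 1, by omega⟩
        rw [ENNReal.ofReal_mul (by norm_num), Nat.add_sub_cancel, pow_succ]
        push_cast
        simp only [ENNReal.ofReal_ofNat]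
        ring

end Overlap

section Kernel
variable {n : ℕ} {γ : ℝ} {K : (Fin n → ℝ) → (Fin n → ℝ) → ℝ}

lemma enorm_czIntegral_le_of_notMem (hK : IsNormalisedKernel n γ K) {B : Set (Fin n → ℝ)}
    (hB : MeasurableSet B) {ψ : (Fin n → ℝ) → ℝ} {σ : ℝ}
    (hψ : ∀ y, |ψ y| ≤ B.indicator (fun _ => σ) y)
    {x : Fin n → ℝ} (hx : x ∉ B) :
    ‖czIntegral K ψ x‖ₑ ≤
      ENNReal.ofReal σ * ∫⁻ y in B, ENNReal.ofReal (‖x - y‖ ^ (-(n:ℝ))) := by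
  rw [← lintegral_const_mul' _ _ ENNReal.ofReal_ne_top, ← lintegral_indicator hB]
  refine (enorm_integral_le_lintegral_enorm _).trans (lintegral_mono fun y => ?_)
  have h := hψ y
  by_cases hy : y ∈ B
  · rw [Set.indicator_of_mem hy] at h ⊢
    have hxy : x ≠ y := fun e => hx (e ▸ hy)
    have h1 := hK.size x y hxy
    rw [dist_eq_norm] at h1
    rw [enorm_mul, mul_comm, ← Real.enorm_abs (ψ y), ← Real.enorm_abs (K x y),
      Real.enorm_of_nonneg (abs_nonneg _), Real.enorm_of_nonneg (abs_nonneg _)]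
    exact mul_le_mul' (ENNReal.ofReal_le_ofReal h) (ENNReal.ofReal_le_ofReal h1)
  · rw [Set.indicator_of_notMem hy] at h ⊢
    rw [abs_nonpos_iff.1 h]
    simp

/-- Hypotheses on a mean-zero function `ψ` of height `σ` on a cube `B` of side `l`, centre `c`. -/
structure IsCubeAtom (B : Set (Fin n → ℝ)) (a : Fin n → ℝ) (l σ : ℝ) (ψ : (Fin n → ℝ) → ℝ) :
    Prop where
  pos : 0 < l
  box : B = Set.univ.pi fun i => Set.Ico (a i) (a i + l)
  bound : ∀ y, |ψ y| ≤ B.indicator (fun _ => σ) y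
  integrable : Integrable ψ
  mean_zero : ∫ y, ψ y = 0

variable {B : Set (Fin n → ℝ)} {a : Fin n → ℝ} {l σ : ℝ} {ψ : (Fin n → ℝ) → ℝ}

lemma IsCubeAtom.measurableSet (h : IsCubeAtom B a l σ ψ) : MeasurableSet B := by
  rw [h.box]
  exact MeasurableSet.univ_pi fun i => measurableSet_Ico

lemma IsCubeAtom.volume_eq (h : IsCubeAtom B a l σ ψ) : volume B = ENNReal.ofReal l ^ n := by
  rw [h.box, volume_pi_pi]
  simp

lemma IsCubeAtom.norm_sub_le (h : IsCubeAtom B a l σ ψ) {y : Fin n → ℝ} (hy : y ∈ B) :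
    ‖y - fun i => a i + l / 2‖ ≤ l / 2 := by
  have hl := h.pos
  rw [h.box] at hy
  refine (pi_norm_le_iff_of_nonneg (by positivity)).2 fun i => ?_
  have := hy i (Set.mem_univ i)
  rw [Pi.sub_apply, Real.norm_eq_abs, abs_le]
  constructor <;> linarith [this.1, this.2]

lemma IsCubeAtom.enorm_czIntegral_le (h : IsCubeAtom B a l σ ψ) (hK : IsNormalisedKernel n γ K)
    (hγ : 0 < γ) {x : Fin n → ℝ} (hx : l < ‖x - fun i => a i + l / 2‖) :
    ‖czIntegral K ψ x‖ₑ ≤ ENNReal.ofReal σ * ENNReal.ofReal l ^ n *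
      ENNReal.ofReal ((l / 2) ^ γ * ‖x - fun i => a i + l / 2‖ ^ (-(n:ℝ) - γ)) := by
  obtain ⟨c, hc⟩ : ∃ c : Fin n → ℝ, c = fun i => a i + l / 2 := ⟨_, rfl⟩
  rw [← hc] at hx ⊢
  by_cases hi : Integrable fun y => K x y * ψ y
  · have e : czIntegral K ψ x = ∫ y, (K x y - K x c) * ψ y := by
      simp_rw [sub_mul]
      rw [integral_sub hi (h.integrable.const_mul _), integral_const_mul, h.mean_zero, mul_zero,
        sub_zero]
      rfl
    rw [e]
    refine (enorm_integral_le_lintegral_enorm _).trans ?_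
    calc _ ≤ ∫⁻ y, B.indicator (fun _ => ENNReal.ofReal σ *
          ENNReal.ofReal ((l / 2) ^ γ * ‖x - c‖ ^ (-(n:ℝ) - γ))) y := by
          refine lintegral_mono fun y => ?_
          have hb := h.bound y
          by_cases hy : y ∈ B
          · rw [Set.indicator_of_mem hy] at hb ⊢
            have hyc := h.norm_sub_le hy
            rw [← hc] at hyc
            have h1 := hK.smooth x c (y - c) (by rw [dist_eq_norm]; linarith)
            rw [add_sub_cancel, dist_eq_norm] at h1
            have h2 : |K x y - K x c| ≤ (l / 2) ^ γ * ‖x - c‖ ^ (-(n:ℝ) - γ) :=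
              (le_add_of_nonneg_left (abs_nonneg _)).trans (h1.trans (mul_le_mul_of_nonneg_right
                (Real.rpow_le_rpow (norm_nonneg _) hyc hγ.le) (by positivity)))
            rw [enorm_mul, mul_comm, ← Real.enorm_abs (ψ y), ← Real.enorm_abs (K x y - K x c),
              Real.enorm_of_nonneg (abs_nonneg _), Real.enorm_of_nonneg (abs_nonneg _)]
            exact mul_le_mul' (ENNReal.ofReal_le_ofReal hb) (ENNReal.ofReal_le_ofReal h2)
          · rw [Set.indicator_of_notMem hy] at hb ⊢
            rw [abs_nonpos_iff.1 hb]
            simp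
      _ = _ := by
          rw [lintegral_indicator_const h.measurableSet, h.volume_eq]
          ring
  · rw [czIntegral, integral_undef hi]
    simp

lemma IsCubeAtom.lintegral_le_of_far (h : IsCubeAtom B a l σ ψ) (hK : IsNormalisedKernel n γ K)
    (hγ : 0 < γ) {Q : Set (Fin n → ℝ)} (hQ : MeasurableSet Q) {D : ℝ} (hD : 0 < D)
    (h1 : ∀ x ∈ Q, l < ‖x - fun i => a i + l / 2‖) (h2 : ∀ x ∈ Q, D ≤ ‖x - fun i => a i + l / 2‖) :
    ∫⁻ x in Q, ‖czIntegral K ψ x‖ₑ ≤ ENNReal.ofReal σ * ENNReal.ofReal l ^ n *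
      ENNReal.ofReal ((l / 2) ^ γ * D ^ (-(n:ℝ) - γ)) * volume Q := by
  have hl := h.pos
  rw [← setLIntegral_const]
  refine setLIntegral_mono' hQ fun x hx => (h.enorm_czIntegral_le hK hγ (h1 x hx)).trans ?_
  refine mul_le_mul_right (ENNReal.ofReal_le_ofReal (mul_le_mul_of_nonneg_left ?_
    (by positivity))) _
  exact Real.rpow_le_rpow_of_nonpos hD (h2 x hx) (by linarith [(Nat.cast_nonneg n : (0:ℝ) ≤ n)])

lemma lintegral_czIntegral_le_of_near (hn : 0 < n) (hγ : 0 < γ) :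
    ∃ C : NNReal, ∀ (K : (Fin n → ℝ) → (Fin n → ℝ) → ℝ), IsNormalisedKernel n γ K →
      ∀ (B : Set (Fin n → ℝ)) (a : Fin n → ℝ) (l σ : ℝ) (ψ : (Fin n → ℝ) → ℝ),
      IsCubeAtom B a l σ ψ → ∀ (d : ℕ) (Q : Set (Fin n → ℝ)), MeasurableSet Q →
      (∀ x ∈ Q, x ∉ B) → (∀ x ∈ Q, (d + 1 / 2) * l ≤ ‖x - fun i => a i + l / 2‖) →
      ∫⁻ x in Q, ‖czIntegral K ψ x‖ₑ ≤
        C * (ENNReal.ofReal σ * ENNReal.ofReal l ^ n * ENNReal.ofReal ((d + 1 : ℝ) ^ (-γ))) := by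
  obtain ⟨C₁, h₁⟩ := lintegral_norm_rpow_far hn hγ
  obtain ⟨C₂, h₂⟩ := lintegral_lintegral_norm_sub_le hn
  refine ⟨C₁ * ((2:ℝ) ^ γ).toNNReal + C₂, fun K hK B a l σ ψ h d Q hQ hQB hQd => ?_⟩
  have hl := h.pos
  obtain ⟨c, hc⟩ : ∃ c : Fin n → ℝ, c = fun i => a i + l / 2 := ⟨_, rfl⟩
  rw [← hc] at hQd
  have hfm : MeasurableSet {x : Fin n → ℝ | l < ‖x - c‖} :=
    measurableSet_lt measurable_const (measurable_id.sub_const c).norm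
  have far : ∫⁻ x in Q ∩ {x | l < ‖x - c‖}, ‖czIntegral K ψ x‖ₑ ≤
      (C₁ * ((2:ℝ) ^ γ).toNNReal : NNReal) *
      (ENNReal.ofReal σ * ENNReal.ofReal l ^ n * ENNReal.ofReal ((d + 1 : ℝ) ^ (-γ))) := by
    have hR : (0:ℝ) < (d + 1) * l / 4 := by positivity
    calc _ ≤ ∫⁻ x in Q ∩ {x | l < ‖x - c‖}, ENNReal.ofReal σ * ENNReal.ofReal l ^ n *
          ENNReal.ofReal ((l / 2) ^ γ) * ENNReal.ofReal (‖x - c‖ ^ (-(n:ℝ) - γ)) := by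
          refine setLIntegral_mono' (hQ.inter hfm) fun x hx => ?_
          have := h.enorm_czIntegral_le hK hγ (x := x) (by rw [← hc]; exact hx.2)
          rwa [← hc, ENNReal.ofReal_mul (by positivity), ← mul_assoc] at this
      _ ≤ ∫⁻ x in {x | (d + 1) * l / 4 < ‖x - c‖}, ENNReal.ofReal σ * ENNReal.ofReal l ^ n *
          ENNReal.ofReal ((l / 2) ^ γ) * ENNReal.ofReal (‖x - c‖ ^ (-(n:ℝ) - γ)) := by
          refine lintegral_mono_set fun x hx => ?_
          have h3 := hQd x hx.1
          have : (0:ℝ) ≤ d * l := by positivity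
          exact lt_of_lt_of_le (by linarith) h3
      _ ≤ ENNReal.ofReal σ * ENNReal.ofReal l ^ n * ENNReal.ofReal ((l / 2) ^ γ) *
          (C₁ * ENNReal.ofReal (((d + 1) * l / 4) ^ (-γ))) := by
          rw [lintegral_const_mul' _ _ (by finiteness)]
          exact mul_le_mul_right (h₁ _ hR c) _
      _ = _ := by
          have e : (l / 2) ^ γ * (((d + 1 : ℝ)) * l / 4) ^ (-γ) = 2 ^ γ * (d + 1 : ℝ) ^ (-γ) := by
            have hu : 0 < l / 2 := by positivity
            rw [show ((d + 1 : ℝ)) * l / 4 = (d + 1) * ((l / 2) / 2) by ring]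
            generalize l / 2 = u at hu
            rw [Real.mul_rpow (by positivity) (by positivity),
              Real.div_rpow hu.le (by positivity), Real.rpow_neg hu.le,
              Real.rpow_neg (by norm_num : (0:ℝ) ≤ 2)]
            field_simp
          have e' : ENNReal.ofReal ((l / 2) ^ γ) * ENNReal.ofReal (((d + 1) * l / 4) ^ (-γ)) =
              (((2:ℝ) ^ γ).toNNReal : ℝ≥0∞) * ENNReal.ofReal ((d + 1 : ℝ) ^ (-γ)) := by
            rw [← ENNReal.ofReal_mul (by positivity), e, ENNReal.ofReal_mul (by positivity)]
            rfl
          calc _ = ENNReal.ofReal σ * ENNReal.ofReal l ^ n * C₁ * (ENNReal.ofReal ((l / 2) ^ γ) *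
                ENNReal.ofReal (((d + 1) * l / 4) ^ (-γ))) := by ring
            _ = _ := by
                rw [e']
                push_cast
                ring
  have near : ∫⁻ x in Q \ {x | l < ‖x - c‖}, ‖czIntegral K ψ x‖ₑ ≤
      C₂ * (ENNReal.ofReal σ * ENNReal.ofReal l ^ n * ENNReal.ofReal ((d + 1 : ℝ) ^ (-γ))) := by
    rcases Nat.eq_zero_or_pos d with hd | hd
    · have h3 := h₂ a l hl B (Q \ {x | l < ‖x - c‖}) h.box (hQ.diff hfm) (fun x hx => hQB x hx.1)
        fun x hx y hy => by
          have h4 := h.norm_sub_le hy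
          rw [← hc, norm_sub_rev] at h4
          have h5 : ‖x - c‖ ≤ l := not_lt.1 hx.2
          linarith [norm_sub_le_norm_sub_add_norm_sub x c y]
      calc _ ≤ ∫⁻ x in Q \ {x | l < ‖x - c‖}, ENNReal.ofReal σ *
            ∫⁻ y in B, ENNReal.ofReal (‖x - y‖ ^ (-(n:ℝ))) :=
            setLIntegral_mono' (hQ.diff hfm) fun x hx =>
              enorm_czIntegral_le_of_notMem hK h.measurableSet h.bound (hQB x hx.1)
        _ ≤ ENNReal.ofReal σ * (C₂ * ENNReal.ofReal l ^ n) := by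
            rw [lintegral_const_mul' _ _ (by finiteness)]
            exact mul_le_mul_right h3 _
        _ = _ := by
            rw [hd]
            simp only [Nat.cast_zero, zero_add, Real.one_rpow, ENNReal.ofReal_one]
            ring
    · have : Q \ {x | l < ‖x - c‖} = ∅ := by
        refine Set.eq_empty_of_forall_notMem fun x hx => hx.2 ?_
        have h3 := hQd x hx.1
        have h4 : (1:ℝ) ≤ d := by exact_mod_cast hd
        exact lt_of_lt_of_le (by nlinarith) h3
      rw [this]
      simp
  rw [← lintegral_inter_add_sdiff _ Q hfm]
  push_cast at far ⊢
  rw [add_mul]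
  exact add_le_add far near

end Kernel

section Boundary
variable {n : ℕ} {γ : ℝ}

lemma two_rpow_neg_le_bdry (hn : 0 < n) (s κ : ℕ) (z : Fin n → ℤ) :
    (2:ℝ≥0∞) ^ (-(γ * s)) ≤ bdry γ s κ z := by
  have h : layer κ 0 z = 1 := by
    refine le_antisymm (layer_le_one _ _ _) (le_trans ?_ le_sup_left)
    rw [jump, Nat.sub_zero, cell_add_smul, if_neg]
    intro h
    have := congrFun h ⟨0, hn⟩
    simp at this
  have := Finset.single_le_sum (f := fun j : ℕ => (2:ℝ≥0∞) ^ (-(γ * (s - j : ℝ))) * layer κ j z)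
    (fun _ _ => zero_le) (Finset.mem_range.2 s.succ_pos)
  rw [bdry]
  simpa [h] using this

lemma ofReal_rpow_neg_le_bdry (hγ : 0 < γ) {s r d : ℕ} {z : Fin n → ℤ} {i : Fin n}
    (h : (d : ℤ) = 2 ^ s - 1 - cell r z i % 2 ^ s ∨ (d : ℤ) = cell r z i % 2 ^ s) :
    ENNReal.ofReal ((d + 1 : ℝ) ^ (-γ)) ≤ ENNReal.ofReal (2 ^ γ) * bdry γ s (r + s) z := by
  have h2 : (0:ℤ) < 2 ^ s := by positivity
  have hm0 := Int.emod_nonneg (cell r z i) h2.ne'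
  have hm1 := Int.emod_lt_of_pos (cell r z i) h2
  have hmd := Int.emod_add_mul_ediv (cell r z i) (2 ^ s)
  have hd : d < 2 ^ s := by
    zify
    rcases h with h | h <;> omega
  have ht : Nat.size d ≤ s := Nat.size_le.2 hd
  obtain ⟨t, rfl⟩ : ∃ t, t = Nat.size d := ⟨_, rfl⟩
  have htd : (d : ℤ) < 2 ^ Nat.size d := by exact_mod_cast Nat.lt_size_self d
  have htd2 : 2 ^ Nat.size d ≤ 2 * (d + 1) := by
    rcases Nat.eq_zero_or_pos d with h0 | h0
    · simp [h0]
    · obtain ⟨t, ht'⟩ : ∃ t, Nat.size d = t + 1 := ⟨Nat.size d - 1, by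
        have := Nat.size_pos.2 h0
        omega⟩
      have := Nat.lt_size.1 (show t < Nat.size d by omega)
      rw [ht', pow_succ]
      omega
  have hz : ∀ a : ℤ, cell (r + s) (z + (2:ℤ) ^ (r + s - (s - Nat.size d)) • (fun _ => a)) i =
      (cell r z i + 2 ^ Nat.size d * a) / 2 ^ s := fun a => by
    rw [← cell_cell, show r + s - (s - Nat.size d) = r + Nat.size d by omega, pow_add, mul_smul,
      cell_add_smul]
    rfl
  have hz0 : cell (r + s) z i = cell r z i / 2 ^ s := by rw [← cell_cell]; rfl
  have hl : layer (r + s) (s - Nat.size d) z = 1 := by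
    refine le_antisymm (layer_le_one _ _ _) ?_
    rcases h with h | h
    · refine le_trans ?_ le_sup_left
      rw [jump, if_neg]
      intro he
      have := congrFun he i
      have h1 := hz 1
      rw [show (fun _ => 1 : Fin n → ℤ) = 1 from rfl] at h1
      rw [h1, hz0, Int.ediv_eq_iff_of_pos h2] at this
      linarith [this.2]
    · refine le_trans ?_ le_sup_right
      rw [jump, if_neg]
      intro he
      have := congrFun he i
      have h1 := hz (-1)
      rw [show (fun _ => -1 : Fin n → ℤ) = -1 from rfl] at h1
      rw [h1, hz0, Int.ediv_eq_iff_of_pos h2] at this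
      linarith [this.1]
  have hsum := Finset.single_le_sum
    (f := fun j : ℕ => (2:ℝ≥0∞) ^ (-(γ * (s - j : ℝ))) * layer (r + s) j z)
    (fun _ _ => zero_le) (Finset.mem_range.2 (show s - Nat.size d < s + 1 by omega))
  simp only [hl, mul_one, Nat.cast_sub ht, sub_sub_cancel] at hsum
  refine le_trans ?_ (mul_le_mul_right hsum _)
  rw [← ofReal_two_rpow, ← ENNReal.ofReal_mul (by positivity)]
  refine ENNReal.ofReal_le_ofReal ?_
  have h3 : (2:ℝ) ^ (Nat.size d : ℝ) / 2 ≤ d + 1 := by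
    have : ((2 ^ Nat.size d : ℕ) : ℝ) ≤ ((2 * (d + 1) : ℕ) : ℝ) := by exact_mod_cast htd2
    push_cast at this
    rw [Real.rpow_natCast]
    linarith
  refine (Real.rpow_le_rpow_of_nonpos (by positivity) h3 (by linarith)).trans (le_of_eq ?_)
  rw [Real.div_rpow (by positivity) (by positivity), ← Real.rpow_mul (by positivity),
    Real.rpow_neg (by positivity : (0:ℝ) ≤ 2) γ, div_inv_eq_mul, mul_comm]
  congr 2
  ring

end Boundary

section Cubes
variable {n : ℕ}

lemma cell_gridIdx (N : ℤ) (j : ℕ) (x : Fin n → ℝ) : cell j (gridIdx N x) = gridIdx (N - j) x :=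
  funext fun _ => (floor_zpow_sub _ _ _).symm

lemma setOf_gridIdx_eq (k : ℤ) (w : Fin n → ℤ) : {x | gridIdx k x = w} =
    Set.univ.pi fun i => Set.Ico ((2:ℝ) ^ (-k) * w i) ((2:ℝ) ^ (-k) * w i + 2 ^ (-k)) := by
  ext x
  simp only [Set.mem_univ_pi, funext_iff, gridIdx, Set.mem_ofPred_eq]
  refine forall_congr' fun i => ?_
  rw [← mem_dyadicIco_iff, mul_add, mul_one]

lemma measurableSet_gridIdx_eq (k : ℤ) (w : Fin n → ℤ) :
    MeasurableSet {x : Fin n → ℝ | gridIdx k x = w} :=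
  measurable_gridIdx k (measurableSet_singleton w)

lemma volume_gridIdx_eq (k : ℤ) (w : Fin n → ℤ) :
    volume {x : Fin n → ℝ | gridIdx k x = w} = ENNReal.ofReal (2 ^ (-k)) ^ n := by
  rw [setOf_gridIdx_eq, volume_pi_pi]
  simp

lemma haarZero_eq_indicator (k : ℤ) (w : Fin n → ℤ) (x : Fin n → ℝ) :
    haarZero n k w x = {x | gridIdx k x = w}.indicator (fun _ => haarScale n k) x := by
  rw [haarZero_eq (N := k + 1) (ν := 0) (by simp), cell_gridIdx, Set.indicator_apply]
  simp [haarScale]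

lemma tsum_latHaar_eq_zero {q : ℕ × (Fin n → ℤ) × (Fin n → Bool)} (hq : q.2.2 ≠ fun _ => false) :
    ∑' z, latHaar q z = 0 := by
  rw [tsum_eq_sum fun z hz => latHaar_eq_zero (mt mem_latBlk.2 hz)]
  refine Eq.trans (Finset.sum_congr ?_ fun _ _ => rfl)
    (sum_blk_latHaar hq ((2:ℤ) ^ (q.1 + 1) • q.2.1))
  ext z
  rw [mem_stdGrid_blk, mem_latBlk, cell_two_pow_smul]

lemma isCubeAtom_haarFn (k : ℤ) (w : Fin n → ℤ) {η : Fin n → Bool} (hη : η ≠ fun _ => false) :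
    IsCubeAtom {x | gridIdx k x = w} (fun i => (2:ℝ) ^ (-k) * w i) (2 ^ (-k)) (haarScale n k)
      (haarFn n k w η) where
  pos := by positivity
  box := setOf_gridIdx_eq k w
  bound y := by
    rw [haarFn_eq (N := k + 1) (ν := 0) (by simp), abs_mul, abs_latHaar, cell_gridIdx,
      Set.indicator_apply, abs_of_nonneg (by positivity)]
    simp [haarScale]
  integrable := by
    rw [show haarFn n k w η = _ from funext fun x =>
      haarFn_eq (k := k) (N := k + 1) (ν := 0) (by simp) w η x]
    exact (integrable_comp_gridIdx _ (support_latHaar_finite _)).const_mul _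
  mean_zero := by
    rw [show haarFn n k w η = _ from funext fun x =>
      haarFn_eq (k := k) (N := k + 1) (ν := 0) (by simp) w η x]
    rw [integral_const_mul, integral_comp_gridIdx _ (support_latHaar_finite _),
      tsum_latHaar_eq_zero hη, mul_zero, mul_zero]

lemma exists_norm_eq_abs (hn : 0 < n) (m : Fin n → ℤ) : ∃ i, ‖m‖ = |(m i : ℝ)| := by
  have : Nonempty (Fin n) := ⟨⟨0, hn⟩⟩
  by_contra! h
  have h1 : ∀ i, ‖m i‖ < ‖m‖ := fun i => lt_of_le_of_ne (norm_le_pi_norm m i) (h i).symm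
  have h2 : 0 < ‖m‖ := (norm_nonneg _).trans_lt (h1 ⟨0, hn⟩)
  exact lt_irrefl _ ((pi_norm_lt_iff h2).2 h1)

/-- Distance from the centre of a cube to a translate of its `s`-th ancestor. -/
lemma exists_le_norm_sub (hn : 0 < n) (k : ℤ) (s : ℕ) (w : Fin n → ℤ) {m : Fin n → ℤ}
    (hm : m ≠ 0) : ∃ (M d : ℕ) (i : Fin n), 1 ≤ M ∧ ‖m‖ = M ∧
      ((d : ℤ) = 2 ^ s - 1 - w i % 2 ^ s ∨ (d : ℤ) = w i % 2 ^ s) ∧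
      ∀ x, gridIdx (k - s) x = cell s w + m → ((M - 1) * 2 ^ s + d + 1 / 2) * (2:ℝ) ^ (-k) ≤
        ‖x - fun i => (2:ℝ) ^ (-k) * w i + 2 ^ (-k) / 2‖ := by
  obtain ⟨i, hi⟩ := exists_norm_eq_abs hn m
  have h2 : (0:ℤ) < 2 ^ s := by positivity
  have hm0 := Int.emod_nonneg (w i) h2.ne'
  have hm1 := Int.emod_lt_of_pos (w i) h2
  have hmd := Int.emod_add_mul_ediv (w i) (2 ^ s)
  have hmd' : ((w i % 2 ^ s : ℤ) : ℝ) + 2 ^ s * (w i / 2 ^ s : ℤ) = w i := by exact_mod_cast hmd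
  have hmi : m i ≠ 0 := fun h => hm (norm_eq_zero.1 (by rw [hi, h]; simp))
  have hl : (0:ℝ) < 2 ^ (-k) := by positivity
  have hx : ∀ x, gridIdx (k - s) x = cell s w + m →
      (2:ℝ) ^ (-k) * (2 ^ s * ((w i / 2 ^ s : ℤ) + m i)) ≤ x i ∧
        x i ≤ (2:ℝ) ^ (-k) * (2 ^ s * ((w i / 2 ^ s : ℤ) + m i + 1)) := fun x hx => by
    have h := (mem_dyadicIco_iff (k - s) (cell s w i + m i) (x i)).2 (congrFun hx i)
    rw [neg_sub, sub_eq_neg_add, zpow_add₀ two_ne_zero, zpow_natCast] at h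
    push_cast at h
    rw [mul_assoc, mul_assoc] at h
    exact ⟨h.1, h.2.le⟩
  have hn' : ∀ x : Fin n → ℝ, |x i - ((2:ℝ) ^ (-k) * w i + 2 ^ (-k) / 2)| ≤
      ‖x - fun i => (2:ℝ) ^ (-k) * w i + 2 ^ (-k) / 2‖ := fun x =>
    norm_le_pi_norm (x - fun i => (2:ℝ) ^ (-k) * w i + 2 ^ (-k) / 2) i
  rcases lt_or_gt_of_ne hmi with h | h
  · obtain ⟨M, hM⟩ := Int.eq_ofNat_of_zero_le (show 0 ≤ -m i by omega)
    obtain ⟨d, hd⟩ := Int.eq_ofNat_of_zero_le hm0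
    have hM' : (m i : ℝ) = -M := by exact_mod_cast (show m i = -(M : ℤ) by omega)
    refine ⟨M, d, i, by omega, by rw [hi, hM', abs_neg, Nat.abs_cast], .inr hd.symm,
      fun x hxi => le_trans ?_ ((neg_le_abs _).trans (hn' x))⟩
    have h1 := (hx x hxi).2
    rw [hd] at hmd'
    rw [hM'] at h1
    rw [← hmd']
    push_cast
    linarith
  · obtain ⟨M, hM⟩ := Int.eq_ofNat_of_zero_le (show 0 ≤ m i by omega)
    obtain ⟨d, hd⟩ := Int.eq_ofNat_of_zero_le (show 0 ≤ 2 ^ s - 1 - w i % 2 ^ s by omega)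
    have hM' : (m i : ℝ) = M := by exact_mod_cast hM
    have hd' : ((w i % 2 ^ s : ℤ) : ℝ) = 2 ^ s - 1 - d := by
      have : w i % 2 ^ s = 2 ^ s - 1 - d := by omega
      rw [this]
      push_cast
      ring
    refine ⟨M, d, i, by omega, by rw [hi, hM', Nat.abs_cast], .inl hd.symm,
      fun x hxi => le_trans ?_ ((le_abs_self _).trans (hn' x))⟩
    have h1 := (hx x hxi).1
    rw [hd'] at hmd'
    rw [hM'] at h1
    rw [← hmd']
    linarith

end Cubes

section Coefficients
variable {n : ℕ} {γ : ℝ}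

lemma enorm_haarCoeff_le (K : (Fin n → ℝ) → (Fin n → ℝ) → ℝ) (s : ℕ)
    (q : ℤ × (Fin n → ℤ) × (Fin n → Bool)) (m : Fin n → ℤ) :
    ‖haarCoeff K s q m‖ₑ ≤ ENNReal.ofReal (haarScale n (q.1 - s)) *
      ∫⁻ x in {x | gridIdx (q.1 - s) x = cell s q.2.1 + m},
        ‖czIntegral K (haarFn n q.1 q.2.1 q.2.2) x‖ₑ := by
  rw [haarCoeff, pairing, ← lintegral_const_mul' _ _ ENNReal.ofReal_ne_top,
    ← lintegral_indicator (measurableSet_gridIdx_eq _ _)]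
  refine (enorm_integral_le_lintegral_enorm _).trans (lintegral_mono fun x => ?_)
  rw [haarZero_eq_indicator, ancestorIdx_eq, enorm_mul]
  by_cases hx : x ∈ {x | gridIdx (q.1 - s) x = cell s q.2.1 + m}
  · rw [Set.indicator_of_mem hx, Set.indicator_of_mem hx,
      Real.enorm_of_nonneg (haarScale_pos _).le]
  · rw [Set.indicator_of_notMem hx, Set.indicator_of_notMem hx]
    simp

lemma haarScale_sq_mul (k : ℤ) (s : ℕ) :
    haarScale n (k - s) * haarScale n (k - s) * ((2:ℝ) ^ (-k)) ^ n = 2 ^ (-(s * n : ℝ)) := by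
  have h : (0:ℝ) < 2 ^ (-(k - s)) := by positivity
  rw [haarScale, ← mul_pow, ← mul_inv, Real.mul_self_sqrt h.le, ← mul_pow, ← zpow_neg,
    ← zpow_add₀ two_ne_zero, neg_neg, show k - (s:ℤ) + -k = -s by ring, ← neg_mul,
    Real.rpow_mul (by norm_num), Real.rpow_natCast, ← Real.rpow_intCast]
  push_cast
  rfl

lemma far_constant_le {M l : ℝ} (hM : 1 ≤ M) (hl : 0 < l) (hγ : 0 < γ) (s : ℕ) :
    (l / 2) ^ γ * (M * 2 ^ s * l / 2) ^ (-(n:ℝ) - γ) * (2 ^ s * l) ^ n ≤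
      2 ^ (2 * n + γ) * ((1 + M) ^ (-(n + γ)) * 2 ^ (-(γ * s))) := by
  have hM0 : 0 < M := by linarith
  have h1 : M ^ (-(n:ℝ) - γ) ≤ 2 ^ (n + γ) * (1 + M) ^ (-(n + γ)) := by
    have h2 : ((1 + M) / 2) ^ (-(n + γ)) = 2 ^ (n + γ) * (1 + M) ^ (-(n + γ)) := by
      rw [Real.div_rpow (by positivity) (by positivity),
        Real.rpow_neg (by positivity : (0:ℝ) ≤ 2), div_inv_eq_mul, mul_comm]
    rw [← h2, show -(n:ℝ) - γ = -(n + γ) by ring]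
    refine Real.rpow_le_rpow_of_nonpos (by positivity) (by linarith) ?_
    linarith [(Nat.cast_nonneg n : (0:ℝ) ≤ n)]
  have e : (l / 2) ^ γ * (M * 2 ^ s * l / 2) ^ (-(n:ℝ) - γ) * (2 ^ s * l) ^ n =
      2 ^ (n:ℝ) * 2 ^ (-(γ * s)) * M ^ (-(n:ℝ) - γ) := by
    have hu : 0 < l / 2 := by positivity
    rw [show M * 2 ^ s * l / 2 = M * (2 ^ s * (l / 2)) by ring,
      show 2 ^ s * l = 2 ^ s * (2 * (l / 2)) by ring]
    generalize l / 2 = u at hu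
    rw [Real.mul_rpow hM0.le (by positivity), Real.mul_rpow (by positivity) hu.le,
      ← Real.rpow_natCast 2 s, ← Real.rpow_mul (by positivity), mul_pow, mul_pow,
      ← Real.rpow_natCast _ n, ← Real.rpow_natCast 2 n, ← Real.rpow_natCast u n,
      ← Real.rpow_mul (by positivity)]
    have hu1 : u ^ γ * u ^ (-(n:ℝ) - γ) * u ^ (n:ℝ) = 1 := by
      rw [← Real.rpow_add hu, ← Real.rpow_add hu]
      simp
    have h21 : (2:ℝ) ^ ((s:ℝ) * (-(n:ℝ) - γ)) * 2 ^ ((s:ℝ) * n) = 2 ^ (-(γ * s)) := by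
      rw [← Real.rpow_add two_pos]
      congr 1
      ring
    calc _ = 2 ^ (n:ℝ) * (2 ^ ((s:ℝ) * (-(n:ℝ) - γ)) * 2 ^ ((s:ℝ) * n)) * M ^ (-(n:ℝ) - γ) *
          (u ^ γ * u ^ (-(n:ℝ) - γ) * u ^ (n:ℝ)) := by ring
      _ = _ := by rw [hu1, h21, mul_one]
  rw [e]
  calc _ ≤ 2 ^ (n:ℝ) * 2 ^ (-(γ * s)) * (2 ^ (n + γ) * (1 + M) ^ (-(n + γ))) :=
        mul_le_mul_of_nonneg_left h1 (by positivity)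
    _ = (2 ^ (n:ℝ) * 2 ^ (n + γ)) * ((1 + M) ^ (-(n + γ)) * 2 ^ (-(γ * s))) := by ring
    _ = _ := by
        rw [← Real.rpow_add two_pos]
        congr 2
        ring

lemma lintegral_czIntegral_haarFn_le (hn : 0 < n) (hγ : 0 < γ) :
    ∃ A : NNReal, ∀ (K : (Fin n → ℝ) → (Fin n → ℝ) → ℝ), IsNormalisedKernel n γ K →
      ∀ (s : ℕ) (k : ℤ) (w : Fin n → ℤ) (η : Fin n → Bool), (η ≠ fun _ => false) →
      ∀ m : Fin n → ℤ, m ≠ 0 → ∀ (r : ℕ) (z : Fin n → ℤ), cell r z = w →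
      ∫⁻ x in {x | gridIdx (k - s) x = cell s w + m}, ‖czIntegral K (haarFn n k w η) x‖ₑ ≤
        ENNReal.ofReal (haarScale n k) * ENNReal.ofReal (2 ^ (-k)) ^ n *
          (A * (wt n γ m * bdry γ s (r + s) z)) := by
  obtain ⟨C, hC⟩ := lintegral_czIntegral_le_of_near hn hγ
  refine ⟨C * ((2:ℝ) ^ (n + 2 * γ)).toNNReal + ((2:ℝ) ^ (2 * n + γ)).toNNReal,
    fun K hK s k w η hη m hm r z hz => ?_⟩
  obtain ⟨M, d, i, hM, hmM, hd, hx⟩ := exists_le_norm_sub hn k s w hm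
  have hat := isCubeAtom_haarFn k w hη
  have hQ := measurableSet_gridIdx_eq (k - s) (cell s w + m)
  have hl := hat.pos
  have hd0 : (0:ℝ) ≤ d := Nat.cast_nonneg d
  have h2s : (1:ℝ) ≤ 2 ^ s := one_le_pow₀ (by norm_num)
  push_cast
  rw [add_mul]
  rcases hM.eq_or_lt with hM1 | hM2
  · subst hM1
    have hQB : ∀ x ∈ {x : Fin n → ℝ | gridIdx (k - s) x = cell s w + m},
        x ∉ {x | gridIdx k x = w} := fun x h1 h2 => by
      have h1 : gridIdx (k - s) x = cell s w + m := h1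
      have h2 : gridIdx k x = w := h2
      rw [← cell_gridIdx, h2, left_eq_add] at h1
      exact hm h1
    have h := hC K hK _ _ _ _ _ hat d _ hQ hQB fun x hxQ => by
      have := hx x hxQ
      simpa using this
    have hb := ofReal_rpow_neg_le_bdry hγ (s := s) (r := r) (d := d) (z := z) (i := i)
      (by rw [hz]; exact hd)
    have hw : ENNReal.ofReal (2 ^ γ) = ENNReal.ofReal (2 ^ (n + 2 * γ)) * wt n γ m := by
      rw [wt, hmM, ← ENNReal.ofReal_mul (by positivity), Nat.cast_one, one_add_one_eq_two,
        ← Real.rpow_add two_pos]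
      congr 2
      ring
    refine h.trans (le_trans ?_ (mul_le_mul_right le_self_add _))
    rw [hw] at hb
    refine (mul_le_mul_right (mul_le_mul_right hb _) _).trans (le_of_eq ?_)
    rw [ENNReal.ofReal, ENNReal.ofReal, ENNReal.ofReal]
    ring
  · have hM2 : (2:ℝ) ≤ M := by exact_mod_cast hM2
    have h := hat.lintegral_le_of_far hK hγ hQ (D := M * 2 ^ s * 2 ^ (-k) / 2) (by positivity)
      (fun x hxQ => lt_of_lt_of_le ?_ (hx x hxQ)) (fun x hxQ => le_trans ?_ (hx x hxQ))
    · rw [volume_gridIdx_eq, mul_assoc, neg_sub, sub_eq_add_neg (s:ℤ), zpow_add₀ two_ne_zero,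
        zpow_natCast] at h
      refine h.trans (mul_le_mul' le_rfl (le_trans ?_ le_add_self))
      rw [← ENNReal.ofReal_pow (by positivity), ← ENNReal.ofReal_mul (by positivity)]
      refine (ENNReal.ofReal_le_ofReal
        (far_constant_le (n := n) (M := M) (by linarith) hl hγ s)).trans ?_
      rw [ENNReal.ofReal_mul (by positivity), ENNReal.ofReal_mul (by positivity), ofReal_two_rpow
        (-(γ * s)), wt, hmM]
      exact mul_le_mul_right (mul_le_mul_right (two_rpow_neg_le_bdry hn _ _ _) _) _
    · have : (1:ℝ) < (M - 1) * 2 ^ s + d + 1 / 2 := by nlinarith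
      nlinarith
    · have : (M:ℝ) * 2 ^ s / 2 ≤ (M - 1) * 2 ^ s + d + 1 / 2 := by nlinarith
      nlinarith

/-- The matrix coefficients of `Φ̃_s` satisfy the size condition of the lattice estimate. -/
lemma coeffBound_latCoeff (hn : 0 < n) (hγ : 0 < γ) :
    ∃ A : NNReal, ∀ (K : (Fin n → ℝ) → (Fin n → ℝ) → ℝ), IsNormalisedKernel n γ K →
      ∀ (s : ℕ) (N : ℤ) (G : Finset (ℕ × (Fin n → ℤ) × (Fin n → Bool))),
      (∀ q ∈ G, q.2.2 ≠ fun _ => false) → CoeffBound γ s A G (latCoeff K s N) := by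
  obtain ⟨A, hA⟩ := lintegral_czIntegral_haarFn_le hn hγ
  refine ⟨A, fun K hK s N G hG q hq m z hz => ?_⟩
  rw [latCoeff]
  split_ifs with hm
  · simp
  obtain ⟨k, hk⟩ : ∃ k, k = (ofLattice N q).1 := ⟨_, rfl⟩
  have h := hA K hK s k q.2.1 q.2.2 (hG q hq) m hm (q.1 + 1) z hz
  have h1 := enorm_haarCoeff_le K s (ofLattice N q) m
  rw [← hk] at h1 ⊢
  have h2 : (ofLattice N q).2 = q.2 := rfl
  rw [h2] at h1
  have hs := haarScale_pos (n := n) k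
  have hs' := haarScale_pos (n := n) (k - s)
  rw [enorm_mul, Real.enorm_of_nonneg (r := _ / _) (by positivity)]
  have e : ENNReal.ofReal (haarScale n (k - s)) * (ENNReal.ofReal (haarScale n k) *
      ENNReal.ofReal (2 ^ (-k)) ^ n) * ENNReal.ofReal (haarScale n (k - s) / haarScale n k) =
      2 ^ (-(s * n : ℝ)) := by
    rw [← ofReal_two_rpow, ← haarScale_sq_mul k s, ← ENNReal.ofReal_pow (by positivity),
      ← ENNReal.ofReal_mul (by positivity), ← ENNReal.ofReal_mul (by positivity),
      ← ENNReal.ofReal_mul (by positivity)]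
    congr 1
    field_simp
  calc _ ≤ ENNReal.ofReal (haarScale n (k - s)) * (ENNReal.ofReal (haarScale n k) *
        ENNReal.ofReal (2 ^ (-k)) ^ n * (A * (wt n γ m * bdry γ s (q.1 + 1 + s) z))) *
        ENNReal.ofReal (haarScale n (k - s) / haarScale n k) :=
        mul_le_mul_left (h1.trans (mul_le_mul_right h _)) _
    _ = ENNReal.ofReal (haarScale n (k - s)) * (ENNReal.ofReal (haarScale n k) *
      ENNReal.ofReal (2 ^ (-k)) ^ n) * ENNReal.ofReal (haarScale n (k - s) / haarScale n k) *
        (A * (wt n γ m * bdry γ s (q.1 + 1 + s) z)) := by ring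
    _ = _ := by
        rw [e]
        ring

end Coefficients

end

/-- Proposition 4.1: the bound on `Φ̃_s` in `L^p`. -/
theorem statement4 (n : ℕ) (hn : 0 < n) (p γ : ℝ) (hp : 1 < p)
    (hγ0 : 0 < γ) (hγ1 : γ ≤ 1) :
    ∃ C : ℝ, 0 < C ∧
      ∀ K : (Fin n → ℝ) → (Fin n → ℝ) → ℝ, IsNormalisedKernel n γ K →
      ∀ s : ℕ,
      ∀ (F : Finset (ℤ × (Fin n → ℤ) × (Fin n → Bool)))
        (c : ℤ × (Fin n → ℤ) × (Fin n → Bool) → ℝ),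
        (∀ q ∈ F, q.2.2 ≠ (fun _ => false)) →
      ∀ f : (Fin n → ℝ) → ℝ,
        (f = fun x => ∑ q ∈ F, c q * haarFn n q.1 q.2.1 q.2.2 x) →
        eLpNorm (PhiTildeNZ n K s f) (ENNReal.ofReal p) volume ≤
          ENNReal.ofReal
              (C * (1 + (s:ℝ)) * (2:ℝ) ^ (-(s:ℝ) * min γ (min (1/2) (1 - 1/p)))) *
            eLpNorm f (ENNReal.ofReal p) volume := by
  obtain ⟨C, hC⟩ := eLpNorm_phiTildeNZ_le hn hp hγ0 hγ1
  obtain ⟨A, hA⟩ := coeffBound_latCoeff hn hγ0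
  refine ⟨C * A + 1, by positivity, fun K hK s F c hF f hf => ?_⟩
  subst hf
  refine (hC K s A F c hF (hA K hK s)).trans (mul_le_mul_left ?_ _)
  have hs : (s : ENNReal) + 1 = ENNReal.ofReal (1 + (s:ℝ)) := by
    rw [ENNReal.ofReal_add zero_le_one (Nat.cast_nonneg s), ENNReal.ofReal_one,
      ENNReal.ofReal_natCast, add_comm]
  rw [← mul_assoc, ← mul_assoc, hs, ← ofReal_two_rpow, ← ENNReal.ofReal_coe_nnreal,
    ← ENNReal.ofReal_coe_nnreal, ← ENNReal.ofReal_mul (by positivity),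
    ← ENNReal.ofReal_mul (by positivity), ← ENNReal.ofReal_mul (by positivity), neg_mul,
    mul_comm (s:ℝ)]
  refine ENNReal.ofReal_le_ofReal ?_
  have : (C * A : ℝ) ≤ C * A + 1 := by linarith
  gcongr

end
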